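/- arXiv:1805.05729 — 11 statements merged into one kernel-verified Lean document; each statement's English description precedes it below -/
import Mathlib

section
/- Let d ≥ 1 and let f : ℝ^d → ℝ^d be any function. Suppose y : ℝ → ℝ^d is differentiable and satisfies y'(t) = f(y(t)) for all t ≥ 0. Define, for t in the half-open interval [0, π/2), u(t) = y(tan t) and v(t) = tan t. Then u(0) = y(0), v(0) = 0, and for every t ∈ [0, π/2) one has v'(t) = 1 + v(t)² and u'(t) = (1 + v(t)²) • f(u(t)). Consequently the entire unbounded time evolution of y on [0, ∞) is contracted into the bounded time interval [0, π/2) of the system (u, v). -/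
open Real Set in
/-- Space–time contraction of the half-line `[0, ∞)` into the bounded interval
`[0, π/2)`: if `y' = f(y)` for `t ≥ 0`, then `u(t) = y(tan t)`, `v(t) = tan t`
satisfy `v' = 1 + v²` and `u' = (1 + v²) • f(u)` on `[0, π/2)`. -/
theorem time_contraction_bounded_interval
    (d : ℕ) (hd : 1 ≤ d) (f : (Fin d → ℝ) → (Fin d → ℝ))
    (y : ℝ → (Fin d → ℝ)) (hydiff : Differentiable ℝ y)
    (hy : ∀ t : ℝ, 0 ≤ t → HasDerivAt y (f (y t)) t)
    (u : ℝ → (Fin d → ℝ)) (hu : ∀ t, u t = y (tan t))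
    (v : ℝ → ℝ) (hv : ∀ t, v t = tan t) :
    u 0 = y 0 ∧ v 0 = 0 ∧
      (∀ t ∈ Ico (0 : ℝ) (π / 2),
        HasDerivWithinAt v (1 + (v t) ^ 2) (Ico (0 : ℝ) (π / 2)) t) ∧
      (∀ t ∈ Ico (0 : ℝ) (π / 2),
        HasDerivWithinAt u ((1 + (v t) ^ 2) • f (u t)) (Ico (0 : ℝ) (π / 2)) t) := by
  obtain rfl : u = fun t => y (tan t) := funext hu
  obtain rfl : v = fun t => tan t := funext hv
  have key : ∀ t ∈ Ico (0 : ℝ) (π / 2), HasDerivAt (fun t => tan t) (1 + (tan t) ^ 2) t := by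
    intro t ht
    have hc : cos t ≠ 0 :=
      (cos_pos_of_mem_Ioo ⟨by linarith [ht.1, pi_pos], ht.2⟩).ne'
    have h := hasDerivAt_tan hc
    have e : 1 / cos t ^ 2 = 1 + tan t ^ 2 := by
      rw [tan_eq_sin_div_cos]
      field_simp
      linarith [sin_sq_add_cos_sq t]
    rw [e] at h
    exact h
  refine ⟨by simp, by simp, fun t ht => (key t ht).hasDerivWithinAt, fun t ht => ?_⟩
  have h0 : 0 ≤ tan t := tan_nonneg_of_nonneg_of_le_pi_div_two ht.1 ht.2.le
  exact (HasDerivAt.scomp t (hy _ h0) (key t ht)).hasDerivWithinAt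
end

section
/- If f : ℝ → ℝ and g : ℝ → ℝ are both GPAC-generable, then the functions f + g (i.e., t ↦ f(t) + g(t)) and f − g (i.e., t ↦ f(t) − g(t)) are GPAC-generable. -/
/-- A function `f : ℝ → ℝ` is GPAC-generable if it is the first component of a
solution of a polynomial initial value problem `y(0) = y₀`, `y' = p(y)` where
`p` is a vector of `d ≥ 1` multivariate polynomials with real coefficients. -/
def GPACGenerable (f : ℝ → ℝ) : Prop :=
  ∃ (d : ℕ) (p : Fin (d + 1) → MvPolynomial (Fin (d + 1)) ℝ)
    (y₀ : Fin (d + 1) → ℝ) (y : ℝ → (Fin (d + 1) → ℝ)),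
    y 0 = y₀ ∧
    (∀ t : ℝ, HasDerivAt y (fun i => MvPolynomial.eval (y t) (p i)) t) ∧
    (∀ t : ℝ, f t = y t 0)

/-- Linear combinations `f + c * g` of GPAC-generable functions are GPAC-generable. -/
theorem gpacGenerable_add_const_mul (c : ℝ) (f g : ℝ → ℝ)
    (hf : GPACGenerable f) (hg : GPACGenerable g) :
    GPACGenerable (fun t => f t + c * g t) := by
  obtain ⟨a, p, _, y, _, hy, hfy⟩ := hf
  obtain ⟨b, q, _, z, _, hz, hgz⟩ := hg
  let iL : Fin (a + 1) → Fin ((a + 1) + (b + 1) + 1) := fun i => (Fin.castAdd (b + 1) i).succ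
  let iR : Fin (b + 1) → Fin ((a + 1) + (b + 1) + 1) := fun i => (Fin.natAdd (a + 1) i).succ
  let P : Fin (a + 1) → MvPolynomial (Fin ((a + 1) + (b + 1) + 1)) ℝ :=
    fun i => MvPolynomial.rename iL (p i)
  let Q : Fin (b + 1) → MvPolynomial (Fin ((a + 1) + (b + 1) + 1)) ℝ :=
    fun i => MvPolynomial.rename iR (q i)
  let w : ℝ → (Fin ((a + 1) + (b + 1) + 1) → ℝ) := fun t =>
    Fin.cons (y t 0 + c * z t 0) (Fin.append (y t) (z t))
  have hL : ∀ t, w t ∘ iL = y t := by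
    intro t; funext i; simp [w, iL]
  have hR : ∀ t, w t ∘ iR = z t := by
    intro t; funext i; simp [w, iR]
  refine ⟨(a + 1) + (b + 1),
    Fin.cons (P 0 + MvPolynomial.C c * Q 0) (Fin.append P Q), w 0, w, rfl, ?_, ?_⟩
  · intro t
    have hy' := hasDerivAt_pi.1 (hy t)
    have hz' := hasDerivAt_pi.1 (hz t)
    rw [hasDerivAt_pi]
    intro i
    refine Fin.cases ?_ (fun j => ?_) i
    · simpa [w, P, Q, MvPolynomial.eval_rename, hL, hR] using
        (hy' 0).fun_add ((hz' 0).const_mul c)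
    · refine Fin.addCases (fun k => ?_) (fun k => ?_) j
      · have h := hy' k
        rw [← hL t] at h
        simpa [w, P, MvPolynomial.eval_rename] using h
      · have h := hz' k
        rw [← hR t] at h
        simpa [w, Q, MvPolynomial.eval_rename] using h
  · intro t
    simp [w, hfy, hgz]

/-- Closure of GPAC-generable functions under addition and subtraction. -/
theorem gpacGenerable_add_sub (f g : ℝ → ℝ)
    (hf : GPACGenerable f) (hg : GPACGenerable g) :
    GPACGenerable (fun t => f t + g t) ∧ GPACGenerable (fun t => f t - g t) := by
  constructor
  · simpa using gpacGenerable_add_const_mul 1 f g hf hg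
  · simpa [sub_eq_add_neg] using gpacGenerable_add_const_mul (-1) f g hf hg
end

section
/- If f : ℝ → ℝ and g : ℝ → ℝ are both GPAC-generable, then the product function f·g (i.e., t ↦ f(t)·g(t)) is GPAC-generable. -/
/-- Closure of GPAC-generable functions under multiplication. -/
theorem gpacGenerable_mul (f g : ℝ → ℝ)
    (hf : GPACGenerable f) (hg : GPACGenerable g) :
    GPACGenerable (fun t => f t * g t) := by
  obtain ⟨d, p, _, y, -, hy, hfy⟩ := hf
  obtain ⟨e, q, _, z, -, hz, hgz⟩ := hg
  let a : Fin (d + 1) → Fin ((d + 1) + (e + 1) + 1) := fun i => (Fin.castAdd (e + 1) i).succ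
  let b : Fin (e + 1) → Fin ((d + 1) + (e + 1) + 1) := fun i => (Fin.natAdd (d + 1) i).succ
  let w : ℝ → Fin ((d + 1) + (e + 1) + 1) → ℝ :=
    fun t => Fin.cons (y t 0 * z t 0) (Fin.append (y t) (z t))
  have hwa : ∀ t, w t ∘ a = y t := by
    intro t; funext i; simp [w, a]
  have hwb : ∀ t, w t ∘ b = z t := by
    intro t; funext i; simp [w, b]
  have hwa' : ∀ t i, w t (a i) = y t i := fun t i => congrFun (hwa t) i
  have hwb' : ∀ t i, w t (b i) = z t i := fun t i => congrFun (hwb t) i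
  let r : Fin ((d + 1) + (e + 1) + 1) → MvPolynomial (Fin ((d + 1) + (e + 1) + 1)) ℝ :=
    Fin.cons (MvPolynomial.rename a (p 0) * MvPolynomial.X (b 0)
        + MvPolynomial.X (a 0) * MvPolynomial.rename b (q 0))
      (Fin.append (fun i => MvPolynomial.rename a (p i)) (fun i => MvPolynomial.rename b (q i)))
  refine ⟨(d + 1) + (e + 1), r, w 0, w, rfl, ?_, ?_⟩
  · intro t
    have hy' := hasDerivAt_pi.1 (hy t)
    have hz' := hasDerivAt_pi.1 (hz t)
    rw [hasDerivAt_pi]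
    intro i
    refine Fin.cases ?_ (fun j => ?_) i
    · have h := (hy' 0).mul (hz' 0)
      have hr : MvPolynomial.eval (w t) (r 0) =
          MvPolynomial.eval (y t) (p 0) * z t 0 + y t 0 * MvPolynomial.eval (z t) (q 0) := by
        simp only [r, Fin.cons_zero, map_add, map_mul, MvPolynomial.eval_rename,
          MvPolynomial.eval_X, hwa, hwb, hwa', hwb']
      rw [hr]
      exact h
    · refine Fin.addCases (fun k => ?_) (fun k => ?_) j
      · have hr : MvPolynomial.eval (w t) (r (Fin.castAdd (e + 1) k).succ) =
            MvPolynomial.eval (y t) (p k) := by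
          simp only [r, Fin.cons_succ, Fin.append_left, MvPolynomial.eval_rename, hwa]
        rw [hr]
        exact (hy' k).congr_of_eventuallyEq (Filter.Eventually.of_forall fun s => hwa' s k)
      · have hr : MvPolynomial.eval (w t) (r (Fin.natAdd (d + 1) k).succ) =
            MvPolynomial.eval (z t) (q k) := by
          simp only [r, Fin.cons_succ, Fin.append_right, MvPolynomial.eval_rename, hwb]
        rw [hr]
        exact (hz' k).congr_of_eventuallyEq (Filter.Eventually.of_forall fun s => hwb' s k)
  · intro t
    simp [w, hfy, hgz]
end

section
/- If f : ℝ → ℝ and g : ℝ → ℝ are both GPAC-generable, then the composition f ∘ g (i.e., t ↦ f(g(t))) is GPAC-generable. -/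
/-- Closure of GPAC-generable functions under composition. -/
theorem gpacGenerable_comp (f g : ℝ → ℝ)
    (hf : GPACGenerable f) (hg : GPACGenerable g) :
    GPACGenerable (fun t => f (g t)) := by
  obtain ⟨d, p, y₀, y, -, hy, hfy⟩ := hf
  obtain ⟨e, q, z₀, z, -, hz, hgz⟩ := hg
  let w : ℝ → (Fin (d + 1 + (e + 1)) → ℝ) := fun t => Fin.append (y (z t 0)) (z t)
  let P : Fin (d + 1 + (e + 1)) → MvPolynomial (Fin (d + 1 + (e + 1))) ℝ :=
    Fin.append
      (fun i => MvPolynomial.rename (Fin.castAdd (e + 1)) (p i) *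
        MvPolynomial.rename (Fin.natAdd (d + 1)) (q 0))
      (fun j => MvPolynomial.rename (Fin.natAdd (d + 1)) (q j))
  have hl : ∀ t, w t ∘ Fin.castAdd (e + 1) = y (z t 0) := by
    intro t
    funext i
    simp [w]
  have hr : ∀ t, w t ∘ Fin.natAdd (d + 1) = z t := by
    intro t
    funext i
    simp [w]
  refine ⟨d + 1 + e, P, w 0, w, rfl, ?_, ?_⟩
  · intro t
    have hzi := hasDerivAt_pi.1 (hz t)
    have hyi := hasDerivAt_pi.1 (hy (z t 0))
    have key : ∀ i : Fin (d + 1 + (e + 1)),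
        HasDerivAt (fun s => w s i) (MvPolynomial.eval (w t) (P i)) t := by
      intro i
      refine Fin.addCases (fun i => ?_) (fun j => ?_) i
      · have h := (hyi i).comp t (hzi 0)
        simpa [P, w, MvPolynomial.eval_rename, hl, hr, Function.comp_def] using h
      · have h := hzi j
        simpa [P, w, MvPolynomial.eval_rename, hl, hr, Function.comp_def] using h
    exact hasDerivAt_pi.2 key
  · intro t
    have h := congrFun (hl t) 0
    change f (g t) = w t (Fin.castAdd (e + 1) 0)
    rw [hfy, hgz]
    exact h.symm
end

section
/- If f : ℝ → ℝ and g : ℝ → ℝ are both GPAC-generable and g(t) ≠ 0 for every t ∈ ℝ, then the quotient function f/g (i.e., t ↦ f(t)/g(t)) is GPAC-generable. -/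
/-- A polynomial system indexed by any finite type yields a GPAC-generable function. -/
theorem gpacGenerable_of_fintype {ι : Type} [Fintype ι] (i₀ : ι)
    (P : ι → MvPolynomial ι ℝ) (z : ℝ → ι → ℝ)
    (hz : ∀ t i, HasDerivAt (fun s => z s i) (MvPolynomial.eval (z t) (P i)) t) :
    GPACGenerable (fun t => z t i₀) := by
  classical
  obtain ⟨d, hd⟩ : ∃ d, Fintype.card ι = d + 1 :=
    Nat.exists_eq_succ_of_ne_zero (Fintype.card_pos_iff.mpr ⟨i₀⟩).ne'
  let e₁ : ι ≃ Fin (d + 1) := Fintype.equivFinOfCardEq hd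
  let e : ι ≃ Fin (d + 1) := e₁.trans (Equiv.swap (e₁ i₀) 0)
  have he : e.symm 0 = i₀ := by
    rw [Equiv.symm_apply_eq]
    simp [e]
  refine ⟨d, fun k => MvPolynomial.rename e (P (e.symm k)), _,
    fun t k => z t (e.symm k), rfl, ?_, ?_⟩
  · intro t
    rw [hasDerivAt_pi]
    intro k
    have h := hz t (e.symm k)
    rw [MvPolynomial.eval_rename]
    have : ((fun k => z t (e.symm k)) ∘ e) = z t := by
      funext i
      simp
    rw [this]
    exact h
  · intro t
    simp [he]

/-- Closure of GPAC-generable functions under division (when the denominator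
never vanishes). -/
theorem gpacGenerable_div (f g : ℝ → ℝ)
    (hf : GPACGenerable f) (hg : GPACGenerable g) (hg0 : ∀ t : ℝ, g t ≠ 0) :
    GPACGenerable (fun t => f t / g t) := by
  obtain ⟨a, p, _, y, -, hy, hfy⟩ := hf
  obtain ⟨b, r, _, w, -, hw, hgw⟩ := hg
  let ι := Fin (a + 1) ⊕ (Fin (b + 1) ⊕ Bool)
  let A : Fin (a + 1) → MvPolynomial ι ℝ := fun i => MvPolynomial.rename Sum.inl (p i)
  let B : Fin (b + 1) → MvPolynomial ι ℝ :=
    fun i => MvPolynomial.rename (fun j => Sum.inr (Sum.inl j)) (r i)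
  let H : MvPolynomial ι ℝ := MvPolynomial.X (Sum.inr (Sum.inr false))
  let F : MvPolynomial ι ℝ := MvPolynomial.X (Sum.inl 0)
  let P : ι → MvPolynomial ι ℝ := Sum.elim A (Sum.elim B
    (fun c => if c then A 0 * H - F * B 0 * H ^ 2 else - B 0 * H ^ 2))
  let z : ℝ → ι → ℝ := fun t => Sum.elim (y t) (Sum.elim (w t)
    (fun c => if c then f t / g t else (g t)⁻¹))
  have hA : ∀ t i, MvPolynomial.eval (z t) (A i) = MvPolynomial.eval (y t) (p i) := by
    intro t i
    simp only [A, MvPolynomial.eval_rename]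
    rfl
  have hB : ∀ t i, MvPolynomial.eval (z t) (B i) = MvPolynomial.eval (w t) (r i) := by
    intro t i
    simp only [B, MvPolynomial.eval_rename]
    rfl
  have hH : ∀ t, MvPolynomial.eval (z t) H = (g t)⁻¹ := by
    intro t
    simp [H, z]
  have hF : ∀ t, MvPolynomial.eval (z t) F = f t := by
    intro t
    simp [F, z, hfy]
  have hf' : ∀ t, HasDerivAt f (MvPolynomial.eval (y t) (p 0)) t := by
    intro t
    rw [funext hfy]
    exact hasDerivAt_pi.mp (hy t) 0
  have hg' : ∀ t, HasDerivAt g (MvPolynomial.eval (w t) (r 0)) t := by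
    intro t
    rw [funext hgw]
    exact hasDerivAt_pi.mp (hw t) 0
  refine gpacGenerable_of_fintype (ι := ι) (Sum.inr (Sum.inr true)) P z ?_
  rintro t (i | i | (_ | _))
  · change HasDerivAt (fun s => y s i) (MvPolynomial.eval (z t) (A i)) t
    rw [hA]
    exact hasDerivAt_pi.mp (hy t) i
  · change HasDerivAt (fun s => w s i) (MvPolynomial.eval (z t) (B i)) t
    rw [hB]
    exact hasDerivAt_pi.mp (hw t) i
  · change HasDerivAt (fun s => (g s)⁻¹) (MvPolynomial.eval (z t) (- B 0 * H ^ 2)) t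
    simp only [map_mul, map_neg, map_pow, hB, hH]
    refine HasDerivAt.congr_deriv ((hg' t).fun_inv (hg0 t)) ?_
    have := hg0 t
    field_simp
  · change HasDerivAt (fun s => f s / g s)
      (MvPolynomial.eval (z t) (A 0 * H - F * B 0 * H ^ 2)) t
    simp only [map_mul, map_sub, map_pow, hA, hB, hH, hF]
    refine HasDerivAt.congr_deriv ((hf' t).fun_div (hg' t) (hg0 t)) ?_
    have := hg0 t
    field_simp
end

section
/- If f : ℝ → ℝ is GPAC-generable and z : ℝ → ℝ is a differentiable function satisfying the differential equation z'(t) = f(z(t)) for all t ∈ ℝ, then z is GPAC-generable. -/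
/-- If `f` is GPAC-generable and `z` is a differentiable solution of the ODE
`z' = f(z)`, then `z` is GPAC-generable. -/
theorem gpacGenerable_ode (f : ℝ → ℝ) (hf : GPACGenerable f)
    (z : ℝ → ℝ) (hz : ∀ t : ℝ, HasDerivAt z (f (z t)) t) :
    GPACGenerable z := by
  obtain ⟨d, p, y₀, y, -, hy, hf⟩ := hf
  refine ⟨d + 1, Fin.cons (MvPolynomial.X 1)
    (fun i => MvPolynomial.rename Fin.succ (p i) * MvPolynomial.X 1),
    _, fun t => Fin.cons (z t) (y (z t)), rfl, ?_, fun t => rfl⟩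
  intro t
  rw [hasDerivAt_pi]
  intro i
  have h1 : (Fin.cons (z t) (y (z t)) : Fin (d + 1 + 1) → ℝ) 1 = f (z t) := by
    rw [hf]; rfl
  refine Fin.cases ?_ (fun j => ?_) i
  · simp only [Fin.cons_zero, MvPolynomial.eval_X, h1]
    exact hz t
  · simp only [Fin.cons_succ, map_mul, MvPolynomial.eval_X, h1, MvPolynomial.eval_rename]
    have h2 : (Fin.cons (z t) (y (z t)) : Fin (d + 1 + 1) → ℝ) ∘ Fin.succ = y (z t) := by
      funext k; simp
    rw [h2]
    exact ((hasDerivAt_pi.1 (hy (z t))) j).comp t (hz t)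
end

section
/- If f : ℝ → ℝ is GPAC-generable, then f is infinitely differentiable on ℝ and there exist n ∈ ℕ and a nonzero polynomial P in n + 1 variables with real coefficients such that for every t ∈ ℝ, P(f(t), f'(t), f''(t), …, f⁽ⁿ⁾(t)) = 0, where f⁽ᵏ⁾ denotes the k-th iterated derivative of f. In other words, every GPAC-generable function is differentially algebraic (solution of a polynomial differential algebraic equation). -/
/-- Chain rule along a solution of the polynomial ODE. -/
theorem gpac_hasDerivAt_eval {m : ℕ} (p : Fin m → MvPolynomial (Fin m) ℝ)
    (y : ℝ → (Fin m → ℝ))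
    (hy : ∀ t : ℝ, HasDerivAt y (fun i => MvPolynomial.eval (y t) (p i)) t)
    (q : MvPolynomial (Fin m) ℝ) (t : ℝ) :
    HasDerivAt (fun s => MvPolynomial.eval (y s) q)
      (MvPolynomial.eval (y t) (MvPolynomial.mkDerivation ℝ p q)) t := by
  induction q using MvPolynomial.induction_on with
  | C a => simpa using hasDerivAt_const t a
  | add q r hq hr => simpa using hq.fun_add hr
  | mul_X q i hq =>
    have h := hq.mul (hasDerivAt_pi.1 (hy t) i)
    have e : (fun s => MvPolynomial.eval (y s) (q * MvPolynomial.X i)) =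
        (fun s => MvPolynomial.eval (y s) q) * fun s => y s i := by
      ext s; simp
    rw [e]
    refine HasDerivAt.congr_deriv h ?_
    simp [MvPolynomial.mkDerivation_X]
    ring

/-- More polynomials than variables are algebraically dependent. -/
theorem gpac_exists_relation {m : ℕ} (q : Fin (m + 1) → MvPolynomial (Fin m) ℝ) :
    ∃ P : MvPolynomial (Fin (m + 1)) ℝ, P ≠ 0 ∧ MvPolynomial.aeval q P = 0 := by
  by_contra! hcon
  have hind : AlgebraicIndependent ℝ q := by
    rw [algebraicIndependent_iff]
    intro P hP
    by_contra hne
    exact hcon P hne hP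
  have h := hind.cardinalMk_le_trdeg
  rw [MvPolynomial.trdeg_of_isDomain] at h
  simp only [Cardinal.mk_fin, Cardinal.lift_natCast] at h
  have h' : m + 1 ≤ m := by exact_mod_cast h
  omega

/-- Shannon's theorem: every GPAC-generable function is infinitely
differentiable and differentially algebraic, i.e. satisfies a polynomial
differential algebraic equation `P(f, f', …, f⁽ⁿ⁾) = 0`. -/
theorem gpacGenerable_differentially_algebraic (f : ℝ → ℝ)
    (hf : GPACGenerable f) :
    ContDiff ℝ (⊤ : ℕ∞) f ∧
      ∃ (n : ℕ) (P : MvPolynomial (Fin (n + 1)) ℝ), P ≠ 0 ∧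
        ∀ t : ℝ,
          MvPolynomial.eval (fun k : Fin (n + 1) => iteratedDeriv k f t) P = 0 := by
  obtain ⟨d, p, y₀, y, -, hy, hfy⟩ := hf
  set D := MvPolynomial.mkDerivation ℝ p with hD
  have key : ∀ k : ℕ, iteratedDeriv k f =
      fun t => MvPolynomial.eval (y t) ((fun q => D q)^[k] (MvPolynomial.X 0)) := by
    intro k
    induction k with
    | zero => ext t; simp [hfy]
    | succ k ih =>
      rw [iteratedDeriv_succ, ih]
      ext t
      rw [(gpac_hasDerivAt_eval p y hy _ t).deriv, Function.iterate_succ_apply']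
  refine ⟨?_, ?_⟩
  · apply contDiff_of_differentiable_iteratedDeriv
    intro k _
    rw [key]
    exact fun t => (gpac_hasDerivAt_eval p y hy _ t).differentiableAt
  · obtain ⟨P, hP0, hP⟩ := gpac_exists_relation
      (fun k : Fin (d + 1 + 1) => (fun q => D q)^[(k : ℕ)] (MvPolynomial.X 0))
    refine ⟨d + 1, P, hP0, fun t => ?_⟩
    have h := congrArg (MvPolynomial.aeval (R := ℝ) (y t)) hP
    rw [map_zero, MvPolynomial.comp_aeval_apply] at h
    simp only [key]
    simpa [MvPolynomial.aeval_eq_eval] using h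
end

section
/- There exists a nonzero polynomial P in 5 variables with real coefficients (corresponding to a polynomial differential algebraic equation of order 4) with the following universality property: for every continuous function f : ℝ → ℝ and every continuous function ε : ℝ → ℝ with ε(t) > 0 for all t, there exists an infinitely differentiable function y : ℝ → ℝ such that P(y(t), y'(t), y''(t), y'''(t), y''''(t)) = 0 for all t ∈ ℝ and |y(t) − f(t)| < ε(t) for all t ∈ ℝ. -/
open Set Filter Topology

namespace RubelAux

/-- The differential polynomial, in the first four derivatives of the unknown function. -/
def R {A : Type*} [CommRing A] (g0 g1 g2 g3 : A) : A :=
  let U := g1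
  let V := g0 * g2 - g1 ^ 2
  let W := g3 * g0 ^ 2 - 3 * g0 * g1 * g2 + 2 * g1 ^ 3
  let N := W * U + 4 * V * U ^ 2
  let K := 4 * V ^ 2 + 4 * V * U ^ 2 - 3 * W * U
  3 * N ^ 2 * U ^ 2 - 2 * (U ^ 2 + V) * N * K - U ^ 2 * K ^ 2

noncomputable def P : MvPolynomial (Fin 5) ℝ :=
  R (MvPolynomial.X 1) (MvPolynomial.X 2) (MvPolynomial.X 3) (MvPolynomial.X 4)

theorem eval_P (v : Fin 5 → ℝ) : MvPolynomial.eval v P = R (v 1) (v 2) (v 3) (v 4) := by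
  simp [P, R]

theorem P_ne_zero : P ≠ 0 := by
  intro h
  have := eval_P ![0, 1, 1, 2, 4]
  rw [h] at this
  simp [R] at this
  norm_num at this

/-- The ODE for `y` at the point `t`. -/
def Ode (y : ℝ → ℝ) (t : ℝ) : Prop :=
  R (iteratedDeriv 1 y t) (iteratedDeriv 2 y t) (iteratedDeriv 3 y t) (iteratedDeriv 4 y t) = 0

theorem Ode.congr {y z : ℝ → ℝ} {t : ℝ} (h : y =ᶠ[𝓝 t] z) (hz : Ode z t) : Ode y t := by
  unfold Ode at *
  rwa [h.iteratedDeriv_eq, h.iteratedDeriv_eq, h.iteratedDeriv_eq, h.iteratedDeriv_eq]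

theorem Ode.const (c t : ℝ) : Ode (fun _ => c) t := by
  simp [Ode, iteratedDeriv_const, R]

theorem continuous_ode {y : ℝ → ℝ} (hy : ContDiff ℝ (⊤ : ℕ∞) y) :
    Continuous (fun t => R (iteratedDeriv 1 y t) (iteratedDeriv 2 y t)
      (iteratedDeriv 3 y t) (iteratedDeriv 4 y t)) := by
  have h : ∀ k : ℕ, Continuous (iteratedDeriv k y) := fun k =>
    hy.continuous_iteratedDeriv k (by exact_mod_cast le_top)
  have h1 := h 1
  have h2 := h 2
  have h3 := h 3
  have h4 := h 4
  unfold R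
  fun_prop

theorem ode_of_finite {y : ℝ → ℝ} (hy : ContDiff ℝ (⊤ : ℕ∞) y) (s : Set ℝ) (hs : s.Finite)
    (h : ∀ t ∉ s, Ode y t) (t : ℝ) : Ode y t := by
  have hd : Dense sᶜ := hs.countable.dense_compl ℝ
  have := Continuous.ext_on hd (continuous_ode hy) (continuous_const (y := (0 : ℝ)))
    (fun x hx => h x hx)
  exact congrFun this t

theorem concat {y z : ℝ → ℝ} {b c : ℝ} (hy : ContDiff ℝ (⊤ : ℕ∞) y)
    (hz : ContDiff ℝ (⊤ : ℕ∞) z) (oy : ∀ t, Ode y t) (oz : ∀ t, Ode z t)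
    (hyc : ∀ t, b ≤ t → y t = c) (hzc : ∀ t, t ≤ b → z t = c) (t : ℝ) :
    Ode (fun t => y t + z t - c) t := by
  refine ode_of_finite (by fun_prop) {b} (finite_singleton b) ?_ t
  intro x hx
  rcases lt_or_gt_of_ne (show x ≠ b from hx) with h | h
  · refine Ode.congr ?_ (oy x)
    filter_upwards [Iio_mem_nhds h] with u hu
    rw [hzc u (le_of_lt hu)]; ring
  · refine Ode.congr ?_ (oz x)
    filter_upwards [Ioi_mem_nhds h] with u hu
    rw [hyc u (le_of_lt hu)]; ring

/-! ### The bump function -/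

noncomputable def G (t : ℝ) : ℝ := expNegInvGlue (1 - t ^ 2)

theorem G_contDiff : ContDiff ℝ (⊤ : ℕ∞) G :=
  expNegInvGlue.contDiff.comp (by fun_prop)

theorem G_nonneg (t : ℝ) : 0 ≤ G t := expNegInvGlue.nonneg _

theorem G_zero {t : ℝ} (h : 1 ≤ t ^ 2) : G t = 0 :=
  expNegInvGlue.zero_of_nonpos (by linarith)

noncomputable def E (t : ℝ) : ℝ := Real.exp (-(1 - t ^ 2)⁻¹)
noncomputable def U (t : ℝ) : ℝ := -2 * t / (1 - t ^ 2) ^ 2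
noncomputable def V (t : ℝ) : ℝ := -2 * (1 + 3 * t ^ 2) / (1 - t ^ 2) ^ 3
noncomputable def W (t : ℝ) : ℝ := -24 * t * (1 + t ^ 2) / (1 - t ^ 2) ^ 4

theorem hasD (t : ℝ) : HasDerivAt (fun t : ℝ => 1 - t ^ 2) (-(2 * t)) t := by
  simpa using (hasDerivAt_pow 2 t).const_sub 1

theorem hasE {t : ℝ} (ht : 1 - t ^ 2 ≠ 0) : HasDerivAt E (E t * U t) t := by
  have := (((hasD t).fun_inv ht).fun_neg).exp
  refine HasDerivAt.congr_deriv this ?_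
  simp only [E, U]
  congr 1
  ring

theorem hasU {t : ℝ} (ht : 1 - t ^ 2 ≠ 0) : HasDerivAt U (V t) t := by
  have := ((hasDerivAt_id' t).const_mul (-2)).fun_div ((hasD t).fun_pow 2) (pow_ne_zero 2 ht)
  refine HasDerivAt.congr_deriv this ?_
  simp only [V]
  field_simp
  ring

theorem hasV {t : ℝ} (ht : 1 - t ^ 2 ≠ 0) : HasDerivAt V (W t) t := by
  have := (((((hasDerivAt_pow 2 t).const_mul 3).const_add 1)).const_mul (-2)).fun_div
    ((hasD t).fun_pow 3) (pow_ne_zero 3 ht)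
  refine HasDerivAt.congr_deriv this ?_
  simp only [W]
  field_simp
  ring

theorem step {g h h' : ℝ → ℝ} {s : Set ℝ} (hs : IsOpen s) (e : ∀ t ∈ s, g t = h t)
    (d : ∀ t ∈ s, HasDerivAt h (h' t) t) : ∀ t ∈ s, deriv g t = h' t := by
  intro t ht
  have : g =ᶠ[𝓝 t] h := by
    filter_upwards [hs.mem_nhds ht] with u hu using e u hu
  rw [this.deriv_eq, (d t ht).deriv]

theorem R_formula {e t : ℝ} (ht : 1 - t ^ 2 ≠ 0) :
    R e (e * U t) (e * (U t ^ 2 + V t)) (e * (U t ^ 3 + 3 * U t * V t + W t)) = 0 := by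
  have h1 : 3 * (t ^ 2) ^ 2 * U t ^ 2 - 2 * (U t ^ 2 + V t) * t ^ 2 - U t ^ 2 = 0 := by
    simp only [U, V]
    field_simp
    ring
  have h2 : W t * U t + 4 * V t * U t ^ 2
      = t ^ 2 * (4 * V t ^ 2 + 4 * V t * U t ^ 2 - 3 * W t * U t) := by
    simp only [U, V, W]
    field_simp
    ring
  generalize U t = u at *
  generalize V t = v at *
  generalize W t = w at *
  have : R e (e * u) (e * (u ^ 2 + v)) (e * (u ^ 3 + 3 * u * v + w)) = e ^ 10 *
    (3 * (w * u + 4 * v * u ^ 2) ^ 2 * u ^ 2 - 2 * (u ^ 2 + v) * (w * u + 4 * v * u ^ 2) *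
      (4 * v ^ 2 + 4 * v * u ^ 2 - 3 * w * u)
      - u ^ 2 * (4 * v ^ 2 + 4 * v * u ^ 2 - 3 * w * u) ^ 2) := by
    simp only [R]; ring
  rw [this, h2]
  linear_combination e ^ 10 * (4 * v ^ 2 + 4 * v * u ^ 2 - 3 * w * u) ^ 2 * h1

theorem G_inside {t : ℝ} (ht : t ∈ Ioo (-1 : ℝ) 1) :
    R (G t) (iteratedDeriv 1 G t) (iteratedDeriv 2 G t) (iteratedDeriv 3 G t) = 0 := by
  have hD : ∀ u ∈ Ioo (-1 : ℝ) 1, 0 < 1 - u ^ 2 := by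
    intro u hu
    nlinarith [hu.1, hu.2]
  have e0 : ∀ u ∈ Ioo (-1 : ℝ) 1, G u = E u := by
    intro u hu
    simp [G, expNegInvGlue, E, not_le.mpr (hD u hu)]
  have e1 := step isOpen_Ioo e0 (fun u hu => hasE (hD u hu).ne')
  have e2 : ∀ u ∈ Ioo (-1 : ℝ) 1, deriv (deriv G) u = E u * (U u ^ 2 + V u) := by
    refine step isOpen_Ioo e1 (fun u hu => ?_)
    have h := (hD u hu).ne'
    refine ((hasE h).fun_mul (hasU h)).congr_deriv ?_
    ring
  have e3 : ∀ u ∈ Ioo (-1 : ℝ) 1, deriv (deriv (deriv G)) u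
      = E u * (U u ^ 3 + 3 * U u * V u + W u) := by
    refine step isOpen_Ioo e2 (fun u hu => ?_)
    have h := (hD u hu).ne'
    refine ((hasE h).fun_mul (((hasU h).fun_pow 2).fun_add (hasV h))).congr_deriv ?_
    simp
    ring
  have i3 : iteratedDeriv 3 G = deriv (deriv (deriv G)) := by
    simp [iteratedDeriv_succ, iteratedDeriv_zero]
  have i2 : iteratedDeriv 2 G = deriv (deriv G) := by
    simp [iteratedDeriv_succ, iteratedDeriv_zero]
  rw [i3, i2, iteratedDeriv_one, e0 t ht, e1 t ht, e2 t ht, e3 t ht]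
  exact R_formula (hD t ht).ne'

/-! ### The step function -/

noncomputable def I (t : ℝ) : ℝ := ∫ x in (-1 : ℝ)..t, G x

theorem hasI (t : ℝ) : HasDerivAt I (G t) t :=
  (G_contDiff.continuous).integral_hasStrictDerivAt (-1) t |>.hasDerivAt

theorem deriv_I : deriv I = G := funext fun t => (hasI t).deriv

theorem I_contDiff : ContDiff ℝ (⊤ : ℕ∞) I := by
  rw [contDiff_infty_iff_deriv, deriv_I]
  exact ⟨fun t => (hasI t).differentiableAt, G_contDiff⟩

theorem I_mono : Monotone I :=
  monotone_of_deriv_nonneg (fun t => (hasI t).differentiableAt)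
    (fun t => by rw [deriv_I]; exact G_nonneg t)

theorem I_left {t : ℝ} (ht : t ≤ -1) : I t = 0 := by
  unfold I
  rw [intervalIntegral.integral_congr (g := fun _ => (0 : ℝ))]
  · simp
  · intro x hx
    rw [uIcc_of_ge ht] at hx
    exact G_zero (by nlinarith [hx.2])

theorem I_right {t : ℝ} (ht : 1 ≤ t) : I t = I 1 := by
  have hc := G_contDiff.continuous
  have h := intervalIntegral.integral_add_adjacent_intervals
    (hc.intervalIntegrable (μ := MeasureTheory.volume) (-1) 1) (hc.intervalIntegrable 1 t)
  have h0 : ∫ x in (1 : ℝ)..t, G x = 0 := by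
    rw [intervalIntegral.integral_congr (g := fun _ => (0 : ℝ))]
    · simp
    · intro x hx
      rw [uIcc_of_le ht] at hx
      exact G_zero (by nlinarith [hx.1])
  unfold I
  linarith

theorem I_one_pos : 0 < I 1 := by
  refine intervalIntegral.intervalIntegral_pos_of_pos_on
    (G_contDiff.continuous.intervalIntegrable _ _) ?_ (by norm_num)
  intro x hx
  exact expNegInvGlue.pos_of_pos (by nlinarith [hx.1, hx.2])

theorem I_ode (t : ℝ) : Ode I t := by
  refine ode_of_finite I_contDiff {-1, 1} (by simp) ?_ t
  intro x hx
  simp only [mem_insert_iff, mem_singleton_iff, not_or] at hx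
  rcases lt_or_gt_of_ne hx.1 with h | h
  · refine Ode.congr ?_ (Ode.const 0 x)
    filter_upwards [Iio_mem_nhds h] with u hu using I_left (le_of_lt hu)
  rcases lt_or_gt_of_ne hx.2 with h' | h'
  · have := G_inside ⟨h, h'⟩
    unfold Ode
    rw [iteratedDeriv_succ' (n := 3), iteratedDeriv_succ' (n := 2), iteratedDeriv_succ' (n := 1),
      iteratedDeriv_one, deriv_I]
    exact this
  · refine Ode.congr ?_ (Ode.const (I 1) x)
    filter_upwards [Ioi_mem_nhds h'] with u hu using I_right (le_of_lt hu)

theorem affine_deriv (A B α β : ℝ) (k : ℕ) (t : ℝ) :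
    iteratedDeriv (k + 1) (fun t => A + B * I (α * t + β)) t
      = B * (α ^ (k + 1) * iteratedDeriv (k + 1) I (α * t + β)) := by
  have hI : ∀ k : ℕ, Differentiable ℝ (iteratedDeriv k I) := fun k =>
    I_contDiff.differentiable_iteratedDeriv k (by exact_mod_cast ENat.natCast_lt_top k)
  have key : ∀ k : ℕ, ∀ t, HasDerivAt (fun t => iteratedDeriv k I (α * t + β))
      (iteratedDeriv (k + 1) I (α * t + β) * α) t := by
    intro k t
    have h1 : HasDerivAt (fun t => α * t + β) α t := by
      simpa using ((hasDerivAt_id' t).const_mul α).add_const β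
    have h2 : HasDerivAt (iteratedDeriv k I) (iteratedDeriv (k + 1) I (α * t + β)) (α * t + β) := by
      rw [iteratedDeriv_succ]
      exact (hI k _).hasDerivAt
    exact HasDerivAt.comp t h2 h1
  induction k generalizing t with
  | zero =>
    have := ((key 0 t).const_mul B).const_add A
    rw [iteratedDeriv_one]
    simp only [iteratedDeriv_zero] at this
    rw [this.deriv]
    ring
  | succ k ih =>
    rw [iteratedDeriv_succ, funext ih]
    rw [(((key (k + 1) t).const_mul (α ^ (k + 1))).const_mul B).deriv]
    ring

theorem affine_ode (A B α β : ℝ) (t : ℝ) : Ode (fun t => A + B * I (α * t + β)) t := by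
  have h := I_ode (α * t + β)
  unfold Ode at *
  rw [affine_deriv A B α β 0, affine_deriv A B α β 1, affine_deriv A B α β 2,
    affine_deriv A B α β 3]
  norm_num only [zero_add, Nat.reduceAdd]
  generalize iteratedDeriv 1 I (α * t + β) = a at *
  generalize iteratedDeriv 2 I (α * t + β) = b at *
  generalize iteratedDeriv 3 I (α * t + β) = c at *
  generalize iteratedDeriv 4 I (α * t + β) = d at *
  have : R (B * (α ^ 1 * a)) (B * (α ^ 2 * b)) (B * (α ^ 3 * c)) (B * (α ^ 4 * d))
      = B ^ 10 * α ^ 20 * R a b c d := by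
    simp only [R]; ring
  rw [this, h, mul_zero]

/-! ### Approximation on intervals -/

def Good (f ε : ℝ → ℝ) (a b : ℝ) : Prop :=
  ∃ y : ℝ → ℝ, ContDiff ℝ (⊤ : ℕ∞) y ∧ (∀ t, Ode y t) ∧ (∀ t, t ≤ a → y t = f a) ∧
    (∀ t, b ≤ t → y t = f b) ∧ ∀ t ∈ Icc a b, |y t - f t| < ε t

theorem Good.refl {f ε : ℝ → ℝ} (hε : ∀ t, 0 < ε t) (a : ℝ) : Good f ε a a := by
  refine ⟨fun _ => f a, contDiff_const, Ode.const _, fun _ _ => rfl, fun _ _ => rfl, ?_⟩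
  intro t ht
  have : t = a := le_antisymm ht.2 ht.1
  subst this
  simpa using hε t

theorem Good.trans {f ε : ℝ → ℝ} {a b c : ℝ} (hab : a ≤ b) (hbc : b ≤ c)
    (h1 : Good f ε a b) (h2 : Good f ε b c) : Good f ε a c := by
  obtain ⟨y, y1, y2, y3, y4, y5⟩ := h1
  obtain ⟨z, z1, z2, z3, z4, z5⟩ := h2
  refine ⟨fun t => y t + z t - f b, by fun_prop, concat y1 z1 y2 z2 y4 z3, ?_, ?_, ?_⟩
  · intro t ht
    simp only
    rw [y3 t ht, z3 t (ht.trans hab)]; ring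
  · intro t ht
    simp only
    rw [y4 t (hbc.trans ht), z4 t ht]; ring
  · intro t ht
    simp only
    rcases le_total t b with h | h
    · rw [z3 t h, add_sub_cancel_right]
      exact y5 t ⟨ht.1, h⟩
    · rw [y4 t h, add_sub_cancel_left]
      exact z5 t ⟨h, ht.2⟩

theorem good_local {f ε : ℝ → ℝ} {a b : ℝ} (hab : a < b)
    (h : ∀ s ∈ Icc a b, ∀ t ∈ Icc a b, |f s - f t| < ε t) : Good f ε a b := by
  have hI := I_one_pos
  have hba : 0 < b - a := sub_pos.mpr hab
  have hL : ∀ t, t ≤ a → 2 / (b - a) * t + -(a + b) / (b - a) ≤ -1 := by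
    intro t ht
    rw [div_mul_eq_mul_div, ← add_div, div_le_iff₀ hba]
    linarith
  have hR : ∀ t, b ≤ t → 1 ≤ 2 / (b - a) * t + -(a + b) / (b - a) := by
    intro t ht
    rw [div_mul_eq_mul_div, ← add_div, le_div_iff₀ hba]
    linarith
  refine ⟨fun t => f a + (f b - f a) / I 1 * I (2 / (b - a) * t + -(a + b) / (b - a)),
    ?_, affine_ode _ _ _ _, ?_, ?_, ?_⟩
  · have : ContDiff ℝ (⊤ : ℕ∞) (fun t => I (2 / (b - a) * t + -(a + b) / (b - a))) :=
      I_contDiff.comp (by fun_prop)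
    fun_prop
  · intro t ht
    simp only
    rw [I_left (hL t ht)]; ring
  · intro t ht
    simp only
    rw [I_right (hR t ht)]; field_simp; ring
  · intro t ht
    simp only
    set x := 2 / (b - a) * t + -(a + b) / (b - a)
    have x0 : 0 ≤ I x := by
      rcases le_total x (-1) with hx | hx
      · rw [I_left hx]
      · rw [← I_left (le_refl (-1))]; exact I_mono hx
    have x1 : I x ≤ I 1 := by
      rcases le_total x 1 with hx | hx
      · exact I_mono hx
      · rw [I_right hx]
    have l0 : 0 ≤ I x / I 1 := div_nonneg x0 hI.le
    have l1 : I x / I 1 ≤ 1 := (div_le_one hI).mpr x1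
    have e : f a + (f b - f a) / I 1 * I x - f t
        = (1 - I x / I 1) * (f a - f t) + I x / I 1 * (f b - f t) := by ring
    rw [e]
    have ha := abs_lt.mp (h a ⟨le_refl a, hab.le⟩ t ht)
    have hb := abs_lt.mp (h b ⟨hab.le, le_refl b⟩ t ht)
    generalize I x / I 1 = l at *
    have := (convex_Ioo (-ε t) (ε t)) ha hb (sub_nonneg.mpr l1) l0 (by ring)
    exact abs_lt.mpr this

theorem good_Icc {f ε : ℝ → ℝ} (hf : Continuous f) (hε : Continuous ε) (pos : ∀ t, 0 < ε t)
    {a b : ℝ} (hab : a ≤ b) : Good f ε a b := by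
  let c : Icc a b → Set (Icc a b) := fun x =>
    {s | |f s - f x| < ε x / 4 ∧ ε x / 2 < ε s}
  have hc1 : ∀ x, IsOpen (c x) := by
    intro x
    have o1 : IsOpen {s : Icc a b | |f s - f x| < ε x / 4} :=
      isOpen_lt (by fun_prop) (by fun_prop)
    have o2 : IsOpen {s : Icc a b | ε x / 2 < ε s} := isOpen_lt (by fun_prop) (by fun_prop)
    exact o1.inter o2
  have hc2 : univ ⊆ ⋃ x, c x := by
    intro x _
    refine mem_iUnion.mpr ⟨x, ?_⟩
    have := pos x
    constructor
    · simp; linarith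
    · linarith
  obtain ⟨t, t0, tm, ⟨m, hm⟩, tc⟩ := exists_monotone_Icc_subset_open_cover_Icc hab hc1 hc2
  have key : ∀ n, Good f ε a (t n) := by
    intro n
    induction n with
    | zero => rw [t0]; exact Good.refl pos a
    | succ n ih =>
      have hle : (t n : ℝ) ≤ t (n + 1) := tm (Nat.le_succ n)
      refine Good.trans (t n).2.1 hle ih ?_
      rcases hle.eq_or_lt with h | h
      · rw [← h]; exact Good.refl pos _
      · refine good_local h ?_
        obtain ⟨x, hx⟩ := tc n
        have hmem : ∀ s ∈ Icc (t n : ℝ) (t (n + 1)), |f s - f x| < ε x / 4 ∧ ε x / 2 < ε s := by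
          intro s hs
          have hs' : s ∈ Icc a b := ⟨(t n).2.1.trans hs.1, hs.2.trans (t (n + 1)).2.2⟩
          exact @hx ⟨s, hs'⟩ ⟨hs.1, hs.2⟩
        intro s hs u hu
        have p1 := abs_lt.mp (hmem s hs).1
        have p2 := abs_lt.mp (hmem u hu).1
        have p3 := (hmem u hu).2
        rw [abs_lt]
        constructor <;> linarith [p1.1, p1.2, p2.1, p2.2]
  have := key m
  rwa [hm m le_rfl] at this

end RubelAux

open RubelAux in
/-- Rubel's universal pDAE of order 4: there is a nonzero polynomial `P` in 5
variables such that the smooth solutions of `P(y, y', y'', y''', y'''') = 0`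
can approximate any continuous function on `ℝ` with any prescribed continuous
positive accuracy. -/
theorem universal_pDAE_order_four :
    ∃ P : MvPolynomial (Fin 5) ℝ, P ≠ 0 ∧
      ∀ (f ε : ℝ → ℝ), Continuous f → Continuous ε → (∀ t : ℝ, 0 < ε t) →
        ∃ y : ℝ → ℝ, ContDiff ℝ (⊤ : ℕ∞) y ∧
          (∀ t : ℝ, MvPolynomial.eval (fun k : Fin 5 => iteratedDeriv k y t) P = 0) ∧
          (∀ t : ℝ, |y t - f t| < ε t) := by
  refine ⟨RubelAux.P, P_ne_zero, ?_⟩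
  intro f ε hf hε pos
  have hg : ∀ n : ℤ, Good f ε (n : ℝ) ((n + 1 : ℤ) : ℝ) := fun n =>
    good_Icc hf hε pos (by push_cast; linarith)
  choose y y1 y2 y3 y4 y5 using hg
  have loc : ∀ t : ℝ, (fun u => y ⌊u⌋ u) =ᶠ[𝓝 t]
      (fun u => y (⌊t⌋ - 1) u + y ⌊t⌋ u - f (⌊t⌋ : ℝ)) := by
    intro t
    have h1 : ((⌊t⌋ - 1 : ℤ) : ℝ) < t := by
      push_cast; linarith [Int.floor_le t]
    have h2 : t < ((⌊t⌋ + 1 : ℤ) : ℝ) := by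
      push_cast; exact Int.lt_floor_add_one t
    filter_upwards [Ioo_mem_nhds h1 h2] with u hu
    rcases lt_or_ge u (⌊t⌋ : ℝ) with h | h
    · have e : ⌊u⌋ = ⌊t⌋ - 1 := Int.floor_eq_iff.mpr ⟨hu.1.le, by push_cast; linarith⟩
      rw [e, y3 ⌊t⌋ u h.le]; ring
    · have e : ⌊u⌋ = ⌊t⌋ := Int.floor_eq_iff.mpr ⟨h, by simpa using hu.2⟩
      have := y4 (⌊t⌋ - 1) u (by simpa using h)
      rw [sub_add_cancel] at this
      rw [e, this]; ring
  refine ⟨fun u => y ⌊u⌋ u, ?_, ?_, ?_⟩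
  · rw [contDiff_iff_contDiffAt]
    intro t
    refine ContDiffAt.congr_of_eventuallyEq ?_ (loc t)
    have a1 := y1 (⌊t⌋ - 1)
    have a2 := y1 ⌊t⌋
    exact ((a1.add a2).sub contDiff_const).contDiffAt
  · intro t
    rw [eval_P]
    refine Ode.congr (loc t) ?_
    refine concat (b := (⌊t⌋ : ℝ)) (y1 _) (y1 _) (y2 _) (y2 _) ?_ (y3 _) t
    intro u hu
    have := y4 (⌊t⌋ - 1) u (by simpa using hu)
    rwa [sub_add_cancel] at this
  · intro t
    exact y5 ⌊t⌋ t ⟨Int.floor_le t, by push_cast; exact (Int.lt_floor_add_one t).le⟩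
end

section
/- There exists a nonzero polynomial P in 4 variables with real coefficients (corresponding to a polynomial differential algebraic equation of order 3) with the following universality property: for every continuous function f : ℝ → ℝ and every continuous function ε : ℝ → ℝ with ε(t) > 0 for all t, there exists an infinitely differentiable function y : ℝ → ℝ such that P(y(t), y'(t), y''(t), y'''(t)) = 0 for all t ∈ ℝ and |y(t) − f(t)| < ε(t) for all t ∈ ℝ. -/
open Real Set Filter Topology MeasureTheory

namespace UPDAE

/-- the function `log (2 cosh x)` -/
noncomputable def ell (x : ℝ) : ℝ := Real.log (2 * Real.cosh x)

noncomputable def rr (L x : ℝ) : ℝ := L + ell x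

noncomputable def TT (L x : ℝ) : ℝ := ∫ s in (0 : ℝ)..x, ((rr L s) ^ 4)⁻¹

lemma hasDerivAt_th (x : ℝ) : HasDerivAt Real.tanh (1 - Real.tanh x ^ 2) x := by
  have h : Real.tanh = fun x => Real.sinh x / Real.cosh x := by
    funext x; exact Real.tanh_eq_sinh_div_cosh x
  rw [h]
  have hc : Real.cosh x ≠ 0 := (Real.cosh_pos x).ne'
  refine ((Real.hasDerivAt_sinh x).div (Real.hasDerivAt_cosh x) hc).congr_deriv ?_
  field_simp

lemma hasDerivAt_ell (x : ℝ) : HasDerivAt ell (Real.tanh x) x := by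
  have hc : 0 < Real.cosh x := Real.cosh_pos x
  have := ((Real.hasDerivAt_cosh x).const_mul 2).log (by positivity)
  refine this.congr_deriv ?_
  rw [Real.tanh_eq_sinh_div_cosh]
  field_simp

lemma abs_le_ell (x : ℝ) : |x| ≤ ell x := by
  unfold ell
  rw [Real.le_log_iff_exp_le (by have := Real.cosh_pos x; positivity), ← Real.cosh_abs x,
    Real.cosh_eq]
  have := Real.exp_pos (-|x|)
  linarith

lemma hasDerivAt_rr (L x : ℝ) : HasDerivAt (rr L) (Real.tanh x) x :=
  (hasDerivAt_ell x).const_add L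

lemma continuous_ell : Continuous ell :=
  continuous_iff_continuousAt.2 fun x => (hasDerivAt_ell x).continuousAt

lemma continuous_rr (L : ℝ) : Continuous (rr L) := continuous_const.add continuous_ell

lemma continuous_th : Continuous Real.tanh :=
  continuous_iff_continuousAt.2 fun x => (hasDerivAt_th x).continuousAt

lemma rr_ge (L x : ℝ) : L + |x| ≤ rr L x := by
  have := abs_le_ell x
  unfold rr; linarith

lemma rr_pos {L : ℝ} (hL : 1 ≤ L) (x : ℝ) : 0 < rr L x := by
  have := rr_ge L x
  have := abs_nonneg x
  linarith

lemma sech_eq (x : ℝ) : 1 - Real.tanh x ^ 2 = (Real.cosh x ^ 2)⁻¹ := by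
  have hc : Real.cosh x ≠ 0 := (Real.cosh_pos x).ne'
  rw [Real.tanh_eq_sinh_div_cosh]
  field_simp
  have := Real.cosh_sq x
  linarith

lemma sech_eq_exp (L x : ℝ) :
    1 - Real.tanh x ^ 2 = 4 * Real.exp (2 * L) * (Real.exp (-rr L x)) ^ 2 := by
  have hc : 0 < Real.cosh x := Real.cosh_pos x
  rw [sech_eq]
  have h1 : Real.exp (-rr L x) = Real.exp (-L) * (2 * Real.cosh x)⁻¹ := by
    unfold rr ell
    rw [neg_add, Real.exp_add, Real.exp_neg (Real.log _), Real.exp_log (by positivity)]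
  rw [h1, two_mul, Real.exp_add, Real.exp_neg]
  field_simp
  norm_num

lemma sech_nonneg (x : ℝ) : 0 ≤ 1 - Real.tanh x ^ 2 := by
  rw [sech_eq]; positivity

lemma sech_le (x : ℝ) : 1 - Real.tanh x ^ 2 ≤ (1 + x ^ 2)⁻¹ := by
  rw [sech_eq]
  apply inv_anti₀ (by positivity)
  have h := Real.cosh_sq x
  have h2 : x ^ 2 ≤ Real.sinh x ^ 2 := by
    rw [sq_le_sq, Real.abs_sinh]
    exact Real.self_le_sinh_iff.2 (abs_nonneg x)
  linarith

lemma hasDerivAt_TT {L : ℝ} (hL : 1 ≤ L) (x : ℝ) : HasDerivAt (TT L) (((rr L x) ^ 4)⁻¹) x := by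
  have hc : Continuous fun s => ((rr L s) ^ 4)⁻¹ :=
    ((continuous_rr L).pow 4).inv₀ fun x => (pow_pos (rr_pos hL x) 4).ne'
  exact intervalIntegral.integral_hasDerivAt_right (hc.intervalIntegrable _ _)
    (hc.stronglyMeasurableAtFilter _ _) hc.continuousAt

lemma strictMono_TT {L : ℝ} (hL : 1 ≤ L) : StrictMono (TT L) :=
  strictMono_of_hasDerivAt_pos (fun x => hasDerivAt_TT hL x)
    (fun x => inv_pos.2 (pow_pos (rr_pos hL x) 4))

lemma continuous_TT {L : ℝ} (hL : 1 ≤ L) : Continuous (TT L) :=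
  continuous_iff_continuousAt.2 fun x => (hasDerivAt_TT hL x).continuousAt

lemma TT_mem {L : ℝ} (hL : 1 ≤ L) (x : ℝ) :
    TT L x ∈ Ioo (-(2 / L ^ 2)) (2 / L ^ 2) := by
  have hL0 : 0 < L := by linarith
  have hmono : Monotone fun x => Real.arctan x / L ^ 2 - TT L x := by
    have hd : ∀ x, HasDerivAt (fun x => Real.arctan x / L ^ 2 - TT L x)
        (1 / (1 + x ^ 2) / L ^ 2 - ((rr L x) ^ 4)⁻¹) x := fun x =>
      ((Real.hasDerivAt_arctan x).div_const _).sub (hasDerivAt_TT hL x)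
    apply monotone_of_deriv_nonneg (fun x => (hd x).differentiableAt)
    intro x
    rw [(hd x).deriv, div_div, sub_nonneg, one_div]
    apply inv_anti₀ (by positivity)
    have h1 := rr_ge L x
    have h2 := abs_nonneg x
    have h3 := sq_abs x
    have h4 : L ^ 2 ≤ rr L x ^ 2 := by gcongr; linarith
    have h5 : 1 + x ^ 2 ≤ rr L x ^ 2 := by
      rw [← h3]
      calc 1 + |x| ^ 2 ≤ (L + |x|) ^ 2 := by nlinarith
        _ ≤ _ := by gcongr
    calc (1 + x ^ 2) * L ^ 2 ≤ rr L x ^ 2 * rr L x ^ 2 := by gcongr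
      _ = _ := by ring
  have h0 : TT L 0 = 0 := by simp [TT]
  have hpi := Real.pi_lt_four
  have ha := Real.arctan_lt_pi_div_two x
  have hb := Real.neg_pi_div_two_lt_arctan x
  have hp : 0 < 2 / L ^ 2 := by positivity
  have ha' : Real.arctan x / L ^ 2 < 2 / L ^ 2 := by gcongr; linarith
  have hb' : -(2 / L ^ 2) < Real.arctan x / L ^ 2 := by rw [← neg_div]; gcongr; linarith
  rcases le_total 0 x with hx | hx
  · have h1 := hmono hx
    have h2 := (strictMono_TT hL).monotone hx
    simp only [h0, Real.arctan_zero, zero_div, sub_zero] at h1 h2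
    constructor <;> linarith
  · have h1 := hmono hx
    have h2 := (strictMono_TT hL).monotone hx
    simp only [h0, Real.arctan_zero, zero_div, sub_zero] at h1 h2
    constructor <;> linarith

/-- polynomial derivation in the algebraic phase variables -/
noncomputable def DD : Derivation ℝ (MvPolynomial (Fin 2) ℝ) (MvPolynomial (Fin 2) ℝ) :=
  MvPolynomial.mkDerivation ℝ
    ![(1 - MvPolynomial.X 0 ^ 2) * MvPolynomial.X 1 ^ 4, MvPolynomial.X 0 * MvPolynomial.X 1 ^ 4]

noncomputable def DT (Q : MvPolynomial (Fin 2) ℝ) : MvPolynomial (Fin 2) ℝ :=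
  DD Q - 2 * MvPolynomial.X 0 * MvPolynomial.X 1 ^ 4 * Q

noncomputable def ev (L x : ℝ) (Q : MvPolynomial (Fin 2) ℝ) : ℝ :=
  MvPolynomial.eval ![Real.tanh x, rr L x] Q

noncomputable def phi (L : ℝ) (Q : MvPolynomial (Fin 2) ℝ) (x : ℝ) : ℝ :=
  (1 - Real.tanh x ^ 2) * ev L x Q

lemma hasDerivAt_ev {L : ℝ} (hL : 1 ≤ L) (Q : MvPolynomial (Fin 2) ℝ) (x : ℝ) :
    HasDerivAt (fun x => ev L x Q) (((rr L x) ^ 4)⁻¹ * ev L x (DD Q)) x := by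
  have hr := (rr_pos hL x).ne'
  induction Q using MvPolynomial.induction_on with
  | C a =>
    have : DD (MvPolynomial.C a) = 0 := by simp [DD]
    rw [this]
    simpa [ev] using hasDerivAt_const x a
  | add p q hp hq =>
    have hf : (fun x => ev L x (p + q)) = (fun x => ev L x p) + fun x => ev L x q := by
      funext x; simp [ev]
    rw [hf]
    refine (hp.add hq).congr_deriv ?_
    simp [ev, mul_add]
  | mul_X p i hp =>
    have hi : HasDerivAt (fun x => ev L x (MvPolynomial.X i))
        (((rr L x) ^ 4)⁻¹ * ev L x (DD (MvPolynomial.X i))) x := by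
      fin_cases i
      · convert hasDerivAt_th x using 1
        · funext x; simp [ev]
        · simp [ev, DD, MvPolynomial.mkDerivation_X]; field_simp
      · convert hasDerivAt_rr L x using 1
        · funext x; simp [ev]
        · simp [ev, DD, MvPolynomial.mkDerivation_X]; field_simp
    have hf : (fun x => ev L x (p * MvPolynomial.X i)) =
        (fun x => ev L x p) * fun x => ev L x (MvPolynomial.X i) := by
      funext x; simp [ev]
    rw [hf]
    refine (hp.mul hi).congr_deriv ?_
    rw [Derivation.leibniz]; simp [ev]; ring

lemma hasDerivAt_phi {L : ℝ} (hL : 1 ≤ L) (Q : MvPolynomial (Fin 2) ℝ) (x : ℝ) :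
    HasDerivAt (phi L Q) (((rr L x) ^ 4)⁻¹ * phi L (DT Q) x) x := by
  have hr := (rr_pos hL x).ne'
  have h := (((hasDerivAt_th x).pow 2).const_sub 1).mul (hasDerivAt_ev hL Q x)
  refine h.congr_deriv ?_
  simp only [phi, DT, ev, map_sub, map_mul, map_pow, MvPolynomial.eval_X, map_ofNat]
  simp
  field_simp
  ring

lemma tendsto_rr (L : ℝ) : Tendsto (rr L) (cocompact ℝ) atTop := by
  apply tendsto_atTop_mono (rr_ge L)
  exact tendsto_atTop_add_const_left _ _ (tendsto_norm_cocompact_atTop (E := ℝ))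

lemma tendsto_phi_aux (L : ℝ) (Q : MvPolynomial (Fin 2) ℝ) : ∀ n : ℕ,
    Tendsto (fun x => (1 - Real.tanh x ^ 2) * rr L x ^ n * ev L x Q) (cocompact ℝ) (𝓝 0) := by
  induction Q using MvPolynomial.induction_on with
  | C a =>
    intro n
    have h1 := (Real.tendsto_pow_mul_exp_neg_atTop_nhds_zero n).comp (tendsto_rr L)
    have h2 := (Real.tendsto_pow_mul_exp_neg_atTop_nhds_zero 0).comp (tendsto_rr L)
    have h3 := ((h1.mul h2).const_mul (4 * Real.exp (2 * L))).mul_const a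
    simp only [mul_zero, zero_mul] at h3
    refine h3.congr fun x => ?_
    rw [sech_eq_exp L x]
    simp only [ev, MvPolynomial.eval_C, Function.comp]
    ring
  | add p q hp hq =>
    intro n
    have := (hp n).add (hq n)
    rw [add_zero] at this
    refine this.congr fun x => ?_
    simp [ev]; ring
  | mul_X p i hp =>
    intro n
    fin_cases i
    · have h := hp n
      have hb : IsBoundedUnder (· ≤ ·) (cocompact ℝ) ((‖·‖) ∘ Real.tanh) :=
        isBoundedUnder_of ⟨1, fun x => (Real.abs_tanh_lt_one x).le⟩
      have := h.zero_mul_isBoundedUnder_le hb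
      refine this.congr fun x => ?_
      simp [ev]; ring
    · refine (hp (n + 1)).congr fun x => ?_
      simp [ev]; ring

lemma tendsto_phi (L : ℝ) (Q : MvPolynomial (Fin 2) ℝ) :
    Tendsto (phi L Q) (cocompact ℝ) (𝓝 0) := by
  refine (tendsto_phi_aux L Q 0).congr fun x => ?_
  simp [phi]

noncomputable def FF (L : ℝ) (Q : MvPolynomial (Fin 2) ℝ) : ℝ → ℝ :=
  Function.extend (TT L) (phi L Q) 0

lemma FF_TT {L : ℝ} (hL : 1 ≤ L) (Q) (x : ℝ) : FF L Q (TT L x) = phi L Q x :=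
  (strictMono_TT hL).injective.extend_apply _ _ _

lemma FF_zero {L : ℝ} (Q) {t : ℝ} (ht : t ∉ range (TT L)) : FF L Q t = 0 := by
  unfold FF
  rw [Function.extend_apply' _ _ _ ht]; rfl

lemma openEmb {L : ℝ} (hL : 1 ≤ L) : IsOpenEmbedding (TT L) := by
  have hoc : OrdConnected (range (TT L)) :=
    (isPreconnected_range (continuous_TT hL)).ordConnected
  refine ⟨(strictMono_TT hL).isEmbedding_of_ordConnected hoc, ?_⟩
  rw [isOpen_iff_mem_nhds]
  rintro _ ⟨x, rfl⟩
  have h1 := strictMono_TT hL (show x - 1 < x by linarith)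
  have h2 := strictMono_TT hL (show x < x + 1 by linarith)
  exact mem_of_superset (Icc_mem_nhds h1 h2) (hoc.out ⟨_, rfl⟩ ⟨_, rfl⟩)

lemma range_TT {L : ℝ} (hL : 1 ≤ L) : ∃ a b, range (TT L) = Ioo a b := by
  have hoc : OrdConnected (range (TT L)) :=
    (isPreconnected_range (continuous_TT hL)).ordConnected
  have hbb : BddBelow (range (TT L)) := ⟨_, by rintro _ ⟨x, rfl⟩; exact (TT_mem hL x).1.le⟩
  have hba : BddAbove (range (TT L)) := ⟨_, by rintro _ ⟨x, rfl⟩; exact (TT_mem hL x).2.le⟩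
  refine ⟨sInf (range (TT L)), sSup (range (TT L)), ?_⟩
  apply Subset.antisymm
  · rintro _ ⟨x, rfl⟩
    have h1 := strictMono_TT hL (show x - 1 < x by linarith)
    have h2 := strictMono_TT hL (show x < x + 1 by linarith)
    exact ⟨(csInf_le hbb ⟨_, rfl⟩).trans_lt h1, h2.trans_le (le_csSup hba ⟨_, rfl⟩)⟩
  · rintro t ⟨h1, h2⟩
    obtain ⟨a, ha, hat⟩ := exists_lt_of_csInf_lt (range_nonempty _) h1
    obtain ⟨b, hb, htb⟩ := exists_lt_of_lt_csSup (range_nonempty _) h2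
    exact hoc.out ha hb ⟨hat.le, htb.le⟩

lemma continuous_phi {L : ℝ} (hL : 1 ≤ L) (Q) : Continuous (phi L Q) :=
  continuous_iff_continuousAt.2 fun x => (hasDerivAt_phi hL Q x).continuousAt

lemma continuous_FF {L : ℝ} (hL : 1 ≤ L) (Q) : Continuous (FF L Q) := by
  rw [continuous_iff_continuousAt]
  intro t
  by_cases ht : t ∈ range (TT L)
  · obtain ⟨x, rfl⟩ := ht
    rw [← (openEmb hL).continuousAt_iff]
    have : FF L Q ∘ TT L = phi L Q := funext fun x => FF_TT hL Q x
    rw [this]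
    exact (continuous_phi hL Q).continuousAt
  · rw [ContinuousAt, FF_zero Q ht, Metric.tendsto_nhds]
    intro e he
    have h1 := (Metric.tendsto_nhds.1 (tendsto_phi L Q)) e he
    obtain ⟨K, hK, hKs⟩ := mem_cocompact.1 h1
    have hcl : IsClosed (TT L '' K) := (hK.image (continuous_TT hL)).isClosed
    have hmem : (TT L '' K)ᶜ ∈ 𝓝 t := hcl.isOpen_compl.mem_nhds (by
      rintro ⟨x, _, hx⟩; exact ht ⟨x, hx⟩)
    filter_upwards [hmem] with s hs
    by_cases hs' : s ∈ range (TT L)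
    · obtain ⟨x, rfl⟩ := hs'
      rw [FF_TT hL]
      exact hKs fun hx => hs ⟨x, hx, rfl⟩
    · rw [FF_zero Q hs']; simpa using he

lemma hasDerivAt_FF_mem {L : ℝ} (hL : 1 ≤ L) (Q) (x : ℝ) :
    HasDerivAt (FF L Q) (phi L (DT Q) x) (TT L x) := by
  have hr := (pow_pos (rr_pos hL x) 4).ne'
  let e := (openEmb hL).toOpenPartialHomeomorph (TT L)
  have hmem : TT L x ∈ e.target := by simp [e]
  have hsymm : e.symm (TT L x) = x := e.left_inv (x := x) (by simp [e])
  have h1 : HasDerivAt e.symm (((rr L x) ^ 4)⁻¹)⁻¹ (TT L x) := by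
    apply e.hasDerivAt_symm hmem (inv_ne_zero hr)
    rw [hsymm]; exact hasDerivAt_TT hL x
  have h2 : HasDerivAt (phi L Q) (((rr L x) ^ 4)⁻¹ * phi L (DT Q) x) (e.symm (TT L x)) := by
    rw [hsymm]; exact hasDerivAt_phi hL Q x
  have h3 := h2.comp (TT L x) h1
  have h4 : FF L Q =ᶠ[𝓝 (TT L x)] phi L Q ∘ e.symm := by
    filter_upwards [e.open_target.mem_nhds hmem] with s hs
    have hs' : s ∈ range (TT L) := by simpa [e] using hs
    obtain ⟨z, rfl⟩ := hs'
    rw [FF_TT hL, Function.comp, show e.symm (TT L z) = z from e.left_inv (x := z) (by simp [e])]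
  refine (h3.congr_of_eventuallyEq h4).congr_deriv ?_
  rw [inv_inv, mul_right_comm, inv_mul_cancel₀ hr, one_mul]

lemma hasDerivAt_local {f g : ℝ → ℝ} {x : ℝ} (h : ∀ᶠ y in 𝓝[≠] x, HasDerivAt f (g y) y)
    (hf : Continuous f) (hg : Continuous g) : HasDerivAt f (g x) x := by
  have hgt : ∀ᶠ y in 𝓝[>] x, HasDerivAt f (g y) y :=
    h.filter_mono (nhdsWithin_mono _ fun y hy => ne_of_gt hy)
  have hlt : ∀ᶠ y in 𝓝[<] x, HasDerivAt f (g y) y :=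
    h.filter_mono (nhdsWithin_mono _ fun y hy => ne_of_lt hy)
  have A : HasDerivWithinAt f (g x) (Ici x) x := by
    refine hasDerivWithinAt_Ici_of_tendsto_deriv (s := {y | HasDerivAt f (g y) y})
      (fun y hy => hy.differentiableAt.differentiableWithinAt) hf.continuousWithinAt hgt ?_
    refine (hg.continuousAt.tendsto.mono_left nhdsWithin_le_nhds).congr' ?_
    filter_upwards [hgt] with y hy using hy.deriv.symm
  have B : HasDerivWithinAt f (g x) (Iic x) x := by
    refine hasDerivWithinAt_Iic_of_tendsto_deriv (s := {y | HasDerivAt f (g y) y})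
      (fun y hy => hy.differentiableAt.differentiableWithinAt) hf.continuousWithinAt hlt ?_
    refine (hg.continuousAt.tendsto.mono_left nhdsWithin_le_nhds).congr' ?_
    filter_upwards [hlt] with y hy using hy.deriv.symm
  simpa using B.union A

lemma hasDerivAt_FF {L : ℝ} (hL : 1 ≤ L) (Q) (t : ℝ) :
    HasDerivAt (FF L Q) (FF L (DT Q) t) t := by
  obtain ⟨a, b, hab⟩ := range_TT hL
  have key : ∀ s, s ≠ a → s ≠ b → HasDerivAt (FF L Q) (FF L (DT Q) s) s := by
    intro s hsa hsb
    by_cases hs : s ∈ range (TT L)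
    · obtain ⟨x, rfl⟩ := hs
      rw [FF_TT hL]; exact hasDerivAt_FF_mem hL Q x
    · rw [FF_zero _ hs]
      have hs' : s ∈ (Icc a b)ᶜ := by
        rintro ⟨h1, h2⟩
        exact hs (hab ▸ ⟨lt_of_le_of_ne h1 hsa.symm, lt_of_le_of_ne h2 hsb⟩)
      refine (hasDerivAt_const s (0 : ℝ)).congr_of_eventuallyEq ?_
      filter_upwards [isClosed_Icc.isOpen_compl.mem_nhds hs'] with z hz
      exact FF_zero _ fun h => hz (Ioo_subset_Icc_self (hab ▸ h))
  apply hasDerivAt_local _ (continuous_FF hL _) (continuous_FF hL _)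
  have hfin : ({a, b} \ {t} : Set ℝ).Finite := (Set.toFinite _)
  have : ({a, b} \ {t} : Set ℝ)ᶜ ∈ 𝓝 t := hfin.isClosed.isOpen_compl.mem_nhds (by simp)
  filter_upwards [mem_nhdsWithin_of_mem_nhds this, self_mem_nhdsWithin] with s hs hst
  have hst' : s ≠ t := hst
  simp [hst'] at hs
  exact key s hs.1 hs.2



noncomputable def Qs : ℕ → MvPolynomial (Fin 2) ℝ
  | 0 => MvPolynomial.X 1 ^ 3
  | n + 1 => DT (Qs n)

noncomputable def UU (n : ℕ) : MvPolynomial (Fin 2) ℝ := (1 - MvPolynomial.X 0 ^ 2) * Qs n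

/-- smooth functions whose jet lies, up to sign, on the parametrised surface -/
def Good (y : ℝ → ℝ) : Prop :=
  ContDiff ℝ (⊤ : ℕ∞) y ∧ ∀ t, ∃ (v : Fin 2 → ℝ) (σ : ℝ), σ ^ 2 = 1 ∧
    ∀ k : ℕ, iteratedDeriv (k + 1) y t = σ * MvPolynomial.eval v (UU k)

lemma FF_eval {L : ℝ} (hL : 1 ≤ L) (t : ℝ) : ∃ v : Fin 2 → ℝ, ∀ Q,
    FF L Q t = MvPolynomial.eval v ((1 - MvPolynomial.X 0 ^ 2) * Q) := by
  by_cases ht : t ∈ range (TT L)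
  · obtain ⟨x, rfl⟩ := ht
    refine ⟨![Real.tanh x, rr L x], fun Q => ?_⟩
    rw [FF_TT hL]
    simp [phi, ev]
  · refine ⟨![1, 0], fun Q => ?_⟩
    rw [FF_zero _ ht]
    simp

lemma deriv_FF {L : ℝ} (hL : 1 ≤ L) (Q) : deriv (FF L Q) = FF L (DT Q) :=
  funext fun t => (hasDerivAt_FF hL Q t).deriv

lemma iteratedDeriv_FF {L : ℝ} (hL : 1 ≤ L) (n : ℕ) :
    iteratedDeriv n (FF L (Qs 0)) = FF L (Qs n) := by
  induction n with
  | zero => simp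
  | succ n ih => rw [iteratedDeriv_succ, ih, deriv_FF hL]; rfl

noncomputable def yy (L t : ℝ) : ℝ := ∫ s in (-(2 / L ^ 2))..t, FF L (Qs 0) s

lemma hasDerivAt_yy {L : ℝ} (hL : 1 ≤ L) (t : ℝ) : HasDerivAt (yy L) (FF L (Qs 0) t) t := by
  have hc := continuous_FF hL (Qs 0)
  exact intervalIntegral.integral_hasDerivAt_right (hc.intervalIntegrable _ _)
    (hc.stronglyMeasurableAtFilter _ _) hc.continuousAt

lemma iteratedDeriv_yy {L : ℝ} (hL : 1 ≤ L) (n : ℕ) :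
    iteratedDeriv (n + 1) (yy L) = FF L (Qs n) := by
  rw [iteratedDeriv_succ', ← iteratedDeriv_FF hL]
  congr 1
  exact funext fun t => (hasDerivAt_yy hL t).deriv

lemma good_yy {L : ℝ} (hL : 1 ≤ L) : Good (yy L) := by
  constructor
  · apply contDiff_of_differentiable_iteratedDeriv
    intro m _
    cases m with
    | zero =>
      rw [iteratedDeriv_zero]
      exact fun t => (hasDerivAt_yy hL t).differentiableAt
    | succ n =>
      rw [iteratedDeriv_yy hL]
      exact fun t => (hasDerivAt_FF hL _ t).differentiableAt
  · intro t
    obtain ⟨v, hv⟩ := FF_eval hL t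
    refine ⟨v, 1, by norm_num, fun k => ?_⟩
    rw [iteratedDeriv_yy hL, hv, one_mul]; rfl

lemma good_const (c : ℝ) : Good fun _ => c := by
  refine ⟨contDiff_const, fun t => ⟨![1, 0], 1, by norm_num, fun k => ?_⟩⟩
  simp [UU, iteratedDeriv_const]

lemma good_neg {y : ℝ → ℝ} (h : Good y) : Good fun t => - y t := by
  refine ⟨h.1.neg, fun t => ?_⟩
  obtain ⟨v, σ, hσ, hk⟩ := h.2 t
  refine ⟨v, -σ, by rw [neg_sq, hσ], fun k => ?_⟩
  have := iteratedDeriv_neg (k + 1) y t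
  rw [show (fun t => - y t) = -y from rfl, this, hk]; ring

lemma good_shift {y : ℝ → ℝ} (h : Good y) (α c : ℝ) : Good fun t => α + y (t - c) := by
  refine ⟨contDiff_const.add (h.1.comp (contDiff_id.sub contDiff_const)), fun t => ?_⟩
  obtain ⟨v, σ, hσ, hk⟩ := h.2 (t - c)
  refine ⟨v, σ, hσ, fun k => ?_⟩
  rw [iteratedDeriv_const_add (Nat.succ_pos k), ← hk]
  have := iteratedDeriv_comp_add_const (k + 1) y (-c)
  simp only [← sub_eq_add_neg] at this
  exact congrFun this t

lemma good_local {y : ℝ → ℝ} (h : ∀ t, ∃ g, Good g ∧ y =ᶠ[𝓝 t] g) : Good y := by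
  constructor
  · rw [contDiff_iff_contDiffAt]
    intro t
    obtain ⟨g, hg, hyg⟩ := h t
    exact hg.1.contDiffAt.congr_of_eventuallyEq hyg
  · intro t
    obtain ⟨g, hg, hyg⟩ := h t
    obtain ⟨v, σ, hσ, hk⟩ := hg.2 t
    exact ⟨v, σ, hσ, fun k => by rw [hyg.iteratedDeriv_eq, hk]⟩

noncomputable def HH (L : ℝ) : ℝ := ∫ x, (1 - Real.tanh x ^ 2) * (rr L x)⁻¹

lemma FF_nonneg {L : ℝ} (hL : 1 ≤ L) (t : ℝ) : 0 ≤ FF L (Qs 0) t := by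
  by_cases ht : t ∈ range (TT L)
  · obtain ⟨x, rfl⟩ := ht
    rw [FF_TT hL]
    have := rr_pos hL x
    have := sech_nonneg x
    simp only [phi, ev, Qs, map_pow, MvPolynomial.eval_X]
    simp
    positivity
  · rw [FF_zero _ ht]

lemma range_sub {L : ℝ} (hL : 1 ≤ L) : range (TT L) ⊆ Ioo (-(2 / L ^ 2)) (2 / L ^ 2) := by
  rintro _ ⟨x, rfl⟩; exact TT_mem hL x

lemma yy_left {L : ℝ} (hL : 1 ≤ L) {t : ℝ} (ht : t ≤ -(2 / L ^ 2)) : yy L t = 0 := by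
  unfold yy
  rw [intervalIntegral.integral_symm, intervalIntegral.integral_of_le ht, neg_eq_zero]
  apply setIntegral_eq_zero_of_forall_eq_zero
  intro s hs
  exact FF_zero _ fun h => absurd (range_sub hL h).1 (not_lt.2 hs.2)

lemma yy_right {L : ℝ} (hL : 1 ≤ L) {t : ℝ} (ht : 2 / L ^ 2 ≤ t) : yy L t = HH L := by
  have hp : 0 < 2 / L ^ 2 := by positivity
  unfold yy
  rw [intervalIntegral.integral_of_le (by linarith)]
  have hz : ∀ s, s ∉ Ioc (-(2 / L ^ 2)) t → FF L (Qs 0) s = 0 := fun s hs =>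
    FF_zero _ fun h => hs ⟨(range_sub hL h).1, (range_sub hL h).2.le.trans ht⟩
  rw [setIntegral_eq_integral_of_forall_compl_eq_zero hz]
  rw [← setIntegral_eq_integral_of_forall_compl_eq_zero (s := range (TT L))
    (fun s hs => FF_zero _ hs), ← image_univ]
  rw [integral_image_eq_integral_abs_deriv_smul MeasurableSet.univ
    (fun x _ => (hasDerivAt_TT hL x).hasDerivWithinAt) (strictMono_TT hL).injective.injOn]
  rw [setIntegral_univ]
  unfold HH
  congr 1
  funext x
  have := rr_pos hL x
  rw [FF_TT hL, abs_of_pos (by positivity)]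
  simp only [phi, ev, Qs, map_pow, MvPolynomial.eval_X, smul_eq_mul]
  simp
  field_simp

lemma yy_mono {L : ℝ} (hL : 1 ≤ L) : Monotone (yy L) :=
  monotone_of_hasDerivAt_nonneg (fun t => hasDerivAt_yy hL t) (fun t => FF_nonneg hL t)

lemma yy_mem {L : ℝ} (hL : 1 ≤ L) (t : ℝ) : yy L t ∈ Icc 0 (HH L) := by
  constructor
  · rw [← yy_left hL (min_le_right t (-(2 / L ^ 2)))]
    exact yy_mono hL (min_le_left _ _)
  · rw [← yy_right hL (le_max_right t (2 / L ^ 2))]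
    exact yy_mono hL (le_max_left _ _)

lemma HH_integrand_cont {L : ℝ} (hL : 1 ≤ L) :
    Continuous fun x => (1 - Real.tanh x ^ 2) * (rr L x)⁻¹ :=
  (continuous_const.sub (continuous_th.pow 2)).mul
    ((continuous_rr L).inv₀ fun x => (rr_pos hL x).ne')

lemma HH_integrand_le {L : ℝ} (hL : 1 ≤ L) (x : ℝ) :
    (1 - Real.tanh x ^ 2) * (rr L x)⁻¹ ≤ (1 + x ^ 2)⁻¹ * L⁻¹ := by
  have h1 := sech_le x
  have h2 := sech_nonneg x
  have h3 := rr_ge L x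
  have h4 := abs_nonneg x
  have h5 := rr_pos hL x
  have : (rr L x)⁻¹ ≤ L⁻¹ := inv_anti₀ (by linarith) (by linarith)
  gcongr

lemma HH_integrand_nonneg {L : ℝ} (hL : 1 ≤ L) (x : ℝ) :
    0 ≤ (1 - Real.tanh x ^ 2) * (rr L x)⁻¹ :=
  mul_nonneg (sech_nonneg x) (inv_nonneg.2 (rr_pos hL x).le)

lemma HH_integrable {L : ℝ} (hL : 1 ≤ L) :
    Integrable fun x => (1 - Real.tanh x ^ 2) * (rr L x)⁻¹ := by
  refine (integrable_inv_one_add_sq.mul_const L⁻¹).mono'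
    (HH_integrand_cont hL).aestronglyMeasurable (Eventually.of_forall fun x => ?_)
  rw [Real.norm_of_nonneg (HH_integrand_nonneg hL x)]
  exact HH_integrand_le hL x

lemma HH_le {L : ℝ} (hL : 1 ≤ L) : HH L ≤ 4 / L := by
  have h := integral_mono (HH_integrable hL) (integrable_inv_one_add_sq.mul_const L⁻¹)
    (HH_integrand_le hL)
  rw [integral_mul_const, integral_univ_inv_one_add_sq] at h
  refine h.trans ?_
  rw [div_eq_mul_inv]
  have := Real.pi_lt_four
  gcongr

lemma HH_ge {L : ℝ} (hL : 1 ≤ L) : HH 1 / L ≤ HH L := by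
  unfold HH
  rw [div_eq_mul_inv, ← integral_mul_const]
  refine integral_mono ((HH_integrable le_rfl).mul_const _) (HH_integrable hL) fun x => ?_
  have h1 := rr_pos le_rfl x
  have h2 := rr_pos hL x
  have h3 := sech_nonneg x
  simp only
  rw [mul_assoc, ← mul_inv]
  gcongr
  have h4 := abs_le_ell x
  have h5 := abs_nonneg x
  unfold rr
  nlinarith

lemma HH_one_pos : 0 < HH 1 := by
  refine integral_pos_of_integrable_nonneg_nonzero (x := 0) (HH_integrand_cont le_rfl)
    (HH_integrable le_rfl) (HH_integrand_nonneg le_rfl) ?_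
  have := rr_pos le_rfl 0
  simp [this.ne']

lemma HH_cont : ContinuousOn HH (Ici 1) := by
  unfold HH
  refine continuousOn_of_dominated (bound := fun x => (1 + x ^ 2)⁻¹) ?_ ?_
    integrable_inv_one_add_sq ?_
  · intro L hL; exact (HH_integrand_cont hL).aestronglyMeasurable
  · intro L hL
    refine Eventually.of_forall fun x => ?_
    rw [Real.norm_of_nonneg (HH_integrand_nonneg hL x)]
    refine (HH_integrand_le hL x).trans ?_
    have : L⁻¹ ≤ 1 := inv_le_one_of_one_le₀ hL
    have h2 : 0 ≤ (1 + x ^ 2)⁻¹ := by positivity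
    exact mul_le_of_le_one_right h2 this
  · refine Eventually.of_forall fun x => ?_
    refine continuousOn_const.mul (ContinuousOn.inv₀ ?_ fun L hL => (rr_pos hL x).ne')
    unfold rr
    fun_prop

lemma exists_HH {d : ℝ} (hd : 0 < d) (hd1 : d ≤ HH 1) : ∃ L, 1 ≤ L ∧ HH L = d := by
  have hM : (1 : ℝ) ≤ max 1 (4 / d) := le_max_left _ _
  have h1 : HH (max 1 (4 / d)) ≤ d := by
    refine (HH_le hM).trans ?_
    rw [div_le_iff₀ (by linarith)]
    calc (4 : ℝ) = d * (4 / d) := by field_simp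
      _ ≤ _ := by gcongr; exact le_max_right _ _
  have := intermediate_value_Icc' hM (HH_cont.mono Icc_subset_Ici_self)
  obtain ⟨L, hL, h⟩ := this ⟨h1, hd1⟩
  exact ⟨L, hL.1, h⟩



/-- transition from the constant `α` (near `a`) to the constant `β` (near `b`),
staying inside the tube `C` -/
def Tr (C : ℝ → Set ℝ) (a b α β : ℝ) : Prop :=
  ∃ y : ℝ → ℝ, Good y ∧ (∃ η > 0, (∀ t ≤ a + η, y t = α) ∧ ∀ t, b - η ≤ t → y t = β) ∧
    ∀ t ∈ Icc a b, y t ∈ C t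

lemma Tr.mono {C C' : ℝ → Set ℝ} {a b α β : ℝ} (h : Tr C a b α β)
    (hC : ∀ t ∈ Icc a b, C t ⊆ C' t) : Tr C' a b α β := by
  obtain ⟨y, hy, hη, hc⟩ := h
  exact ⟨y, hy, hη, fun t ht => hC t ht (hc t ht)⟩

lemma Tr.glue {C : ℝ → Set ℝ} {a b c α β γ : ℝ} (hab : a < b) (hbc : b < c)
    (h1 : Tr C a b α β) (h2 : Tr C b c β γ) : Tr C a c α γ := by
  obtain ⟨y, hy, ⟨η, hη, hl, hr⟩, hc⟩ := h1
  obtain ⟨z, hz, ⟨θ, hθ, hl', hr'⟩, hc'⟩ := h2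
  refine ⟨fun t => if t ≤ b then y t else z t, ?_, ?_, ?_⟩
  · apply good_local
    intro t
    rcases lt_trichotomy t b with h | h | h
    · refine ⟨y, hy, ?_⟩
      filter_upwards [Iio_mem_nhds h] with s hs
      simp [le_of_lt (show s < b from hs)]
    · refine ⟨fun _ => β, good_const β, ?_⟩
      filter_upwards [Ioo_mem_nhds (show b - η < t by linarith) (show t < b + θ by linarith)]
        with s hs
      split_ifs with hsb
      · exact hr s hs.1.le
      · exact hl' s hs.2.le
    · refine ⟨z, hz, ?_⟩
      filter_upwards [Ioi_mem_nhds h] with s hs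
      simp [not_le.2 (show b < s from hs)]
  · refine ⟨min (min η θ) (min (b - a) (c - b) / 2), ?_, ?_, ?_⟩
    · have : 0 < min (b - a) (c - b) := lt_min (by linarith) (by linarith)
      positivity
    all_goals
      have e1 := min_le_left (min η θ) (min (b - a) (c - b) / 2)
      have e2 := min_le_right (min η θ) (min (b - a) (c - b) / 2)
      have e3 := min_le_left η θ
      have e4 := min_le_right η θ
      have e5 := min_le_left (b - a) (c - b)
      have e6 := min_le_right (b - a) (c - b)
      intro t ht
    · have hb : t ≤ b := by linarith
      simp only [hb, if_true]
      exact hl t (by linarith)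
    · have hb : ¬ t ≤ b := by
        rw [not_le]; linarith
      simp only [hb, if_false]
      exact hr' t (by linarith)
  · intro t ht
    by_cases h : t ≤ b
    · simp only [h, if_true]; exact hc t ⟨ht.1, h⟩
    · simp only [h, if_false]; exact hc' t ⟨(not_le.1 h).le, ht.2⟩

lemma Tr.const {C : ℝ → Set ℝ} {a b α : ℝ} (h : ∀ t ∈ Icc a b, α ∈ C t) : Tr C a b α α :=
  ⟨fun _ => α, good_const α, ⟨1, one_pos, fun _ _ => rfl, fun _ _ => rfl⟩, h⟩

lemma Tr.step {L : ℝ} (hL : 1 ≤ L) {w : ℝ} (hw : 4 / L ^ 2 < w) (a α : ℝ) :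
    Tr (fun _ => Icc α (α + HH L)) a (a + w) α (α + HH L) := by
  have h2 : 4 / L ^ 2 = 2 * (2 / L ^ 2) := by ring
  refine ⟨fun t => α + yy L (t - (a + w / 2)), good_shift (good_yy hL) _ _,
    ⟨w / 2 - 2 / L ^ 2, by linarith, fun t ht => ?_, fun t ht => ?_⟩, fun t _ => ?_⟩
  · simp only
    rw [yy_left hL (by linarith), add_zero]
  · simp only
    rw [yy_right hL (by linarith)]
  · have := yy_mem hL (t - (a + w / 2))
    exact ⟨by linarith [this.1], by linarith [this.2]⟩

lemma Tr.steps {L : ℝ} (hL : 1 ≤ L) {w : ℝ} (hw : 4 / L ^ 2 < w) (a α : ℝ) (n : ℕ) :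
    Tr (fun _ => Icc α (α + (n + 1) * HH L)) a (a + (n + 1) * w) α (α + (n + 1) * HH L) := by
  have hw0 : 0 < w := lt_of_le_of_lt (by positivity) hw
  have hH : 0 ≤ HH L := (yy_mem hL 0).1.trans (yy_mem hL 0).2
  induction n with
  | zero => simpa using Tr.step hL hw a α
  | succ n ih =>
    have h2 := Tr.step hL hw (a + (n + 1) * w) (α + (n + 1) * HH L)
    have e1 : a + (n + 1) * w + w = a + ((n + 1 : ℕ) + 1) * w := by push_cast; ring
    have e2 : α + (n + 1) * HH L + HH L = α + ((n + 1 : ℕ) + 1) * HH L := by push_cast; ring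
    rw [e1, e2] at h2
    have hn : 0 ≤ ((n : ℝ) + 1) * HH L := by positivity
    have hn' : 0 < ((n : ℝ) + 1) * w := by positivity
    refine Tr.glue (b := a + (n + 1) * w) (by linarith) (by linarith)
      (ih.mono fun t _ => Icc_subset_Icc_right (by linarith))
      (h2.mono fun t _ => Icc_subset_Icc_left (by linarith))

lemma Tr.up {a b α β : ℝ} (hab : a < b) (hαβ : α ≤ β) :
    Tr (fun _ => Icc α β) a b α β := by
  rcases hαβ.eq_or_lt with rfl | hlt
  · exact Tr.const fun t _ => ⟨le_rfl, le_rfl⟩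
  have hc := HH_one_pos
  set c := HH 1 with hcdef
  have hδ : 0 < β - α := by linarith
  obtain ⟨n, hn⟩ := exists_nat_gt (max ((β - α) / c) (4 * (β - α) ^ 2 / (c ^ 2 * (b - a))))
  have hn1 := (le_max_left _ _).trans_lt hn
  have hn2 := (le_max_right _ _).trans_lt hn
  set N : ℝ := (n : ℝ) + 1 with hN
  have hN0 : 0 < N := by positivity
  have hnN : (n : ℝ) < N := by linarith
  rw [div_lt_iff₀ hc] at hn1
  have hba : 0 < b - a := by linarith
  rw [div_lt_iff₀ (by positivity)] at hn2
  obtain ⟨L, hL, hH⟩ := exists_HH (d := (β - α) / N) (by positivity) (by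
    rw [div_le_iff₀ hN0]; nlinarith)
  have hL0 : 0 < L := by linarith
  have hge := HH_ge hL
  rw [hH, ← hcdef, div_le_div_iff₀ hL0 hN0] at hge
  have hw : 4 / L ^ 2 < (b - a) / N := by
    rw [div_lt_div_iff₀ (by positivity) hN0]
    have h1 : (c * N) ^ 2 ≤ ((β - α) * L) ^ 2 := by gcongr
    have h2 : 4 * (β - α) ^ 2 < N * (c ^ 2 * (b - a)) :=
      hn2.trans (by gcongr)
    have h3 : 4 * (β - α) ^ 2 * N * (β - α) ^ 2 < ((b - a) * L ^ 2) * (β - α) ^ 2 * (β - α) ^ 2 := by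
      calc 4 * (β - α) ^ 2 * N * (β - α) ^ 2
          < N * (c ^ 2 * (b - a)) * N * (β - α) ^ 2 := by gcongr
        _ = (c * N) ^ 2 * (b - a) * (β - α) ^ 2 := by ring
        _ ≤ ((β - α) * L) ^ 2 * (b - a) * (β - α) ^ 2 := by gcongr
        _ = _ := by ring
    have h4 : 0 < (β - α) ^ 2 * (β - α) ^ 2 := by positivity
    by_contra hcon
    push Not at hcon
    nlinarith
  have := Tr.steps hL hw a α n
  rw [hH, ← hN] at this
  have e1 : a + N * ((b - a) / N) = b := by field_simp; ring
  have e2 : α + N * ((β - α) / N) = β := by field_simp; ring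
  rwa [e1, e2] at this

lemma Tr.any {a b α β : ℝ} (hab : a < b) : Tr (fun _ => uIcc α β) a b α β := by
  rcases le_total α β with h | h
  · rw [uIcc_of_le h]; exact Tr.up hab h
  · obtain ⟨y, hy, ⟨η, hη, hl, hr⟩, hc⟩ := Tr.up hab (neg_le_neg h)
    refine ⟨fun t => - y t, good_neg hy, ⟨η, hη, fun t ht => ?_, fun t ht => ?_⟩, fun t ht => ?_⟩
    · simp [hl t ht]
    · simp [hr t ht]
    · rw [uIcc_of_ge h]
      have := hc t ht
      exact ⟨by linarith [this.2], by linarith [this.1]⟩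

lemma Tr.approx {f ε : ℝ → ℝ} (hf : Continuous f) (hε : Continuous ε) (hpos : ∀ t, 0 < ε t)
    {A B : ℝ} (hAB : A < B) :
    Tr (fun t => {z | |z - f t| < ε t}) A B (f A) (f B) := by
  obtain ⟨m, -, hm⟩ := isCompact_Icc.exists_isMinOn (nonempty_Icc.2 hAB.le) hε.continuousOn
  have hm' : ∀ t ∈ Icc A B, ε m ≤ ε t := fun t ht => hm ht
  have huc : UniformContinuousOn f (Icc A B) :=
    isCompact_Icc.uniformContinuousOn_of_continuous hf.continuousOn
  obtain ⟨δ, hδ, hfd⟩ := Metric.uniformContinuousOn_iff.1 huc (ε m) (hpos m)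
  have key : ∀ n : ℕ, ∀ a b, A ≤ a → a < b → b ≤ B → b - a ≤ (n + 1) * (δ / 2) →
      Tr (fun t => {z | |z - f t| < ε t}) a b (f a) (f b) := by
    intro n
    induction n with
    | zero =>
      intro a b hAa hab hbB hd
      refine (Tr.any hab).mono fun t ht z hz => ?_
      have h1 := hfd a ⟨hAa, by linarith⟩ t ⟨by linarith [ht.1], by linarith [ht.2]⟩ (by
        rw [Real.dist_eq, abs_lt]; norm_num at hd; constructor <;> linarith [ht.1, ht.2])
      have h2 := hfd b ⟨by linarith, hbB⟩ t ⟨by linarith [ht.1], by linarith [ht.2]⟩ (by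
        rw [Real.dist_eq, abs_lt]; norm_num at hd; constructor <;> linarith [ht.1, ht.2])
      have h3 := hm' t ⟨by linarith [ht.1], by linarith [ht.2]⟩
      rw [Real.dist_eq, abs_lt] at h1 h2
      show |z - f t| < ε t
      rw [abs_lt]
      rcases mem_uIcc.1 hz with h | h <;> constructor <;> linarith [h.1, h.2, h1.1, h1.2, h2.1, h2.2]
    | succ n ih =>
      intro a b hAa hab hbB hd
      push_cast at hd
      by_cases hs : b - a ≤ (n + 1) * (δ / 2)
      · exact ih a b hAa hab hbB hs
      · push Not at hs
        have hp : 0 < ((n : ℝ) + 1) * (δ / 2) := by positivity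
        have h0 : (δ / 2) ≤ (n + 1) * (δ / 2) := by
          have : 0 ≤ (n : ℝ) * (δ / 2) := by positivity
          linarith
        refine Tr.glue (b := a + (n + 1) * (δ / 2)) (by linarith) (by linarith)
          (ih _ _ hAa (by linarith) (by linarith) (by linarith))
          (ih _ _ (by linarith) (by linarith) hbB (by linarith))
  obtain ⟨n, hn⟩ := exists_nat_gt ((B - A) / (δ / 2))
  rw [div_lt_iff₀ (by positivity)] at hn
  exact key n A B le_rfl hAB le_rfl (by linarith)

lemma exists_good {f ε : ℝ → ℝ} (hf : Continuous f) (hε : Continuous ε) (hpos : ∀ t, 0 < ε t) :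
    ∃ y, Good y ∧ ∀ t, |y t - f t| < ε t := by
  have h : ∀ n : ℤ, Tr (fun t => {z | |z - f t| < ε t}) n (n + 1) (f n) (f (n + 1)) :=
    fun n => Tr.approx hf hε hpos (by linarith)
  choose y hy hη hc using h
  refine ⟨fun t => y ⌊t⌋ t, good_local fun t => ?_, fun t => ?_⟩
  · rcases (Int.floor_le t).eq_or_lt with h | h
    · refine ⟨fun _ => f t, good_const _, ?_⟩
      obtain ⟨η, hη0, hl, -⟩ := hη ⌊t⌋
      obtain ⟨θ, hθ0, -, hr⟩ := hη (⌊t⌋ - 1)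
      rw [h] at hl
      have e : ((⌊t⌋ - 1 : ℤ) : ℝ) + 1 = t := by push_cast; linarith
      rw [e] at hr
      filter_upwards [Ioo_mem_nhds (show t - min θ 1 < t by
        have : 0 < min θ 1 := lt_min hθ0 one_pos
        linarith) (show t < t + min η 1 by
        have : 0 < min η 1 := lt_min hη0 one_pos
        linarith)] with s hs
      have i1 := min_le_left θ 1
      have i2 := min_le_right θ 1
      have i3 := min_le_left η 1
      have i4 := min_le_right η 1
      rcases lt_or_ge s t with hst | hst
      · have : ⌊s⌋ = ⌊t⌋ - 1 := by
          rw [Int.floor_eq_iff]; push_cast; constructor <;> linarith [hs.1]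
        rw [this]
        exact hr s (by linarith [hs.1])
      · have : ⌊s⌋ = ⌊t⌋ := by
          rw [Int.floor_eq_iff]; constructor <;> linarith [hs.2]
        rw [this]
        exact hl s (by linarith [hs.2])
    · refine ⟨y ⌊t⌋, hy _, ?_⟩
      filter_upwards [Ioo_mem_nhds h (Int.lt_floor_add_one t)] with s hs
      have : ⌊s⌋ = ⌊t⌋ := by
        rw [Int.floor_eq_iff]; exact ⟨hs.1.le, hs.2⟩
      rw [this]
  · exact hc ⌊t⌋ t ⟨Int.floor_le t, (Int.lt_floor_add_one t).le⟩

lemma exists_poly : ∃ q : MvPolynomial (Fin 3) ℝ, q ≠ 0 ∧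
    ∀ v : Fin 2 → ℝ, MvPolynomial.eval (fun k : Fin 3 => (MvPolynomial.eval v (UU k)) ^ 2) q = 0 := by
  have hnot : ¬ AlgebraicIndependent ℝ (fun k : Fin 3 => (UU k) ^ 2) := by
    intro h
    have h1 := h.cardinalMk_le_trdeg
    rw [MvPolynomial.trdeg_of_isDomain] at h1
    simp at h1
    norm_cast at h1
  rw [algebraicIndependent_iff] at hnot
  push Not at hnot
  obtain ⟨q, hq, hq0⟩ := hnot
  refine ⟨q, hq0, fun v => ?_⟩
  have := congrArg (MvPolynomial.eval v) hq
  rw [map_zero, MvPolynomial.aeval_def, MvPolynomial.hom_eval₂] at this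
  rw [← this, MvPolynomial.eval, MvPolynomial.coe_eval₂Hom]
  congr 1
  · ext; simp
  · funext k; simp

end UPDAE

/-- Universal pDAE of order 3 (improving Rubel's order-4 result): there is a
nonzero polynomial `P` in 4 variables such that the smooth solutions of
`P(y, y', y'', y''') = 0` can approximate any continuous function on `ℝ` with
any prescribed continuous positive accuracy. -/
theorem universal_pDAE_order_three :
    ∃ P : MvPolynomial (Fin 4) ℝ, P ≠ 0 ∧
      ∀ (f ε : ℝ → ℝ), Continuous f → Continuous ε → (∀ t : ℝ, 0 < ε t) →
        ∃ y : ℝ → ℝ, ContDiff ℝ (⊤ : ℕ∞) y ∧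
          (∀ t : ℝ, MvPolynomial.eval (fun k : Fin 4 => iteratedDeriv k y t) P = 0) ∧
          (∀ t : ℝ, |y t - f t| < ε t) := by
  obtain ⟨q, hq0, hq⟩ := UPDAE.exists_poly
  refine ⟨MvPolynomial.rename Fin.succ (MvPolynomial.expand 2 q), ?_, ?_⟩
  · intro h
    have h1 := (map_eq_zero_iff _ (MvPolynomial.rename_injective _ (Fin.succ_injective 3))).1 h
    exact (MvPolynomial.expand_ne_zero (by norm_num)).2 hq0 h1
  · intro f ε hf hε hpos
    obtain ⟨y, hy, hyf⟩ := UPDAE.exists_good hf hε hpos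
    refine ⟨y, hy.1, fun t => ?_, hyf⟩
    obtain ⟨v, σ, hσ, hk⟩ := hy.2 t
    rw [MvPolynomial.eval_rename, MvPolynomial.eval_expand, ← hq v]
    congr 1
    congr 1
    funext k
    simp [hk, mul_pow, hσ]
end

section
/- There exist d ≥ 1 and a vector p = (p₁,…,p_d) of polynomials in d variables with rational coefficients such that: for every continuous function f : ℝ → ℝ and every continuous function ε : ℝ → ℝ with ε(t) > 0 for all t ≥ 0, there exists an initial condition y₀ ∈ ℝ^d such that the initial value problem y(0) = y₀, y'(t) = p(y(t)) has a unique solution y : [0, ∞) → ℝ^d defined on the whole half-line, and this solution satisfies |y₁(t) − f(t)| ≤ ε(t) for all t ≥ 0. -/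
lemma exists_phase (E θ : ℕ → ℝ) (hE : ∀ n, 0 < E n) (h2 : ∀ n, 2 * E n ≤ E (n+1)) :
    ∃ γ : ℝ, (θ 0 ≤ E 0 * γ ∧ E 0 * γ ≤ θ 0 + 2 * E 0 / E 1) ∧
      ∀ n, ∃ P : ℤ, θ n + P ≤ E n * γ ∧ E n * γ ≤ θ n + P + 2 * E n / E (n+1) := by
  let b : ℕ → ℝ := fun n => Nat.rec (θ 0 / E 0)
    (fun k x => (θ (k+1) + ⌈E (k+1) * x - θ (k+1)⌉) / E (k+1)) n
  have b0 : b 0 = θ 0 / E 0 := rfl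
  have bs : ∀ n, b (n+1) = (θ (n+1) + ⌈E (n+1) * b n - θ (n+1)⌉) / E (n+1) := fun n => rfl
  have hP : ∀ n, ∃ P : ℤ, E n * b n = θ n + P := by
    intro n
    have := (hE n).ne'
    cases n with
    | zero => exact ⟨0, by rw [b0]; field_simp; try simp⟩
    | succ k => exact ⟨_, by rw [bs]; field_simp⟩
  have hmono : ∀ n, b n ≤ b (n+1) := by
    intro n
    rw [bs, le_div_iff₀ (hE _)]
    have := Int.le_ceil (E (n+1) * b n - θ (n+1))
    linarith
  have hup : ∀ n, b (n+1) ≤ b n + 1 / E (n+1) := by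
    intro n
    have h := Int.ceil_lt_add_one (E (n+1) * b n - θ (n+1))
    have h3 := hE (n+1)
    rw [bs, div_le_iff₀ (hE _), add_mul, one_div_mul_cancel h3.ne']
    linarith
  let u : ℕ → ℝ := fun n => b n + 2 / E (n+1)
  have hu : Antitone u := by
    apply antitone_nat_of_succ_le
    intro n
    have h1 := hup n
    have h3 := hE (n+1)
    have h4 := h2 (n+1)
    have h5 : 2 / E (n+1+1) ≤ 1 / E (n+1) := by
      rw [div_le_div_iff₀ (hE _) h3]; linarith
    have h6 : 2 / E (n+1) = 1 / E (n+1) + 1 / E (n+1) := by ring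
    simp only [u]
    linarith
  have hb : Monotone b := monotone_nat_of_le_succ hmono
  have hbu : ∀ n, b n ≤ u n := fun n => by
    have := hE (n+1)
    simp only [u]
    have : 0 ≤ 2 / E (n+1) := by positivity
    linarith
  have hγ := Monotone.ciSup_mem_iInter_Icc_of_antitone hb hu hbu
  set γ := ⨆ n, b n
  simp only [Set.mem_iInter, Set.mem_Icc] at hγ
  have key : ∀ n (x : ℝ), E n * b n = x → x ≤ E n * γ ∧ E n * γ ≤ x + 2 * E n / E (n+1) := by
    intro n x hx
    have h1 := hE n
    obtain ⟨h3, h4⟩ := hγ n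
    constructor
    · rw [← hx]; exact mul_le_mul_of_nonneg_left h3 h1.le
    · have := mul_le_mul_of_nonneg_left h4 h1.le
      simp only [u] at this
      calc E n * γ ≤ _ := this
        _ = _ := by rw [← hx]; ring
  refine ⟨γ, key 0 _ ?_, fun n => ?_⟩
  · rw [b0]; have := (hE 0).ne'; field_simp
  · obtain ⟨P, hP⟩ := hP n
    exact ⟨P, key n _ hP⟩

/-- the small denominator -/
noncomputable def DD (a t : ℝ) : ℝ := Real.sin (Real.pi * (t+1)) ^ 2 + Real.sin (Real.pi * a * (t+1)) ^ 2

lemma DD_nonneg (a t : ℝ) : 0 ≤ DD a t := by unfold DD; positivity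

lemma DD_cont (a : ℝ) : Continuous (DD a) := by unfold DD; fun_prop

noncomputable def gg (a t : ℝ) : ℝ := (DD a (max t 0))⁻¹

lemma abs_sin_pi_le (y : ℝ) (P : ℤ) : |Real.sin (Real.pi * y)| ≤ Real.pi * |y - P| := by
  have h : Real.sin (Real.pi * (y - P)) = (-1) ^ P * Real.sin (Real.pi * y) := by
    rw [mul_sub, mul_comm Real.pi (P:ℝ), Real.sin_sub_int_mul_pi]
  have h2 : |Real.sin (Real.pi * y)| = |Real.sin (Real.pi * (y - P))| := by
    rw [h, abs_mul, abs_zpow]; simp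
  rw [h2]
  calc _ ≤ |Real.pi * (y - P)| := Real.abs_sin_le_abs
    _ = _ := by rw [abs_mul, abs_of_pos Real.pi_pos]

/-- one frequency: sequence `q`, ratio tends to infinity -/
lemma exists_freq (q : ℕ → ℕ) (hq0 : 1 ≤ q 0) (hq : ∀ n, (n + 3) * q n ≤ q (n+1)) :
    ∃ a : ℝ, (∀ t, 0 ≤ t → 0 < DD a t) ∧
      ∀ n, ∀ t : ℝ, (q n : ℝ) ≤ t → (q (n+1) : ℝ) / (300 * q n) ≤ ∫ s in (0:ℝ)..t, gg a s := by
  have hpos : ∀ n, 1 ≤ q n := by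
    intro n
    induction n with
    | zero => exact hq0
    | succ k ih => nlinarith [hq k]
  have hposR : ∀ n, (1:ℝ) ≤ q n := fun n => by exact_mod_cast hpos n
  have hqR : ∀ n : ℕ, ((n:ℝ) + 3) * q n ≤ q (n+1) := fun n => by exact_mod_cast hq n
  obtain ⟨a, ⟨ha0, ha1⟩, ha⟩ := exists_phase (fun n => (q n : ℝ)) (fun n => (q n : ℝ) / q (n+1))
    (fun n => by have := hposR n; positivity)
    (fun n => by have := hposR n; have := hqR n; have : (0:ℝ) ≤ n := n.cast_nonneg
                 show 2 * (q n : ℝ) ≤ q (n+1); nlinarith)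
  have hδ1 : ∀ n : ℕ, ((n:ℝ)+3) * ((q n : ℝ) / q (n+1)) ≤ 1 := by
    intro n
    have h1 := hposR (n+1)
    rw [← mul_div_assoc, div_le_one (by linarith)]
    exact hqR n
  have hδ0 : ∀ n : ℕ, 0 < ((q n : ℝ) / q (n+1)) := by
    intro n
    have h1 := hposR (n+1)
    have h2 := hposR n
    positivity
  have haa : 0 ≤ a ∧ a ≤ 2 := by
    have h0 := hposR 0
    have h1 := hδ1 0
    have h2 := hδ0 0
    have h3 : 2 * (q 0 : ℝ) / q 1 = 2 * ((q 0 : ℝ) / q (0+1)) := by simp; ring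
    rw [h3] at ha1
    simp only [Nat.cast_zero, zero_add] at h1 h2 ha0 ha1
    constructor
    · by_contra h; push Not at h; nlinarith
    · by_contra h; push Not at h; nlinarith
  have hpd : ∀ t, 0 ≤ t → 0 < DD a t := by
    intro t ht
    refine lt_of_le_of_ne (DD_nonneg a t) (fun h => ?_)
    unfold DD at h
    have hs1 : Real.sin (Real.pi * (t+1)) = 0 := by
      have h1 := sq_nonneg (Real.sin (Real.pi * (t+1)))
      have h2 := sq_nonneg (Real.sin (Real.pi * a * (t+1)))
      exact pow_eq_zero_iff (two_ne_zero) |>.1 (by linarith)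
    have hs2 : Real.sin (Real.pi * a * (t+1)) = 0 := by
      have h1 := sq_nonneg (Real.sin (Real.pi * (t+1)))
      have h2 := sq_nonneg (Real.sin (Real.pi * a * (t+1)))
      exact pow_eq_zero_iff (two_ne_zero) |>.1 (by linarith)
    rw [Real.sin_eq_zero_iff] at hs1 hs2
    obtain ⟨N, hN⟩ := hs1
    obtain ⟨K, hK⟩ := hs2
    have hpi := Real.pi_pos
    have hN' : (N:ℝ) = t + 1 := by
      have : Real.pi * N = Real.pi * (t+1) := by linarith
      exact mul_left_cancel₀ hpi.ne' this
    have hK' : (K:ℝ) = a * N := by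
      have : Real.pi * K = Real.pi * (a * N) := by rw [hN']; linarith
      exact mul_left_cancel₀ hpi.ne' this
    have hN1 : (1:ℝ) ≤ N := by linarith
    obtain ⟨n, hn⟩ := exists_nat_gt (3 * (N:ℝ))
    obtain ⟨P, hP1, hP2⟩ := ha n
    have e1 : 2 * (q n : ℝ) / q (n+1) = 2 * ((q n : ℝ) / q (n+1)) := by ring
    rw [e1] at hP2
    set δ := (q n : ℝ) / q (n+1)
    have d0 := hδ0 n
    have d1 := hδ1 n
    change 0 < δ at d0
    change ((n:ℝ)+3) * δ ≤ 1 at d1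
    have e2 : ((q n * K - N * P : ℤ) : ℝ) = N * (q n * a - P) := by
      push_cast; rw [hK']; ring
    have e3 : (0:ℝ) < ((q n * K - N * P : ℤ) : ℝ) := by
      rw [e2]; apply mul_pos <;> linarith
    have e4 : ((q n * K - N * P : ℤ) : ℝ) < 1 := by
      rw [e2]
      calc (N:ℝ) * (q n * a - P) ≤ N * (3 * δ) := by
            apply mul_le_mul_of_nonneg_left <;> linarith
        _ < ((n:ℝ)+3) * δ := by nlinarith
        _ ≤ 1 := d1
    have e5 : (0:ℤ) < q n * K - N * P := by exact_mod_cast e3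
    have e6 : (q n * K - N * P : ℤ) < 1 := by exact_mod_cast e4
    omega
  have hgc : Continuous (gg a) := by
    unfold gg
    apply Continuous.inv₀
    · exact (DD_cont a).comp (by fun_prop)
    · intro t; exact (hpd _ (le_max_right _ _)).ne'
  have hg0 : ∀ s, 0 ≤ gg a s := fun s => inv_nonneg.2 (DD_nonneg _ _)
  refine ⟨a, hpd, ?_⟩
  intro n t ht
  obtain ⟨P, hP1, hP2⟩ := ha n
  have e1 : 2 * (q n : ℝ) / q (n+1) = 2 * ((q n : ℝ) / q (n+1)) := by ring
  rw [e1] at hP2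
  have hq1 := hposR n
  have hq2 := hposR (n+1)
  have e0 : (q (n+1) : ℝ) / (300 * q n) = 1 / (300 * ((q n : ℝ) / q (n+1))) := by
    field_simp
  rw [e0]
  have d0 := hδ0 n
  have d1 := hδ1 n
  set δ := (q n : ℝ) / q (n+1)
  have hn0 : (0:ℝ) ≤ n := n.cast_nonneg
  have d2 : 3 * δ ≤ 1 := by nlinarith
  have hle : ∀ s ∈ Set.Icc ((q n : ℝ) - 1) (q n - 1 + 3 * δ), 1 / (900 * δ^2) ≤ gg a s := by
    intro s hs
    have hs0 : 0 ≤ s := by linarith [hs.1]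
    unfold gg
    rw [max_eq_left hs0, ← one_div]
    apply one_div_le_one_div_of_le (hpd s hs0)
    unfold DD
    have k1 := abs_sin_pi_le (s+1) (q n)
    have k2 := abs_sin_pi_le (a*(s+1)) P
    have hpi := Real.pi_pos
    have hpi4 := Real.pi_lt_d2
    have k3 : |s + 1 - ((q n : ℤ):ℝ)| ≤ 3 * δ := by
      rw [abs_le]; push_cast; constructor <;> linarith [hs.1, hs.2]
    have k4 : |a * (s+1) - P| ≤ 9 * δ := by
      have : a * (s+1) - P = (q n * a - P) + a * (s + 1 - q n) := by ring
      rw [this, abs_le]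
      have : 0 ≤ s + 1 - q n := by linarith [hs.1]
      have : s + 1 - q n ≤ 3 * δ := by linarith [hs.2]
      constructor <;> nlinarith [haa.1, haa.2]
    have k5 : |Real.sin (Real.pi * (s+1))| ≤ 3.15 * (3 * δ) :=
      k1.trans (mul_le_mul hpi4.le k3 (abs_nonneg _) (by norm_num))
    have k6 : |Real.sin (Real.pi * a * (s+1))| ≤ 3.15 * (9 * δ) := by
      rw [mul_assoc]
      exact k2.trans (mul_le_mul hpi4.le k4 (abs_nonneg _) (by norm_num))
    have k7 := abs_le.1 k5
    have k8 := abs_le.1 k6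
    have k9 := sq_le_sq' k7.1 k7.2
    have k10 := sq_le_sq' k8.1 k8.2
    nlinarith [sq_nonneg δ]
  have hI : ∀ x y : ℝ, IntervalIntegrable (gg a) MeasureTheory.volume x y := fun x y =>
    hgc.intervalIntegrable x y
  have s1 : ∫ s in ((q n : ℝ) - 1)..(q n - 1 + 3 * δ), (1 / (900 * δ^2)) ≤
      ∫ s in ((q n : ℝ) - 1)..(q n - 1 + 3 * δ), gg a s := by
    apply intervalIntegral.integral_mono_on (by linarith) (by simp) (hI _ _) hle
  have s2 : ∫ s in ((q n : ℝ) - 1)..(q n - 1 + 3 * δ), gg a s ≤ ∫ s in (0:ℝ)..t, gg a s := by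
    apply intervalIntegral.integral_mono_interval (by linarith) (by linarith) (by linarith)
    · exact Filter.Eventually.of_forall hg0
    · exact hI _ _
  refine le_trans ?_ s2
  refine le_trans (le_of_eq ?_) s1
  rw [intervalIntegral.integral_const]
  simp only [smul_eq_mul]
  field_simp
  ring

lemma gg_cont {a : ℝ} (h : ∀ t, 0 ≤ t → 0 < DD a t) : Continuous (gg a) := by
  unfold gg
  apply Continuous.inv₀
  · exact (DD_cont a).comp (by fun_prop)
  · intro t; exact (h _ (le_max_right _ _)).ne'

lemma gg_nonneg (a s : ℝ) : 0 ≤ gg a s := inv_nonneg.2 (DD_nonneg _ _)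

noncomputable def qseq (φ : ℝ → ℝ) : ℕ → ℕ
  | 0 => 1
  | k + 1 => qseq φ k * (k + 3 + ⌈300 * |φ (qseq φ k)|⌉₊)

/-- Arbitrary growth from two well-approximable frequencies. -/
lemma exists_growth (φ : ℝ → ℝ) (hφ : Monotone φ) :
    ∃ a b : ℝ, (∀ t, 0 ≤ t → 0 < DD a t) ∧ (∀ t, 0 ≤ t → 0 < DD b t) ∧
      ∀ C, φ 1 ≤ C → 0 ≤ C → ∀ t, 0 ≤ t → φ t ≤ C + t + ∫ s in (0:ℝ)..t, (gg a s + gg b s) := by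
  set q : ℕ → ℕ := qseq φ
  have q0 : q 0 = 1 := rfl
  have qs : ∀ n : ℕ, q (n+1) = q n * (n + 3 + ⌈300 * |φ (q n)|⌉₊) := fun n => rfl
  have hpos : ∀ n, 1 ≤ q n := by
    intro n
    induction n with
    | zero => exact q0.ge
    | succ k ih => rw [qs]; nlinarith
  have hmono : ∀ n, (n + 3) * q n ≤ q (n+1) := by
    intro n
    rw [qs, mul_comm]
    apply Nat.mul_le_mul_left
    omega
  have hle : ∀ n, q n ≤ q (n+1) := fun n => by nlinarith [hmono n]
  have hbig : ∀ n, 300 * q n * φ (q n) ≤ q (n+1) := by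
    intro n
    rw [qs]
    push_cast
    have h1 := Nat.le_ceil (300 * |φ (q n)|)
    have h2 := le_abs_self (φ (q n))
    have h3 : (0:ℝ) ≤ q n := by positivity
    have h4 : (0:ℝ) ≤ n := by positivity
    calc 300 * q n * φ (q n) = q n * (300 * φ (q n)) := by ring
      _ ≤ _ := by apply mul_le_mul_of_nonneg_left _ h3; linarith
  obtain ⟨a, ha, ha'⟩ := exists_freq (fun n => q (2*n)) (by simp [q0]) (by
    intro n
    have h1 := hmono (2*n)
    have h2 := hle (2*n+1)
    have : 2 * (n+1) = 2*n+1+1 := by ring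
    rw [this]
    nlinarith)
  obtain ⟨b, hb, hb'⟩ := exists_freq (fun n => q (2*n+1)) (hpos _) (by
    intro n
    have h1 := hmono (2*n+1)
    have h2 := hle (2*n+1+1)
    have : 2 * (n+1) + 1 = 2*n+1+1+1 := by ring
    rw [this]
    nlinarith)
  refine ⟨a, b, ha, hb, ?_⟩
  have hI : ∀ x y : ℝ, IntervalIntegrable (gg a) MeasureTheory.volume x y := fun x y =>
    (gg_cont ha).intervalIntegrable x y
  have hI' : ∀ x y : ℝ, IntervalIntegrable (gg b) MeasureTheory.volume x y := fun x y =>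
    (gg_cont hb).intervalIntegrable x y
  intro C hC hC0 t ht
  rw [intervalIntegral.integral_add (hI _ _) (hI' _ _)]
  have hia : 0 ≤ ∫ s in (0:ℝ)..t, gg a s :=
    intervalIntegral.integral_nonneg ht (fun s _ => gg_nonneg a s)
  have hib : 0 ≤ ∫ s in (0:ℝ)..t, gg b s :=
    intervalIntegral.integral_nonneg ht (fun s _ => gg_nonneg b s)
  by_cases h1 : t ≤ 1
  · have := hφ h1
    linarith
  push Not at h1
  have key : ∀ i, (q i : ℝ) ≤ t → (q (i+2) : ℝ) / (300 * q i) ≤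
      (∫ s in (0:ℝ)..t, gg a s) + ∫ s in (0:ℝ)..t, gg b s := by
    intro i hi
    rcases Nat.even_or_odd' i with ⟨j, rfl | rfl⟩
    · have := ha' j t hi
      have e : 2 * (j+1) = 2*j+2 := by ring
      rw [e] at this
      linarith
    · have := hb' j t hi
      have e : 2 * (j+1) + 1 = 2*j+1+2 := by ring
      rw [e] at this
      linarith
  have hex : ∃ i, t < q i := by
    obtain ⟨N, hN⟩ := exists_nat_gt t
    refine ⟨N, hN.trans_le ?_⟩
    have : ∀ n, n ≤ q n := by
      intro n
      induction n with
      | zero => simp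
      | succ k ih => nlinarith [hmono k, hpos k]
    exact_mod_cast this N
  classical
  have hf := Nat.find_spec hex
  have hm : ∀ i, i < Nat.find hex → (q i : ℝ) ≤ t := fun i hi => not_lt.1 (Nat.find_min hex hi)
  rcases hk : Nat.find hex with _ | k
  · rw [hk, q0] at hf; norm_num at hf; linarith
  rw [hk] at hf hm
  have h2 := key k (hm k (by omega))
  have h3 := hφ hf.le
  have h4 := hbig (k+1)
  have h5 : (q k : ℝ) ≤ q (k+1) := by exact_mod_cast hle k
  have h6 : (1:ℝ) ≤ q k := by exact_mod_cast hpos k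
  have h7 : φ t ≤ max 0 (φ (q (k+1))) := h3.trans (le_max_right _ _)
  have h8 : max 0 (φ (q (k+1))) ≤ (q (k+2) : ℝ) / (300 * q k) := by
    apply max_le (by positivity)
    by_cases h0 : φ (q (k+1)) ≤ 0
    · exact h0.trans (by positivity)
    push Not at h0
    rw [le_div_iff₀ (by positivity)]
    refine le_trans ?_ h4
    nlinarith
  linarith

lemma core_avg (m T : ℝ → ℝ) (hm : Continuous m) (hT : Continuous T) (hm0 : ∀ s, 0 ≤ m s)
    (s0 : ℝ) (A e : ℕ → ℝ) (he0 : ∀ k, 0 ≤ e k) (he : ∀ k, e (k+1) ≤ e k)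
    (M N : ℝ → ℝ) (hM : ∀ s, M s = 1 + ∫ r in s0..s, m r)
    (hN : ∀ s, N s = A 0 + ∫ r in s0..s, m r * T r)
    (h1 : ∀ k : ℕ, ∀ s ∈ Set.Icc (s0 + k) (s0 + k + 1),
      m s * |T s - A (k+1)| ≤ e (k+1) * (m s + 1))
    (h2 : ∀ k : ℕ, M (s0 + k) * (|A k - A (k+1)| + 2 * e k) ≤ e (k+1) * M (s0 + k + 1)) :
    ∀ k : ℕ, ∀ s ∈ Set.Icc (s0 + k) (s0 + k + 1), ∀ F d, |A k - F| ≤ d → |A (k+1) - F| ≤ d →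
      |N s / M s - F| ≤ d + 3 * e k := by
  have hmI : ∀ x y : ℝ, IntervalIntegrable m MeasureTheory.volume x y := fun x y =>
    hm.intervalIntegrable x y
  have hmTI : ∀ x y : ℝ, IntervalIntegrable (fun r => m r * T r) MeasureTheory.volume x y :=
    fun x y => (hm.mul hT).intervalIntegrable x y
  have hMd : ∀ x y, M y = M x + ∫ r in x..y, m r := by
    intro x y
    rw [hM, hM, add_assoc, intervalIntegral.integral_add_adjacent_intervals (hmI _ _) (hmI _ _)]
  have hNd : ∀ x y, N y = N x + ∫ r in x..y, m r * T r := by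
    intro x y
    rw [hN, hN, add_assoc, intervalIntegral.integral_add_adjacent_intervals (hmTI _ _) (hmTI _ _)]
  have hMm : ∀ x y, x ≤ y → M x ≤ M y := by
    intro x y hxy
    rw [hMd x y]
    have := intervalIntegral.integral_nonneg hxy (fun s _ => hm0 s) (μ := MeasureTheory.volume)
    linarith
  have hM1 : ∀ s, s0 ≤ s → 1 ≤ M s := by
    intro s hs
    have := hMm _ _ hs
    have h : M s0 = 1 := by simp [hM]
    linarith
  have err : ∀ k : ℕ, ∀ s ∈ Set.Icc (s0 + k) (s0 + k + 1),
      |N s - N (s0+k) - A (k+1) * (M s - M (s0+k))| ≤ e (k+1) * M s := by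
    intro k s hs
    have e1 : N s - N (s0+k) - A (k+1) * (M s - M (s0+k)) =
        ∫ r in (s0+k)..s, m r * (T r - A (k+1)) := by
      rw [hNd (s0+k) s, hMd (s0+k) s]
      have : ∀ r, m r * (T r - A (k+1)) = m r * T r - A (k+1) * m r := fun r => by ring
      simp_rw [this]
      rw [intervalIntegral.integral_sub (hmTI _ _) ((hmI _ _).const_mul _),
        intervalIntegral.integral_const_mul]
      ring
    rw [e1]
    have e2 : |∫ r in (s0+k)..s, m r * (T r - A (k+1))| ≤
        ∫ r in (s0+k)..s, |m r * (T r - A (k+1))| :=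
      intervalIntegral.abs_integral_le_integral_abs hs.1
    have e3 : ∫ r in (s0+k)..s, |m r * (T r - A (k+1))| ≤
        ∫ r in (s0+k)..s, e (k+1) * (m r + 1) := by
      apply intervalIntegral.integral_mono_on hs.1
      · exact Continuous.intervalIntegrable (by fun_prop) _ _
      · exact Continuous.intervalIntegrable (by fun_prop) _ _
      · intro r hr
        rw [abs_mul, abs_of_nonneg (hm0 r)]
        exact h1 k r ⟨hr.1, hr.2.trans hs.2⟩
    have e4 : ∫ r in (s0+k)..s, e (k+1) * (m r + 1) = e (k+1) * (M s - M (s0+k) + (s - (s0+k))) := by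
      rw [intervalIntegral.integral_const_mul, intervalIntegral.integral_add (hmI _ _) (by simp),
        hMd (s0+k) s]
      simp
    have e5 : M s - M (s0+k) + (s - (s0+k)) ≤ M s := by
      have := hM1 (s0+k) (by have : (0:ℝ) ≤ k := k.cast_nonneg
                             linarith)
      linarith [hs.2]
    have := mul_le_mul_of_nonneg_left e5 (he0 (k+1))
    linarith
  have hk0 : ∀ k : ℕ, (0:ℝ) ≤ k := fun k => k.cast_nonneg
  have inv : ∀ k : ℕ, |N (s0+k) - A k * M (s0+k)| ≤ 2 * e k * M (s0+k) := by
    intro k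
    induction k with
    | zero =>
      have : N (s0 + (0:ℕ)) - A 0 * M (s0 + (0:ℕ)) = 0 := by simp [hM, hN]
      rw [this, abs_zero]
      have := hM1 (s0 + (0:ℕ)) (by simp)
      have := he0 0
      positivity
    | succ k ih =>
      have hr := err k (s0+k+1) ⟨by linarith, le_rfl⟩
      have e0 : s0 + ((k+1 : ℕ) : ℝ) = s0 + k + 1 := by push_cast; ring
      rw [e0]
      have hh := h2 k
      have hMl := hM1 (s0+k) (by linarith [hk0 k])
      have key : N (s0+k+1) - A (k+1) * M (s0+k+1) =
        (N (s0+k+1) - N (s0+k) - A (k+1) * (M (s0+k+1) - M (s0+k))) + (N (s0+k) - A k * M (s0+k))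
         + (A k - A (k+1)) * M (s0+k) := by ring
      rw [key]
      have t1 := abs_add_three (N (s0+k+1) - N (s0+k) - A (k+1) * (M (s0+k+1) - M (s0+k)))
        (N (s0+k) - A k * M (s0+k)) ((A k - A (k+1)) * M (s0+k))
      rw [abs_mul (A k - A (k+1)), abs_of_nonneg (by linarith : 0 ≤ M (s0+k))] at t1
      nlinarith
  intro k s hs F d hF1 hF2
  have hMs := hM1 s (by linarith [hk0 k, hs.1])
  have hMl := hM1 (s0+k) (by linarith [hk0 k])
  have hml := hMm _ _ hs.1
  have hr := err k s hs
  have hi := inv k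
  have e0 : N s / M s - F = (N s - F * M s) / M s := by
    have : M s ≠ 0 := by linarith
    field_simp
  rw [e0, abs_div, abs_of_pos (by linarith : 0 < M s), div_le_iff₀ (by linarith)]
  have key : N s - F * M s = (N s - N (s0+k) - A (k+1) * (M s - M (s0+k)))
     + (N (s0+k) - A k * M (s0+k)) + ((A k - F) * M (s0+k) + (A (k+1) - F) * (M s - M (s0+k))) := by
    ring
  have t1 := abs_add_three (N s - N (s0+k) - A (k+1) * (M s - M (s0+k)))
    (N (s0+k) - A k * M (s0+k)) ((A k - F) * M (s0+k) + (A (k+1) - F) * (M s - M (s0+k)))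
  have t2 := abs_add_le ((A k - F) * M (s0+k)) ((A (k+1) - F) * (M s - M (s0+k)))
  rw [abs_mul, abs_mul, abs_of_nonneg (by linarith : 0 ≤ M (s0+k)),
    abs_of_nonneg (by linarith : 0 ≤ M s - M (s0+k))] at t2
  have t3 := mul_le_mul_of_nonneg_right hF1 (by linarith : 0 ≤ M (s0+k))
  have t4 := mul_le_mul_of_nonneg_right hF2 (by linarith : 0 ≤ M s - M (s0+k))
  have t5 := mul_le_mul_of_nonneg_right (he k) (by linarith : 0 ≤ M s)
  have t6 := mul_le_mul_of_nonneg_left hml (he0 k)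
  rw [key]
  nlinarith

noncomputable def mm (s : ℝ) : ℝ :=
  Real.exp (s ^ 4 - Real.exp (s ^ 2) ^ 6 * Real.sin (Real.pi * s) ^ 2)

noncomputable def TT (c s : ℝ) : ℝ := s * Real.cos (c * Real.exp (s ^ 2))

lemma mm_cont : Continuous mm := by unfold mm; fun_prop
lemma TT_cont (c : ℝ) : Continuous (TT c) := by unfold TT; fun_prop
lemma mm_pos (s : ℝ) : 0 < mm s := Real.exp_pos _

lemma sin_sq_shift (n : ℕ) (s : ℝ) :
    Real.sin (Real.pi * s) ^ 2 = Real.sin (Real.pi * (s - n)) ^ 2 := by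
  have : Real.pi * (s - n) = Real.pi * s - n * Real.pi := by ring
  rw [this, Real.sin_sub_nat_mul_pi, mul_pow, ← pow_mul, mul_comm n 2, pow_mul]
  simp

lemma sin_sq_lower (u : ℝ) (hu : |u| ≤ 1/2) : 4 * u ^ 2 ≤ Real.sin (Real.pi * u) ^ 2 := by
  have hpi := Real.pi_pos
  have h : ∀ v, 0 ≤ v → v ≤ 1/2 → 4 * v ^ 2 ≤ Real.sin (Real.pi * v) ^ 2 := by
    intro v h0 h1
    have := Real.mul_le_sin (x := Real.pi * v) (by positivity) (by nlinarith)
    have e : 2 / Real.pi * (Real.pi * v) = 2 * v := by field_simp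
    rw [e] at this
    nlinarith
  rcases le_total 0 u with h0 | h0
  · exact h u h0 ((le_abs_self u).trans hu)
  · have := h (-u) (by linarith) ((neg_le_abs u).trans hu)
    rw [mul_neg, Real.sin_neg] at this
    linarith [neg_sq u, neg_sq (Real.sin (Real.pi * u))]

lemma exists_large : ∃ N0 : ℕ, 10 ≤ N0 ∧ ∀ x : ℝ, N0 ≤ x → 1000 * x ^ 4 ≤ Real.exp x := by
  have h := Real.tendsto_pow_mul_exp_neg_atTop_nhds_zero 4
  have h2 := (h.eventually (gt_mem_nhds (show (0:ℝ) < 1/1000 by norm_num))).exists_forall_of_atTop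
  obtain ⟨a, ha⟩ := h2
  refine ⟨max 10 ⌈a⌉₊, le_max_left _ _, fun x hx => ?_⟩
  have h3 : a ≤ x := (Nat.le_ceil a).trans (le_trans (by exact_mod_cast le_max_right _ _) hx)
  have h4 := ha x h3
  rw [Real.exp_neg, ← div_eq_mul_inv, div_lt_iff₀ (Real.exp_pos _)] at h4
  linarith

lemma exp_sub_le (p q r : ℝ) (hp : p ≤ r) (hq : q ≤ r) :
    |Real.exp p - Real.exp q| ≤ |p - q| * Real.exp r := by
  have h : ∀ p q, p ≤ r → q ≤ p → Real.exp p - Real.exp q ≤ (p - q) * Real.exp r := by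
    intro p q hp hq
    have h1 := Real.add_one_le_exp (q - p)
    have h2 : Real.exp q = Real.exp p * Real.exp (q - p) := by rw [← Real.exp_add]; ring_nf
    have h3 := Real.exp_le_exp.2 hp
    have h4 := Real.exp_pos p
    have h5 : Real.exp p - Real.exp q ≤ (p - q) * Real.exp p := by rw [h2]; nlinarith
    have h6 := mul_le_mul_of_nonneg_left h3 (by linarith : 0 ≤ p - q)
    linarith
  rcases le_total q p with hh | hh
  · have h1 := h p q hp hh
    rw [abs_of_nonneg (by linarith [Real.exp_le_exp.2 hh]), abs_of_nonneg (by linarith)]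
    exact h1
  · have h1 := h q p hq hh
    rw [abs_sub_comm, abs_sub_comm p, abs_of_nonneg (by linarith [Real.exp_le_exp.2 hh]),
      abs_of_nonneg (by linarith)]
    exact h1

lemma abs_cos_sub_le (x y : ℝ) : |Real.cos x - Real.cos y| ≤ |x - y| := by
  have := Real.abs_cos_sub_cos_le (x := x) (y := y)
  exact this

set_option maxHeartbeats 800000 in
/-- pointwise bound in block around `n` -/
lemma block_bound (n : ℕ) (hn : 10 ≤ (n:ℝ)) (hexp : 1000 * (n:ℝ) ^ 4 ≤ Real.exp n)
    (γ a : ℝ) (hγ : |γ| ≤ 2) (ha : |a| ≤ n)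
    (hc : |Real.cos (2 * Real.pi * γ * Real.exp ((n:ℝ)^2)) - a / n| ≤
      4 * Real.pi * Real.exp (-(2*n+1)))
    (s : ℝ) (hs : |s - n| ≤ 1/2) :
    mm s * |TT (2 * Real.pi * γ) s - a| ≤ 1 / (n + 1) * (mm s + 1) := by
  set x : ℝ := (n:ℝ) with hx
  set u := s - x with hu
  have hpi := Real.pi_pos
  have hpi4 := Real.pi_lt_d2
  have hmp := mm_pos s
  have hsu := abs_le.1 hs
  have hex := Real.exp_pos x
  have e1 : Real.exp (-x) = 1 / Real.exp x := by rw [Real.exp_neg, one_div]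
  have hxp : (0:ℝ) < x := by linarith
  have hx3 : (10:ℝ) * x ^ 3 ≤ x ^ 4 := by nlinarith [pow_pos hxp 3]
  have hx2 : (10:ℝ) * x ^ 2 ≤ x ^ 3 := by nlinarith [pow_pos hxp 2]
  have hx1 : (10:ℝ) * x ≤ x ^ 2 := by nlinarith
  have hsmall : 10 * x * Real.exp (-x) ≤ 1 / (x + 1) := by
    rw [e1, mul_one_div, div_le_div_iff₀ hex (by linarith)]
    nlinarith
  have henx := Real.exp_pos (-x)
  by_cases hcase : |u| ≤ Real.exp (-(2*x^2))
  · -- near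
    have k1 : |TT (2 * Real.pi * γ) s - a| ≤ 1 / (x+1) := by
      have d : TT (2 * Real.pi * γ) s - a = u * Real.cos (2 * Real.pi * γ * Real.exp (s^2))
        + x * (Real.cos (2 * Real.pi * γ * Real.exp (s^2)) -
            Real.cos (2 * Real.pi * γ * Real.exp (x^2)))
        + x * (Real.cos (2 * Real.pi * γ * Real.exp (x^2)) - a / x) := by
        unfold TT
        rw [hu]
        field_simp
        ring
      rw [d]
      refine (abs_add_three _ _ _).trans ?_
      rw [abs_mul, abs_mul, abs_mul, abs_of_pos hxp]
      have c1 : |u| * |Real.cos (2 * Real.pi * γ * Real.exp (s^2))| ≤ |u| * 1 :=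
        mul_le_mul_of_nonneg_left (Real.abs_cos_le_one _) (abs_nonneg _)
      have c2 : |Real.cos (2 * Real.pi * γ * Real.exp (s^2)) -
            Real.cos (2 * Real.pi * γ * Real.exp (x^2))| ≤ 13 * |Real.exp (s^2) - Real.exp (x^2)| := by
        refine (abs_cos_sub_le _ _).trans ?_
        rw [← mul_sub, abs_mul]
        apply mul_le_mul_of_nonneg_right _ (abs_nonneg _)
        rw [abs_mul, abs_of_pos (by positivity)]
        nlinarith [abs_nonneg γ]
      have c3 : |Real.exp (s^2) - Real.exp (x^2)| ≤ |s^2 - x^2| * Real.exp (x^2 + x + 1) := by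
        apply exp_sub_le
        · have : s = x + u := by rw [hu]; ring
          rw [this]; nlinarith [hsu.1, hsu.2]
        · linarith
      have c4 : |s^2 - x^2| ≤ |u| * (3 * x) := by
        have : s^2 - x^2 = u * (s + x) := by rw [hu]; ring
        rw [this, abs_mul]
        apply mul_le_mul_of_nonneg_left _ (abs_nonneg _)
        rw [abs_le]; constructor <;> linarith
      have c5 : |u| * (3 * x) * Real.exp (x^2+x+1) ≤ 3 * x * Real.exp (-(4 * x)) := by
        have : Real.exp (-(2*x^2)) * Real.exp (x^2+x+1) ≤ Real.exp (-(4*x)) := by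
          rw [← Real.exp_add]; apply Real.exp_le_exp.2; nlinarith
        have h' := mul_le_mul_of_nonneg_right hcase (Real.exp_pos (x^2+x+1)).le
        nlinarith
      have c6 : Real.exp (-(4*x)) ≤ Real.exp (-x) * Real.exp (-x) := by
        rw [← Real.exp_add]; apply Real.exp_le_exp.2; linarith
      have c7 : Real.exp (-(2*x+1)) ≤ Real.exp (-x) * Real.exp (-x) := by
        rw [← Real.exp_add]; apply Real.exp_le_exp.2; linarith
      have c8 : Real.exp (-(2*x^2)) ≤ Real.exp (-x) := by
        apply Real.exp_le_exp.2; nlinarith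
      have c9 : x ^ 2 * Real.exp (-x) ≤ 1/1000 := by
        rw [e1, mul_one_div, div_le_div_iff₀ hex (by norm_num)]
        nlinarith
      have c10 : x * Real.exp (-x) ≤ 1/1000 :=
        (mul_le_mul_of_nonneg_right (by linarith : x ≤ x^2) henx.le).trans c9
      have d1 : x * |Real.cos (2 * Real.pi * γ * Real.exp (s^2)) -
            Real.cos (2 * Real.pi * γ * Real.exp (x^2))| ≤ Real.exp (-x) := by
        have f1 : |Real.exp (s^2) - Real.exp (x^2)| ≤ 3 * x * (Real.exp (-x) * Real.exp (-x)) := by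
          have g1 := mul_le_mul_of_nonneg_right c4 (Real.exp_pos (x^2+x+1)).le
          have g2 := mul_le_mul_of_nonneg_left c6 (by linarith : 0 ≤ 3 * x)
          exact c3.trans (g1.trans (c5.trans g2))
        have f2 : x * (13 * (3 * x * (Real.exp (-x) * Real.exp (-x)))) =
          39 * (x^2 * Real.exp (-x)) * Real.exp (-x) := by ring
        have f3 := mul_le_mul_of_nonneg_left (c2.trans (mul_le_mul_of_nonneg_left f1 (by norm_num)))
          hxp.le
        rw [f2] at f3
        refine f3.trans ?_
        have f4 := mul_le_mul_of_nonneg_right c9 henx.le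
        linarith
      have d2 : x * |Real.cos (2 * Real.pi * γ * Real.exp (x^2)) - a / x| ≤ Real.exp (-x) := by
        have f1 : 4 * Real.pi * Real.exp (-(2*x+1)) ≤ 13 * (Real.exp (-x) * Real.exp (-x)) := by
          apply mul_le_mul (by linarith) c7 (Real.exp_pos _).le (by norm_num)
        have f3 := mul_le_mul_of_nonneg_left (hc.trans f1) hxp.le
        refine f3.trans ?_
        have f4 := mul_le_mul_of_nonneg_right c10 henx.le
        linarith
      have f5 : 3 * Real.exp (-x) ≤ 10 * x * Real.exp (-x) :=
        mul_le_mul_of_nonneg_right (by linarith) henx.le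
      linarith
    have h3 := mul_le_mul_of_nonneg_left k1 hmp.le
    have h0 : 0 ≤ 1 / (x+1) := by positivity
    linarith
  · push Not at hcase
    have k1 : |TT (2 * Real.pi * γ) s - a| ≤ 3 * x := by
      have : |TT (2 * Real.pi * γ) s| ≤ x + 1/2 := by
        unfold TT
        rw [abs_mul]
        have h1 := Real.abs_cos_le_one (2 * Real.pi * γ * Real.exp (s^2))
        have h2 : |s| ≤ x + 1/2 := by rw [abs_le]; constructor <;> linarith
        nlinarith [abs_nonneg s, abs_nonneg (Real.cos (2 * Real.pi * γ * Real.exp (s^2)))]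
      have := abs_sub (TT (2 * Real.pi * γ) s) a
      linarith
    have k2 : mm s ≤ Real.exp (-x) := by
      unfold mm
      apply Real.exp_le_exp.2
      rw [sin_sq_shift n s]
      have l1 := sin_sq_lower u hs
      have l2 : Real.exp (-(4*x^2)) ≤ u ^ 2 := by
        have : Real.exp (-(4*x^2)) = Real.exp (-(2*x^2)) * Real.exp (-(2*x^2)) := by
          rw [← Real.exp_add]; ring_nf
        rw [this, ← sq_abs u]
        nlinarith [Real.exp_pos (-(2*x^2))]
      have l3 : Real.exp (6 * x^2 - 6 * x) ≤ Real.exp (s^2)^6 := by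
        rw [← Real.exp_nat_mul]
        apply Real.exp_le_exp.2
        have : s = x + u := by rw [hu]; ring
        rw [this]; push_cast; nlinarith
      have l4 : Real.exp (-(4*x^2)) ≤ Real.sin (Real.pi * u)^2 := by
        nlinarith [sq_nonneg u]
      have l5 : Real.exp x ≤ Real.exp (s^2)^6 * Real.sin (Real.pi * u)^2 := by
        refine le_trans ?_ (mul_le_mul l3 l4 (Real.exp_pos _).le (by positivity))
        rw [← Real.exp_add]
        apply Real.exp_le_exp.2; nlinarith
      have l6 : s^4 ≤ (2*x)^4 := pow_le_pow_left₀ (by linarith) (by linarith) 4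
      have l7 : (2*x)^4 = 16 * x^4 := by ring
      show s^4 - Real.exp (s^2)^6 * Real.sin (Real.pi * u)^2 ≤ -x
      nlinarith
    have h0 : 0 ≤ 1 / (x+1) := by positivity
    have h3 : mm s * |TT (2 * Real.pi * γ) s - a| ≤ Real.exp (-x) * (3 * x) :=
      mul_le_mul k2 k1 (abs_nonneg _) henx.le
    have h4 : 0 ≤ 1 / (x+1) * mm s := by positivity
    have h5 : Real.exp (-x) * (3 * x) ≤ 10 * x * Real.exp (-x) := by
      have : 0 ≤ x * Real.exp (-x) := by positivity
      linarith
    linarith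

lemma mm_lower (n : ℕ) (hn : 10 ≤ (n:ℝ)) (s : ℝ) (h1 : (n:ℝ) ≤ s)
    (h2 : s ≤ n + Real.exp (-(4*(n:ℝ)^2))) : Real.exp ((n:ℝ)^4 - 1) ≤ mm s := by
  set x : ℝ := (n:ℝ) with hx
  unfold mm
  apply Real.exp_le_exp.2
  rw [sin_sq_shift n s]
  change x^4 - 1 ≤ s^4 - Real.exp (s^2)^6 * Real.sin (Real.pi * (s - x))^2
  set ρ := Real.exp (-(4*x^2)) with hρ
  have hρ0 : 0 < ρ := Real.exp_pos _
  have hρ1 : ρ * (4 * x^2) ≤ 1 := by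
    have h := Real.add_one_le_exp (4*x^2)
    have : ρ * Real.exp (4*x^2) = 1 := by rw [hρ, ← Real.exp_add]; simp
    nlinarith
  have l1 : s^2 ≤ x^2 + 1 := by
    have g1 : ρ * 1 ≤ ρ * x := mul_le_mul_of_nonneg_left (by linarith) hρ0.le
    have g2 : ρ * x ≤ ρ * x^2 := mul_le_mul_of_nonneg_left (by nlinarith) hρ0.le
    have g3 : s^2 ≤ (x + ρ)^2 := pow_le_pow_left₀ (by linarith) h2 2
    nlinarith
  have l2 : Real.exp (s^2)^6 ≤ Real.exp (6 * x^2 + 6) := by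
    rw [← Real.exp_nat_mul]
    apply Real.exp_le_exp.2; push_cast; linarith
  have l3 : Real.sin (Real.pi * (s - x))^2 ≤ 10 * Real.exp (-(8*x^2)) := by
    have hh := abs_sin_pi_le (s - x) 0
    simp only [Int.cast_zero, sub_zero] at hh
    have h3 : |s - x| ≤ ρ := by rw [abs_le]; constructor <;> linarith
    have h4 : |Real.sin (Real.pi * (s-x))| ≤ 3.15 * ρ :=
      hh.trans (mul_le_mul Real.pi_lt_d2.le h3 (abs_nonneg _) (by norm_num))
    have h5 : ρ ^ 2 = Real.exp (-(8*x^2)) := by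
      rw [hρ, ← Real.exp_nat_mul]; push_cast; ring_nf
    rw [← sq_abs, ← h5]
    nlinarith [abs_nonneg (Real.sin (Real.pi * (s-x)))]
  have l4 : Real.exp (s^2)^6 * Real.sin (Real.pi * (s - x))^2 ≤
      Real.exp (6 * x^2 + 6) * (10 * Real.exp (-(8*x^2))) :=
    mul_le_mul l2 l3 (sq_nonneg _) (Real.exp_pos _).le
  have l5 : Real.exp (6 * x^2 + 6) * (10 * Real.exp (-(8*x^2))) ≤ 1 := by
    have e : Real.exp (6 * x^2 + 6) * (10 * Real.exp (-(8*x^2))) = 10 * Real.exp (6 - 2 * x^2) := by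
      rw [mul_left_comm, ← Real.exp_add]; ring_nf
    rw [e]
    have h := Real.add_one_le_exp (2*x^2 - 6)
    have : Real.exp (6 - 2*x^2) * Real.exp (2*x^2 - 6) = 1 := by rw [← Real.exp_add]; simp
    have hz := Real.exp_pos (6 - 2*x^2)
    have hw : 10 ≤ Real.exp (2*x^2 - 6) := by nlinarith
    have := mul_le_mul_of_nonneg_left hw hz.le
    linarith
  have l6 : x^4 ≤ s^4 := pow_le_pow_left₀ (by linarith) h1 4
  linarith

lemma mm_upper (s : ℝ) : mm s ≤ Real.exp (s^4) := by
  unfold mm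
  apply Real.exp_le_exp.2
  have : 0 ≤ Real.exp (s ^ 2) ^ 6 * Real.sin (Real.pi * s) ^ 2 := by positivity
  linarith

/-- growth of the mass -/
lemma mass_growth (n0 k : ℕ) (hn0 : 10 ≤ n0) 
    (hexp : 1000 * ((n0 + k : ℕ):ℝ) ^ 4 ≤ Real.exp ((n0 + k : ℕ):ℝ)) :
    (1 + ∫ r in ((n0:ℝ) - 1/2)..((n0:ℝ) - 1/2 + k), mm r) * (3 * ((n0 + k : ℕ):ℝ)) ≤
    1 / (((n0 + k : ℕ):ℝ) + 1) * (1 + ∫ r in ((n0:ℝ) - 1/2)..((n0:ℝ) - 1/2 + k + 1), mm r) := by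
  set x : ℝ := ((n0 + k : ℕ):ℝ) with hx
  have hn0R : (10:ℝ) ≤ n0 := by exact_mod_cast hn0
  have hk : (0:ℝ) ≤ k := k.cast_nonneg
  have hxe : x = n0 + k := by rw [hx]; push_cast; ring
  have hx10 : 10 ≤ x := by linarith
  have hI : ∀ x y : ℝ, IntervalIntegrable mm MeasureTheory.volume x y := fun x y =>
    mm_cont.intervalIntegrable x y
  have up : ∫ r in ((n0:ℝ) - 1/2)..((n0:ℝ) - 1/2 + k), mm r ≤ k * Real.exp ((x-1/2)^4) := by
    have h : ∫ r in ((n0:ℝ) - 1/2)..((n0:ℝ) - 1/2 + k), mm r ≤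
        ∫ r in ((n0:ℝ) - 1/2)..((n0:ℝ) - 1/2 + k), Real.exp ((x-1/2)^4) := by
      apply intervalIntegral.integral_mono_on (by linarith) (hI _ _) (by simp)
      intro r hr
      refine (mm_upper r).trans (Real.exp_le_exp.2 ?_)
      exact pow_le_pow_left₀ (by linarith [hr.1]) (by linarith [hr.2]) 4
    simpa using h
  set ρ := Real.exp (-(4*x^2)) with hρ
  have hρ0 : 0 < ρ := Real.exp_pos _
  have hρ1 : ρ * (4 * x^2) ≤ 1 := by
    have h := Real.add_one_le_exp (4*x^2)
    have : ρ * Real.exp (4*x^2) = 1 := by rw [hρ, ← Real.exp_add]; simp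
    nlinarith
  have hρ2 : ρ ≤ 1/2 := by nlinarith
  have low : ρ * Real.exp (x^4-1) ≤ ∫ r in ((n0:ℝ) - 1/2)..((n0:ℝ) - 1/2 + k + 1), mm r := by
    have h : ∫ r in x..(x+ρ), Real.exp (x^4-1) ≤ ∫ r in x..(x+ρ), mm r := by
      apply intervalIntegral.integral_mono_on (by linarith) (by simp) (hI _ _)
      intro r hr
      exact mm_lower (n0+k) hx10 r hr.1 hr.2
    have h' : ∫ r in x..(x+ρ), mm r ≤ ∫ r in ((n0:ℝ) - 1/2)..((n0:ℝ) - 1/2 + k + 1), mm r := by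
      apply intervalIntegral.integral_mono_interval (by linarith) (by linarith) (by linarith)
      · exact Filter.Eventually.of_forall (fun r => (mm_pos r).le)
      · exact hI _ _
    have h'' : ∫ r in x..(x+ρ), Real.exp (x^4-1) = ρ * Real.exp (x^4-1) := by simp
    linarith
  have hE1 : 1 ≤ Real.exp ((x-1/2)^4) := Real.one_le_exp (by positivity)
  have k1 : 1 + ∫ r in ((n0:ℝ) - 1/2)..((n0:ℝ) - 1/2 + k), mm r ≤ x * Real.exp ((x-1/2)^4) := by
    nlinarith
  have k2 : Real.exp x * Real.exp ((x-1/2)^4) ≤ ρ * Real.exp (x^4-1) := by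
    rw [hρ, ← Real.exp_add, ← Real.exp_add]
    apply Real.exp_le_exp.2
    nlinarith [pow_pos (by linarith : 0 < x) 2, pow_pos (by linarith : 0 < x) 3]
  rw [div_mul_eq_mul_div, one_mul, le_div_iff₀ (by linarith)]
  have k3 : (x * Real.exp ((x-1/2)^4)) * (3 * x) * (x + 1) ≤ Real.exp x * Real.exp ((x-1/2)^4) := by
    have : x * (3 * x) * (x+1) ≤ Real.exp x := by
      nlinarith [pow_pos (by linarith : 0 < x) 2, pow_pos (by linarith : 0 < x) 3]
    nlinarith
  have k4 := mul_le_mul_of_nonneg_right (mul_le_mul_of_nonneg_right k1 (by linarith : 0 ≤ 3 * x))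
    (by linarith : 0 ≤ x + 1)
  linarith

lemma gamma_aux (E γ θ η : ℝ) (h0 : θ ≤ E * γ) (h1 : E * γ ≤ θ + 2 * η) (h2 : 0 ≤ θ)
    (h3 : θ ≤ 1 / 2) (h4 : η ≤ 1 / 2) (h5 : 1 ≤ E) : |γ| ≤ 2 := by
  rw [abs_le]
  constructor
  · by_contra h
    push Not at h
    nlinarith
  · by_contra h
    push Not at h
    nlinarith

lemma decode (n0 : ℕ) (hn0 : 10 ≤ n0) (hexp : ∀ x : ℝ, n0 ≤ x → 1000 * x ^ 4 ≤ Real.exp x)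
    (A : ℕ → ℝ) (hA0 : |A 0| ≤ n0) (hA : ∀ k : ℕ, |A (k+1)| ≤ n0 + k) :
    ∃ γ : ℝ, ∀ k : ℕ, ∀ s ∈ Set.Icc ((n0:ℝ) - 1/2 + k) ((n0:ℝ) - 1/2 + k + 1), ∀ F d,
      |A k - F| ≤ d → |A (k+1) - F| ≤ d →
      |(A 0 + ∫ r in ((n0:ℝ) - 1/2)..s, mm r * TT (2 * Real.pi * γ) r) /
        (1 + ∫ r in ((n0:ℝ) - 1/2)..s, mm r) - F| ≤ d + 3 * (1 / (n0 + k)) := by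
  have hn0R : (10:ℝ) ≤ n0 := by exact_mod_cast hn0
  have hk : ∀ k : ℕ, (0:ℝ) ≤ k := fun k => k.cast_nonneg
  have hpi := Real.pi_pos
  have hratio : ∀ k : ℕ, Real.exp (((n0:ℝ) + (k+1 : ℕ))^2) =
      Real.exp (((n0:ℝ) + k)^2) * Real.exp (2 * (n0 + k) + 1) := by
    intro k
    rw [← Real.exp_add]; push_cast; ring_nf
  obtain ⟨γ, ⟨hγ0, hγ1⟩, hγ⟩ := exists_phase (fun k => Real.exp (((n0:ℝ) + k)^2))
    (fun k => Real.arccos (A (k+1) / (n0 + k)) / (2 * Real.pi)) (fun k => Real.exp_pos _)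
    (by
      intro k
      beta_reduce
      rw [hratio, mul_comm]
      apply mul_le_mul_of_nonneg_left _ (Real.exp_pos _).le
      have := Real.add_one_le_exp (2 * ((n0:ℝ) + k) + 1)
      linarith [hk k])
  have hq : ∀ k : ℕ, 2 * Real.exp (((n0:ℝ) + k)^2) / Real.exp (((n0:ℝ) + (k+1 : ℕ))^2) =
      2 * Real.exp (-(2 * (n0 + k) + 1)) := by
    intro k
    rw [hratio, Real.exp_neg]
    have := Real.exp_pos (((n0:ℝ) + k)^2)
    field_simp
  have hγ2 : |γ| ≤ 2 := by
    have h1 := hq 0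
    simp only [zero_add] at h1
    rw [h1] at hγ1
    have h2 := Real.arccos_nonneg (A (0+1) / (n0 + (0:ℕ)))
    have h3 := Real.arccos_le_pi (A (0+1) / (n0 + (0:ℕ)))
    have h4 : Real.arccos (A (0+1) / (n0 + (0:ℕ))) / (2 * Real.pi) ≤ 1 / 2 := by
      rw [div_le_div_iff₀ (by positivity) (by norm_num)]; linarith
    have h5 : 0 ≤ Real.arccos (A (0+1) / (n0 + (0:ℕ))) / (2 * Real.pi) := by positivity
    have h6 : Real.exp (-(2 * ((n0:ℝ) + (0:ℕ)) + 1)) ≤ 1 / 2 := by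
      have g1 := Real.add_one_le_exp (2 * ((n0:ℝ) + (0:ℕ)) + 1)
      rw [Real.exp_neg, ← one_div]
      apply one_div_le_one_div_of_le (by norm_num)
      have := hk 0
      linarith
    have h7 : 1 ≤ Real.exp (((n0:ℝ) + (0:ℕ))^2) := Real.one_le_exp (by positivity)
    exact gamma_aux _ _ _ _ hγ0 hγ1 h5 h4 h6 h7
  refine ⟨γ, ?_⟩
  have hcos : ∀ k : ℕ, |Real.cos (2 * Real.pi * γ * Real.exp (((n0 + k : ℕ):ℝ)^2))
      - A (k+1) / ((n0 + k : ℕ):ℝ)| ≤ 4 * Real.pi * Real.exp (-(2 * ((n0+k : ℕ):ℝ) + 1)) := by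
    intro k
    obtain ⟨P, hP1, hP2⟩ := hγ k
    rw [hq] at hP2
    push_cast
    have hnk : (0:ℝ) < n0 + k := by linarith [hk k]
    have hle := hA k
    have hr : |A (k+1) / ((n0:ℝ) + k)| ≤ 1 := by
      rw [abs_div, abs_of_pos hnk, div_le_one hnk]; exact hle
    set θ := Real.arccos (A (k+1) / ((n0:ℝ) + k)) with hθ
    have hc : Real.cos θ = A (k+1) / ((n0:ℝ) + k) :=
      Real.cos_arccos (abs_le.1 hr).1 (abs_le.1 hr).2
    have hc2 : Real.cos (θ + P * (2 * Real.pi)) = Real.cos θ := Real.cos_add_int_mul_two_pi θ P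
    rw [← hc, ← hc2]
    refine (abs_cos_sub_le _ _).trans ?_
    have e : θ = 2 * Real.pi * (θ / (2 * Real.pi)) := by field_simp
    set w := θ / (2 * Real.pi)
    rw [e, abs_le]
    constructor <;> nlinarith [Real.exp_pos (-(2 * ((n0:ℝ) + k) + 1))]
  have hres := core_avg mm (TT (2 * Real.pi * γ)) mm_cont (TT_cont _) (fun s => (mm_pos s).le)
    ((n0:ℝ) - 1/2) A (fun k => 1 / ((n0:ℝ) + k))
    (fun k => by have := hk k; positivity)
    (fun k => by
      have := hk k
      apply one_div_le_one_div_of_le (by linarith); push_cast; linarith)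
    (fun s => 1 + ∫ r in ((n0:ℝ) - 1/2)..s, mm r)
    (fun s => A 0 + ∫ r in ((n0:ℝ) - 1/2)..s, mm r * TT (2 * Real.pi * γ) r)
    (fun s => rfl) (fun s => rfl) ?_ ?_
  · exact hres
  · intro k s hs
    have h := block_bound (n0+k) (by push_cast; linarith [hk k])
      (hexp _ (by push_cast; linarith [hk k])) γ (A (k+1)) hγ2 (by push_cast; exact hA k) (hcos k) s
      (by rw [abs_le]; push_cast; constructor <;> linarith [hs.1, hs.2])
    push_cast at h ⊢
    rw [← add_assoc]
    exact h
  · intro k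
    have h := mass_growth n0 k hn0 (hexp _ (by push_cast; linarith [hk k]))
    have hb : |A k - A (k+1)| + 2 * (1 / ((n0:ℝ) + k)) ≤ 3 * ((n0 + k : ℕ):ℝ) := by
      have h1 : |A k| ≤ n0 + k := by
        cases k with
        | zero => simpa using hA0
        | succ j => refine (hA j).trans ?_; push_cast; linarith
      have h2 := hA k
      have h3 := abs_sub (A k) (A (k+1))
      have h4 : 1 / ((n0:ℝ) + k) ≤ 1 := by
        rw [div_le_one (by linarith [hk k])]; linarith [hk k]
      push_cast
      linarith [hk k]
    have hM0 : 0 ≤ 1 + ∫ r in ((n0:ℝ) - 1/2)..((n0:ℝ) - 1/2 + k), mm r := by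
      have := intervalIntegral.integral_nonneg (μ := MeasureTheory.volume)
        (by linarith [hk k] : (n0:ℝ) - 1/2 ≤ (n0:ℝ) - 1/2 + k) (fun s _ => (mm_pos s).le)
      linarith
    refine (mul_le_mul_of_nonneg_left hb hM0).trans ?_
    push_cast at h ⊢
    rw [← add_assoc]
    exact h

lemma exists_phi (f ε : ℝ → ℝ) (hf : Continuous f) (hε : Continuous ε)
    (hpos : ∀ t, 0 ≤ t → 0 < ε t) :
    ∃ φ : ℝ → ℝ, Monotone φ ∧ (∀ t, 0 ≤ t → |f t| ≤ φ t) ∧ (∀ t, 0 ≤ t → 12 / ε t ≤ φ t) ∧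
      ∀ t₁ t₂, 0 ≤ t₁ → t₁ ≤ t₂ → (t₂ - t₁) * φ t₁ ≤ 2 →
        |f t₁ - f t₂| ≤ ε t₁ / 2 ∧ |f t₁ - f t₂| ≤ ε t₂ / 2 := by
  have hc : ∀ N : ℕ, ∃ c : ℝ, 0 ≤ c ∧ 2 ≤ c ∧ (∀ t ∈ Set.Icc (0:ℝ) (N+2), |f t| ≤ c ∧ 12 / ε t ≤ c) ∧
      ∀ t₁ ∈ Set.Icc (0:ℝ) (N+2), ∀ t₂ ∈ Set.Icc (0:ℝ) (N+2), |t₁ - t₂| * c ≤ 2 →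
      ∀ t ∈ Set.Icc (0:ℝ) (N+2), |f t₁ - f t₂| ≤ ε t / 2 := by
    intro N
    have hK : IsCompact (Set.Icc (0:ℝ) (N+2)) := isCompact_Icc
    have hne : (Set.Icc (0:ℝ) (N+2)).Nonempty := ⟨0, by constructor <;> positivity⟩
    obtain ⟨te, hte, hmin⟩ := hK.exists_isMinOn hne hε.continuousOn
    obtain ⟨B, hB⟩ := hK.exists_bound_of_continuousOn hf.continuousOn
    have he : 0 < ε te := hpos _ hte.1
    have hu := hK.uniformContinuousOn_of_continuous hf.continuousOn
    rw [Metric.uniformContinuousOn_iff] at hu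
    obtain ⟨δ, hδ, hδ'⟩ := hu (ε te / 2) (by linarith)
    have hB0 : 0 ≤ B := (norm_nonneg _).trans (hB 0 ⟨le_rfl, by positivity⟩)
    have h12 : 0 < 12 / ε te := by positivity
    have h4 : 0 < 4 / δ := by positivity
    refine ⟨B + 12 / ε te + 4 / δ + 2, by linarith, by linarith, ?_, ?_⟩
    · intro t ht
      constructor
      · have := hB t ht
        rw [Real.norm_eq_abs] at this
        linarith
      · have : 12 / ε t ≤ 12 / ε te := div_le_div_of_nonneg_left (by norm_num) he (hmin ht)
        linarith
    · intro t₁ h1 t₂ h2 hd t ht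
      have hdd : dist t₁ t₂ < δ := by
        rw [Real.dist_eq]
        by_contra hcon
        push Not at hcon
        have h5 : δ * (4 / δ) = 4 := by field_simp
        have h6 : |t₁ - t₂| * (4 / δ) ≤ |t₁ - t₂| * (B + 12 / ε te + 4 / δ + 2) :=
          mul_le_mul_of_nonneg_left (by linarith) (abs_nonneg _)
        have h7 := mul_le_mul_of_nonneg_right hcon h4.le
        linarith
      have h8 := hδ' t₁ h1 t₂ h2 hdd
      rw [Real.dist_eq] at h8
      have h9 : ε te ≤ ε t := hmin ht
      linarith
  choose c c0 c2 c3 c4 using hc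
  let φ : ℝ → ℝ := fun t => ∑ i ∈ Finset.range (⌊t⌋₊ + 1), c i
  have hφ : Monotone φ := by
    intro x y hxy
    apply Finset.sum_le_sum_of_subset_of_nonneg
    · intro i hi
      rw [Finset.mem_range] at hi ⊢
      have := Nat.floor_mono hxy
      omega
    · intro i _ _; exact c0 i
  have hφc : ∀ t, c ⌊t⌋₊ ≤ φ t := fun t =>
    Finset.single_le_sum (f := c) (fun i _ => c0 i) (Finset.self_mem_range_succ _)
  have hmem : ∀ t, 0 ≤ t → t ∈ Set.Icc (0:ℝ) (⌊t⌋₊ + 2) := by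
    intro t ht
    have := Nat.lt_floor_add_one t
    exact ⟨ht, by linarith⟩
  refine ⟨φ, hφ, fun t ht => ((c3 _ t (hmem t ht)).1).trans (hφc t),
    fun t ht => ((c3 _ t (hmem t ht)).2).trans (hφc t), ?_⟩
  intro t₁ t₂ h1 h12 hd
  have k1 := hφc t₁
  have k2 := c2 ⌊t₁⌋₊
  have k3 := mul_le_mul_of_nonneg_left k1 (by linarith : 0 ≤ t₂ - t₁)
  have k4 := mul_le_mul_of_nonneg_left k2 (by linarith : 0 ≤ t₂ - t₁)
  have hm2 : t₂ ∈ Set.Icc (0:ℝ) (⌊t₁⌋₊ + 2) := by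
    have := Nat.lt_floor_add_one t₁
    exact ⟨by linarith, by linarith⟩
  have h := c4 ⌊t₁⌋₊ t₁ (hmem t₁ h1) t₂ hm2 (by
    rw [abs_sub_comm, abs_of_nonneg (by linarith)]; linarith)
  exact ⟨h t₁ (hmem t₁ h1), h t₂ hm2⟩

/-- uniqueness for polynomial fields -/
lemma poly_unique {d : ℕ} (p : Fin (d+1) → MvPolynomial (Fin (d+1)) ℚ)
    (y z : ℝ → (Fin (d+1) → ℝ)) (h0 : z 0 = y 0)
    (hy : ∀ t ∈ Set.Ici (0:ℝ), HasDerivWithinAt y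
      (fun i => MvPolynomial.aeval (y t) (p i)) (Set.Ici (0:ℝ)) t)
    (hz : ∀ t ∈ Set.Ici (0:ℝ), HasDerivWithinAt z
      (fun i => MvPolynomial.aeval (z t) (p i)) (Set.Ici (0:ℝ)) t) :
    ∀ t ∈ Set.Ici (0:ℝ), z t = y t := by
  intro T hT
  have hyc : ContinuousOn y (Set.Icc 0 T) := fun t ht =>
    ((hy t ht.1).continuousWithinAt).mono (fun _ h => h.1)
  have hzc : ContinuousOn z (Set.Icc 0 T) := fun t ht =>
    ((hz t ht.1).continuousWithinAt).mono (fun _ h => h.1)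
  let v : (Fin (d+1) → ℝ) → (Fin (d+1) → ℝ) := fun x i => MvPolynomial.aeval x (p i)
  have hv : ContDiff ℝ 1 v := by
    rw [contDiff_pi]
    intro i
    change ContDiff ℝ 1 (fun x : Fin (d+1) → ℝ => MvPolynomial.aeval x (p i))
    induction p i using MvPolynomial.induction_on with
    | C a => simp only [MvPolynomial.aeval_C]; exact contDiff_const
    | add a b ha hb => simp only [map_add]; exact ha.add hb
    | mul_X a j ha =>
      simp only [map_mul, MvPolynomial.aeval_X]
      exact ha.mul (contDiff_apply ℝ ℝ j)
  obtain ⟨B1, hB1⟩ := isCompact_Icc.exists_bound_of_continuousOn hyc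
  obtain ⟨B2, hB2⟩ := isCompact_Icc.exists_bound_of_continuousOn hzc
  have hcb : IsCompact (Metric.closedBall (0 : Fin (d+1) → ℝ) (max B1 B2)) :=
    isCompact_closedBall _ _
  obtain ⟨K, hK⟩ := hv.contDiffOn.exists_lipschitzOnWith (s := Metric.closedBall (0 : Fin (d+1) → ℝ) (max B1 B2))
    one_ne_zero (convex_closedBall _ _) hcb
  have := ODE_solution_unique_of_mem_Icc_right (v := fun _ => v)
    (s := fun _ => Metric.closedBall (0 : Fin (d+1) → ℝ) (max B1 B2)) (K := K) (a := 0) (b := T)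
    (f := z) (g := y) (fun t _ => hK) hzc
    (fun t ht => (hz t ht.1).mono (Set.Ici_subset_Ici.2 ht.1))
    (fun t ht => by
      rw [mem_closedBall_zero_iff]
      exact (hB2 t ⟨ht.1, ht.2.le⟩).trans (le_max_right _ _))
    hyc
    (fun t ht => (hy t ht.1).mono (Set.Ici_subset_Ici.2 ht.1))
    (fun t ht => by
      rw [mem_closedBall_zero_iff]
      exact (hB1 t ⟨ht.1, ht.2.le⟩).trans (le_max_left _ _))
    h0
  exact this ⟨hT, le_rfl⟩

section system
open MvPolynomial

/-- the speed `h = S (1 + g_a + g_b)` -/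
noncomputable def hp : MvPolynomial (Fin 21) ℚ := X 8 * (1 + X 9 + X 10)

noncomputable def pp : Fin 21 → MvPolynomial (Fin 21) ℚ :=
  ![X 2 * hp * X 1 * (X 8 * X 4 - X 0),
    - (X 1 ^ 2 * X 2 * hp),
    X 2 * (hp * (4 * X 8 ^ 3 - (12 * X 8 * X 5 ^ 6 * X 6 ^ 2 + 2 * X 17 * X 5 ^ 6 * X 6 * X 7))),
    X 4 * (X 20 * (2 * X 8 * X 5 * hp)),
    - (X 3 * (X 20 * (2 * X 8 * X 5 * hp))),
    2 * X 8 * X 5 * hp,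
    X 7 * (X 17 * hp),
    - (X 6 * (X 17 * hp)),
    hp,
    - (X 9 ^ 2 * (2 * X 17 * X 11 * X 12 + 2 * X 18 * X 13 * X 14)),
    - (X 10 ^ 2 * (2 * X 17 * X 11 * X 12 + 2 * X 19 * X 15 * X 16)),
    X 12 * X 17, - (X 11 * X 17),
    X 14 * X 18, - (X 13 * X 18),
    X 16 * X 19, - (X 15 * X 19),
    0, 0, 0, 0]

end system

noncomputable def SS (a b C t : ℝ) : ℝ :=
  Real.exp (C + t + ∫ s in (0:ℝ)..t, (gg a s + gg b s))

lemma SS_deriv {a b : ℝ} (ha : ∀ t, 0 ≤ t → 0 < DD a t) (hb : ∀ t, 0 ≤ t → 0 < DD b t) (C t : ℝ) :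
    HasDerivAt (SS a b C) (SS a b C t * (1 + gg a t + gg b t)) t := by
  unfold SS
  have hc : Continuous (fun s => gg a s + gg b s) := (gg_cont ha).add (gg_cont hb)
  have h1 : HasDerivAt (fun t => ∫ s in (0:ℝ)..t, (gg a s + gg b s)) (gg a t + gg b t) t :=
    (hc.integral_hasStrictDerivAt 0 t).hasDerivAt
  have h2 : HasDerivAt (fun t => Real.exp (C + t + ∫ s in (0:ℝ)..t, (gg a s + gg b s)))
      (Real.exp (C + t + ∫ s in (0:ℝ)..t, (gg a s + gg b s)) * (1 + (gg a t + gg b t))) t :=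
    (((hasDerivAt_id t).const_add C).add h1).exp
  exact h2.congr_deriv (by ring)

noncomputable def MM (s0 s : ℝ) : ℝ := 1 + ∫ r in s0..s, mm r
noncomputable def NN (A0 c s0 s : ℝ) : ℝ := A0 + ∫ r in s0..s, mm r * TT c r

noncomputable def sol (a b C c s0 A0 : ℝ) (t : ℝ) : Fin 21 → ℝ :=
  ![NN A0 c s0 (SS a b C t) / MM s0 (SS a b C t),
    (MM s0 (SS a b C t))⁻¹,
    mm (SS a b C t),
    Real.sin (c * Real.exp (SS a b C t ^ 2)),
    Real.cos (c * Real.exp (SS a b C t ^ 2)),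
    Real.exp (SS a b C t ^ 2),
    Real.sin (Real.pi * SS a b C t),
    Real.cos (Real.pi * SS a b C t),
    SS a b C t,
    (DD a t)⁻¹, (DD b t)⁻¹,
    Real.sin (Real.pi * (t+1)), Real.cos (Real.pi * (t+1)),
    Real.sin (Real.pi * a * (t+1)), Real.cos (Real.pi * a * (t+1)),
    Real.sin (Real.pi * b * (t+1)), Real.cos (Real.pi * b * (t+1)),
    Real.pi, Real.pi * a, Real.pi * b, c]

lemma DD_deriv (a t : ℝ) : HasDerivAt (DD a)
    (2 * Real.pi * Real.sin (Real.pi * (t+1)) * Real.cos (Real.pi * (t+1)) +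
      2 * (Real.pi * a) * Real.sin (Real.pi * a * (t+1)) * Real.cos (Real.pi * a * (t+1))) t := by
  unfold DD
  have h1 : ∀ w, HasDerivAt (fun t : ℝ => w * (t+1)) w t := fun w => by
    simpa using ((hasDerivAt_id t).add_const 1).const_mul w
  have h2 := ((h1 Real.pi).sin.pow 2).add ((h1 (Real.pi * a)).sin.pow 2)
  refine h2.congr_deriv ?_
  push_cast
  ring

set_option maxHeartbeats 4000000 in
lemma sol_deriv {a b : ℝ} (ha : ∀ t, 0 ≤ t → 0 < DD a t) (hb : ∀ t, 0 ≤ t → 0 < DD b t)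
    (C c s0 A0 t : ℝ) (ht : 0 ≤ t) (hM : MM s0 (SS a b C t) ≠ 0) :
    HasDerivAt (sol a b C c s0 A0)
      (fun i => MvPolynomial.aeval (sol a b C c s0 A0 t) (pp i)) t := by
  have hga : gg a t = (DD a t)⁻¹ := by unfold gg; rw [max_eq_left ht]
  have hgb : gg b t = (DD b t)⁻¹ := by unfold gg; rw [max_eq_left ht]
  have hS := SS_deriv ha hb C t
  rw [hga, hgb] at hS
  have hMs : HasDerivAt (fun t => MM s0 (SS a b C t)) (mm (SS a b C t) *
      (SS a b C t * (1 + (DD a t)⁻¹ + (DD b t)⁻¹))) t := by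
    have h1 : HasDerivAt (MM s0) (mm (SS a b C t)) (SS a b C t) :=
      ((mm_cont.integral_hasStrictDerivAt s0 _).hasDerivAt).const_add 1
    exact h1.comp t hS
  have hNs : HasDerivAt (fun t => NN A0 c s0 (SS a b C t)) (mm (SS a b C t) * TT c (SS a b C t) *
      (SS a b C t * (1 + (DD a t)⁻¹ + (DD b t)⁻¹))) t := by
    have h1 : HasDerivAt (NN A0 c s0) (mm (SS a b C t) * TT c (SS a b C t)) (SS a b C t) :=
      (((mm_cont.mul (TT_cont c)).integral_hasStrictDerivAt s0 _).hasDerivAt).const_add A0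
    exact h1.comp t hS
  have hE := (hS.pow 2).exp
  have hcE := hE.const_mul c
  have hpS := hS.const_mul Real.pi
  have hl : ∀ w, HasDerivAt (fun t : ℝ => w * (t+1)) w t := fun w => by
    simpa using ((hasDerivAt_id t).add_const 1).const_mul w
  have hm : HasDerivAt (fun t => mm (SS a b C t)) _ t :=
    ((hS.pow 4).sub ((hE.pow 6).mul (hpS.sin.pow 2))).exp
  rw [hasDerivAt_pi]
  intro i
  have hDa := (ha t ht).ne'
  have hDb := (hb t ht).ne'
  fin_cases i
  · refine (hNs.div hMs hM).congr_deriv ?_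
    simp [pp, sol, hp, TT]
    field_simp
    try ring
  · refine (hMs.inv hM).congr_deriv ?_
    simp [pp, sol, hp]
    field_simp
    try ring
  · refine hm.congr_deriv ?_
    simp [pp, sol, hp, mm]
    try ring
  · refine hcE.sin.congr_deriv ?_
    simp [pp, sol, hp, -mul_eq_mul_left_iff, -mul_eq_mul_right_iff]
    ring
  · refine hcE.cos.congr_deriv ?_
    simp [pp, sol, hp, -mul_eq_mul_left_iff, -mul_eq_mul_right_iff]
    ring
  · refine hE.congr_deriv ?_
    simp [pp, sol, hp]
    try ring
  · refine hpS.sin.congr_deriv ?_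
    simp [pp, sol, hp]
  · refine hpS.cos.congr_deriv ?_
    simp [pp, sol, hp]
  · refine hS.congr_deriv ?_
    simp [pp, sol, hp]
  · refine ((DD_deriv a t).inv hDa).congr_deriv ?_
    simp [pp, sol, hp]
    field_simp
    try ring
  · refine ((DD_deriv b t).inv hDb).congr_deriv ?_
    simp [pp, sol, hp]
    field_simp
    try ring
  · exact (hl Real.pi).sin.congr_deriv (by simp [pp, sol])
  · exact (hl Real.pi).cos.congr_deriv (by simp [pp, sol])
  · exact (hl (Real.pi * a)).sin.congr_deriv (by simp [pp, sol])
  · exact (hl (Real.pi * a)).cos.congr_deriv (by simp [pp, sol])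
  · exact (hl (Real.pi * b)).sin.congr_deriv (by simp [pp, sol])
  · exact (hl (Real.pi * b)).cos.congr_deriv (by simp [pp, sol])
  · exact (hasDerivAt_const t Real.pi).congr_deriv (by simp [pp])
  · exact (hasDerivAt_const t (Real.pi * a)).congr_deriv (by simp [pp])
  · exact (hasDerivAt_const t (Real.pi * b)).congr_deriv (by simp [pp])
  · exact (hasDerivAt_const t c).congr_deriv (by simp [pp])


lemma SS_pos (a b C t : ℝ) : 0 < SS a b C t := Real.exp_pos _

lemma SS_zero (a b C : ℝ) : SS a b C 0 = Real.exp C := by simp [SS]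

lemma SS_gap {a b : ℝ} (ha : ∀ t, 0 ≤ t → 0 < DD a t) (hb : ∀ t, 0 ≤ t → 0 < DD b t)
    (C t₁ t₂ : ℝ) (h12 : t₁ ≤ t₂) :
    (t₂ - t₁) * SS a b C t₁ ≤ SS a b C t₂ - SS a b C t₁ := by
  have hc : Continuous (fun s => gg a s + gg b s) := (gg_cont ha).add (gg_cont hb)
  have h1 : SS a b C t₁ * Real.exp (t₂ - t₁) ≤ SS a b C t₂ := by
    unfold SS
    rw [← Real.exp_add]
    apply Real.exp_le_exp.mpr
    have h2 := intervalIntegral.integral_add_adjacent_intervals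
      (hc.intervalIntegrable (μ := MeasureTheory.volume) 0 t₁) (hc.intervalIntegrable t₁ t₂)
    have h3 : 0 ≤ ∫ s in t₁..t₂, (gg a s + gg b s) :=
      intervalIntegral.integral_nonneg h12 (fun s _ => add_nonneg (gg_nonneg a s) (gg_nonneg b s))
    linarith
  have h2 := Real.add_one_le_exp (t₂ - t₁)
  have h3 := SS_pos a b C t₁
  nlinarith

lemma SS_mono {a b : ℝ} (ha : ∀ t, 0 ≤ t → 0 < DD a t) (hb : ∀ t, 0 ≤ t → 0 < DD b t)
    (C t₁ t₂ : ℝ) (h12 : t₁ ≤ t₂) : SS a b C t₁ ≤ SS a b C t₂ := by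
  have h := SS_gap ha hb C t₁ t₂ h12
  have h3 := SS_pos a b C t₁
  nlinarith

lemma SS_cont {a b : ℝ} (ha : ∀ t, 0 ≤ t → 0 < DD a t) (hb : ∀ t, 0 ≤ t → 0 < DD b t)
    (C : ℝ) : Continuous (SS a b C) :=
  continuous_iff_continuousAt.mpr fun t => (SS_deriv ha hb C t).continuousAt

lemma SS_surj {a b : ℝ} (ha : ∀ t, 0 ≤ t → 0 < DD a t) (hb : ∀ t, 0 ≤ t → 0 < DD b t)
    (C x : ℝ) (hx : Real.exp C ≤ x) : ∃ t, 0 ≤ t ∧ SS a b C t = x := by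
  have hp := Real.exp_pos C
  have hT : 0 ≤ x / Real.exp C := div_nonneg (hp.le.trans hx) hp.le
  have h1 := SS_gap ha hb C 0 (x / Real.exp C) hT
  rw [SS_zero, sub_zero, div_mul_cancel₀ _ hp.ne'] at h1
  obtain ⟨t, ht, h⟩ := intermediate_value_Icc hT (SS_cont ha hb C).continuousOn
    (show x ∈ Set.Icc _ _ from ⟨by rw [SS_zero]; exact hx, by linarith⟩)
  exact ⟨t, ht.1, h⟩


lemma near {a b : ℝ} (ha : ∀ t, 0 ≤ t → 0 < DD a t) (hb : ∀ t, 0 ≤ t → 0 < DD b t)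
    (C : ℝ) (f ε φ : ℝ → ℝ) (hφS : ∀ t, 0 ≤ t → φ t ≤ SS a b C t)
    (hmod : ∀ t₁ t₂, 0 ≤ t₁ → t₁ ≤ t₂ → (t₂ - t₁) * φ t₁ ≤ 2 →
      |f t₁ - f t₂| ≤ ε t₁ / 2 ∧ |f t₁ - f t₂| ≤ ε t₂ / 2)
    (t t' : ℝ) (ht : 0 ≤ t) (ht' : 0 ≤ t') (h1 : SS a b C t' - SS a b C t ≤ 2)
    (h2 : SS a b C t - SS a b C t' ≤ 2) : |f t' - f t| ≤ ε t / 2 := by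
  rcases le_total t t' with h | h
  · have g1 := SS_gap ha hb C t t' h
    have g2 := mul_le_mul_of_nonneg_left (hφS t ht) (sub_nonneg.mpr h)
    have := (hmod t t' ht h (by linarith)).1
    rwa [abs_sub_comm]
  · have g1 := SS_gap ha hb C t' t h
    have g2 := mul_le_mul_of_nonneg_left (hφS t' ht') (sub_nonneg.mpr h)
    exact (hmod t' t ht' h (by linarith)).2

open Set in
/-- Universality of polynomial ODEs: there is a fixed vector `p` of
polynomials with rational coefficients such that for every continuous
`f : ℝ → ℝ` and every continuous positive error bound `ε`, some choice of the
initial condition `y₀` makes the pIVP `y(0) = y₀`, `y' = p(y)` have a unique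
solution on `[0, ∞)`, whose first component approximates `f` within `ε`. -/
theorem universal_polynomial_ODE :
    ∃ (d : ℕ) (p : Fin (d + 1) → MvPolynomial (Fin (d + 1)) ℚ),
      ∀ f ε : ℝ → ℝ, Continuous f → Continuous ε → (∀ t : ℝ, 0 ≤ t → 0 < ε t) →
        ∃ y₀ : Fin (d + 1) → ℝ, ∃ y : ℝ → (Fin (d + 1) → ℝ),
          (y 0 = y₀ ∧
            ∀ t ∈ Ici (0 : ℝ),
              HasDerivWithinAt y
                (fun i => MvPolynomial.aeval (y t) (p i)) (Ici (0 : ℝ)) t) ∧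
          (∀ z : ℝ → (Fin (d + 1) → ℝ),
            (z 0 = y₀ ∧
              ∀ t ∈ Ici (0 : ℝ),
                HasDerivWithinAt z
                  (fun i => MvPolynomial.aeval (z t) (p i)) (Ici (0 : ℝ)) t) →
            ∀ t ∈ Ici (0 : ℝ), z t = y t) ∧
          (∀ t ∈ Ici (0 : ℝ), |y t 0 - f t| ≤ ε t) := by
  refine ⟨20, pp, fun f ε hf hε hpos => ?_⟩
  obtain ⟨φ, hφm, hφf, hφε, hmod⟩ := exists_phi f ε hf hε hpos
  obtain ⟨a, b, ha, hb, hgrow⟩ := exists_growth φ hφm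
  obtain ⟨N0, hN0, hN0exp⟩ := exists_large
  obtain ⟨n1, hn1⟩ := exists_nat_ge (Real.exp (φ 1) + 1)
  obtain ⟨n0, hn0N, hn0n⟩ : ∃ n0 : ℕ, N0 ≤ n0 ∧ n1 ≤ n0 :=
    ⟨max N0 n1, le_max_left _ _, le_max_right _ _⟩
  have hn0 : 10 ≤ n0 := hN0.trans hn0N
  have hn0R : (10:ℝ) ≤ n0 := by exact_mod_cast hn0
  have hn1R : (n1:ℝ) ≤ n0 := by exact_mod_cast hn0n
  have hexp : ∀ x : ℝ, (n0:ℝ) ≤ x → 1000 * x ^ 4 ≤ Real.exp x := fun x hx =>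
    hN0exp x (le_trans (by exact_mod_cast hn0N) hx)
  obtain ⟨C, hC⟩ : ∃ C : ℝ, C = Real.log ((n0:ℝ) - 1/2) := ⟨_, rfl⟩
  have hCexp : Real.exp C = (n0:ℝ) - 1/2 := by rw [hC]; exact Real.exp_log (by linarith)
  have hC1 : φ 1 ≤ C := by
    rw [hC]; apply (Real.le_log_iff_exp_le (by linarith)).mpr; linarith
  have hC0 : 0 ≤ C := by rw [hC]; exact Real.log_nonneg (by linarith)
  have hφS : ∀ t, 0 ≤ t → φ t ≤ SS a b C t := by
    intro t ht
    have h1 := hgrow C hC1 hC0 t ht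
    have h2 := Real.add_one_le_exp (C + t + ∫ s in (0:ℝ)..t, (gg a s + gg b s))
    unfold SS
    linarith
  have hS0 : SS a b C 0 = (n0:ℝ) - 1/2 := by rw [SS_zero, hCexp]
  have hSge : ∀ t, 0 ≤ t → (n0:ℝ) - 1/2 ≤ SS a b C t := fun t ht => by
    rw [← hS0]; exact SS_mono ha hb C 0 t ht
  have hτ : ∀ k : ℕ, ∃ t, 0 ≤ t ∧ SS a b C t = n0 + k := fun k =>
    SS_surj ha hb C _ (by
      have : (0:ℝ) ≤ k := Nat.cast_nonneg k
      rw [hCexp]; linarith)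
  choose τ hτ0 hτ using hτ
  let A : ℕ → ℝ := fun k => Nat.casesOn k (f 0) (fun j => f (τ j))
  have hA0e : A 0 = f 0 := rfl
  have hAs : ∀ k, A (k+1) = f (τ k) := fun k => rfl
  have hA0 : |A 0| ≤ n0 := by
    rw [hA0e]
    have h1 := hφf 0 le_rfl
    have h2 := hφS 0 le_rfl
    linarith
  have hA : ∀ k : ℕ, |A (k+1)| ≤ n0 + k := by
    intro k
    rw [hAs]
    have h1 := hφf _ (hτ0 k)
    have h2 := hφS _ (hτ0 k)
    rw [hτ k] at h2
    linarith
  obtain ⟨γ, hγ⟩ := decode n0 hn0 hexp A hA0 hA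
  have hM : ∀ t, 0 ≤ t → MM ((n0:ℝ) - 1/2) (SS a b C t) ≠ 0 := by
    intro t ht
    have : 0 ≤ ∫ r in ((n0:ℝ) - 1/2)..(SS a b C t), mm r :=
      intervalIntegral.integral_nonneg (hSge t ht) (fun s _ => (mm_pos s).le)
    unfold MM
    linarith
  have hder : ∀ t ∈ Ici (0:ℝ), HasDerivWithinAt
      (sol a b C (2 * Real.pi * γ) ((n0:ℝ) - 1/2) (f 0))
      (fun i => MvPolynomial.aeval
        (sol a b C (2 * Real.pi * γ) ((n0:ℝ) - 1/2) (f 0) t) (pp i)) (Ici (0:ℝ)) t :=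
    fun t ht => (sol_deriv ha hb C _ _ _ t ht (hM t ht)).hasDerivWithinAt
  refine ⟨_, sol a b C (2 * Real.pi * γ) ((n0:ℝ) - 1/2) (f 0), ⟨rfl, hder⟩,
    fun z hz => poly_unique pp _ z hz.1 hder hz.2, ?_⟩
  intro t ht
  have ht : 0 ≤ t := ht
  have hεt := hpos t ht
  have hs := hSge t ht
  obtain ⟨k, hk⟩ : ∃ k : ℕ, k = ⌊SS a b C t - ((n0:ℝ) - 1/2)⌋₊ := ⟨_, rfl⟩
  have hk1 : (k:ℝ) ≤ SS a b C t - ((n0:ℝ) - 1/2) := by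
    rw [hk]; exact Nat.floor_le (by linarith)
  have hk2 : SS a b C t - ((n0:ℝ) - 1/2) < k + 1 := by
    rw [hk]; exact Nat.lt_floor_add_one _
  have hk0 : (0:ℝ) ≤ k := Nat.cast_nonneg k
  have hfin := hγ k (SS a b C t) ⟨by linarith, by linarith⟩ (f t) (ε t / 2) ?_ ?_
  · have h3 : 3 * (1 / ((n0:ℝ) + k)) ≤ ε t / 2 := by
      have h4 := (hφε t ht).trans (hφS t ht)
      rw [div_le_iff₀ hεt] at h4
      rw [mul_one_div, div_le_iff₀ (by linarith)]
      nlinarith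
    have h5 : sol a b C (2 * Real.pi * γ) ((n0:ℝ) - 1/2) (f 0) t 0 =
      (A 0 + ∫ r in ((n0:ℝ) - 1/2)..(SS a b C t), mm r * TT (2 * Real.pi * γ) r) /
        (1 + ∫ r in ((n0:ℝ) - 1/2)..(SS a b C t), mm r) := rfl
    rw [h5]
    linarith
  · rcases k with _ | j
    · rw [hA0e]
      push_cast at hk2
      exact near ha hb C f ε φ hφS hmod t 0 ht le_rfl (by linarith) (by linarith)
    · rw [hAs]
      push_cast at hk1 hk2
      exact near ha hb C f ε φ hφS hmod t (τ j) ht (hτ0 j) (by rw [hτ]; linarith)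
        (by rw [hτ]; linarith)
  · rw [hAs]
    exact near ha hb C f ε φ hφS hmod t (τ k) ht (hτ0 k) (by rw [hτ]; linarith)
      (by rw [hτ]; linarith)
end

section
/- Let θ : ℝ → ℝ be defined by θ(x) = exp(−1/x) for x > 0 and θ(x) = 0 for x ≤ 0, and let r : ℝ → ℝ be any infinitely differentiable function such that r(x) = n for every integer n and every x ∈ [n − 1/4, n + 1/4]. Then there exists a constant c > 0 with the following property: for every continuous function f : ℝ → ℝ mapping integers to integers (f(ℤ) ⊆ ℤ) and every x₀ ∈ ℤ, every differentiable function (y₁, y₂, y₃) : [0, ∞) → ℝ³ satisfying y₁'(t) = c·(f(r(y₂(t))) − y₁(t))³·θ(sin(2π·y₃(t))), y₂'(t) = c·(r(y₁(t)) − y₂(t))³·θ(−sin(2π·y₃(t))), y₃'(t) = 1 for all t ≥ 0, with initial conditions y₁(0) = y₂(0) = x₀ and y₃(0) = 0, satisfies |y₂(n) − f^[n](x₀)| ≤ 1/4 for every natural number n, where f^[n] denotes the n-th iterate of f. Consequently r(y₂(n)) = f^[n](x₀) for all n: the stroboscopic view of the continuous-time system at integer times realizes the discrete-time iteration x ↦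 f(x). -/
/-- The smooth switch function: `θ(x) = exp(−1/x)` for `x > 0`, `θ(x) = 0`
for `x ≤ 0`. -/
noncomputable def thetaFn (x : ℝ) : ℝ := if 0 < x then Real.exp (-1 / x) else 0

theorem clock_at {z d : ℝ → ℝ} (hz : ∀ t ∈ Set.Ici (0 : ℝ), HasDerivWithinAt z (d t) (Set.Ici (0 : ℝ)) t)
    {t : ℝ} (ht : 0 < t) : HasDerivAt z (d t) t :=
  (hz t ht.le).hasDerivAt (Ici_mem_nhds ht)

theorem clock_cont {z d : ℝ → ℝ} (hz : ∀ t ∈ Set.Ici (0 : ℝ), HasDerivWithinAt z (d t) (Set.Ici (0 : ℝ)) t)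
    {a b : ℝ} (ha : 0 ≤ a) : ContinuousOn z (Set.Icc a b) := fun t ht =>
  ((hz t (ha.trans ht.1)).continuousWithinAt).mono fun _ hx => ha.trans hx.1

theorem clock_const {z d : ℝ → ℝ} (hz : ∀ t ∈ Set.Ici (0 : ℝ), HasDerivWithinAt z (d t) (Set.Ici (0 : ℝ)) t)
    {a b : ℝ} (ha : 0 ≤ a) (h0 : ∀ t ∈ Set.Icc a b, d t = 0) :
    ∀ t ∈ Set.Icc a b, z t = z a := by
  apply constant_of_has_deriv_right_zero (clock_cont hz ha)
  intro t ht
  have h := hz t (ha.trans ht.1)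
  rw [h0 t ⟨ht.1, ht.2.le⟩] at h
  exact h.mono (Set.Ici_subset_Ici.2 (ha.trans ht.1))

theorem clock_contract {z d g : ℝ → ℝ} {b s : ℝ} (hs : 0 ≤ s)
    (hz : ∀ t ∈ Set.Ici (0 : ℝ), HasDerivWithinAt z (d t) (Set.Ici (0 : ℝ)) t)
    (hd : ∀ t ∈ Set.Icc s (s + 1/2), d t = 24 * Real.exp 2 * (b - z t) ^ 3 * g t)
    (hg0 : ∀ t ∈ Set.Icc s (s + 1/2), 0 ≤ g t)
    (hg1 : ∀ t ∈ Set.Icc (s + 1/12) (s + 5/12), Real.exp (-2) ≤ g t) :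
    |z (s + 1/2) - b| ≤ 1/4 := by
  by_contra! hcon
  have hE : Real.exp 2 * Real.exp (-2) = 1 := by rw [← Real.exp_add]; simp
  have hEp := Real.exp_pos 2
  have hV : ∀ t ∈ Set.Ioo s (s + 1/2), HasDerivAt (fun t => (z t - b)^2)
      (-(48 * Real.exp 2 * ((z t - b)^2)^2 * g t)) t := by
    intro t ht
    have h := ((clock_at hz (lt_of_le_of_lt hs ht.1)).sub_const b).pow 2
    rw [hd t ⟨ht.1.le, ht.2.le⟩] at h
    refine HasDerivAt.congr_deriv h ?_
    simp
    ring
  have hanti : AntitoneOn (fun t => (z t - b)^2) (Set.Icc s (s + 1/2)) := by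
    apply antitoneOn_of_hasDerivWithinAt_nonpos (convex_Icc _ _)
      (f' := fun t => -(48 * Real.exp 2 * ((z t - b)^2)^2 * g t))
    · exact ((clock_cont hz hs).sub continuousOn_const).pow 2
    · intro t ht
      rw [interior_Icc] at ht
      exact (hV t ht).hasDerivWithinAt
    · intro t ht
      rw [interior_Icc] at ht
      have := hg0 t ⟨ht.1.le, ht.2.le⟩
      have : 0 ≤ 48 * Real.exp 2 * ((z t - b)^2)^2 * g t := by positivity
      linarith
  have hlow : ∀ t ∈ Set.Icc s (s + 1/2), 1/16 < (z t - b)^2 := by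
    intro t ht
    have h1 := hanti ht ⟨by linarith, le_rfl⟩ ht.2
    have h2 : 1/16 < (z (s + 1/2) - b)^2 := by
      rw [← sq_abs]; nlinarith
    exact h2.trans_le h1
  have hmono : MonotoneOn (fun t => ((z t - b)^2)⁻¹ - 48 * t) (Set.Icc (s + 1/12) (s + 5/12)) := by
    apply monotoneOn_of_hasDerivWithinAt_nonneg (convex_Icc _ _)
      (f' := fun t => 48 * Real.exp 2 * g t - 48)
    · refine ContinuousOn.sub (ContinuousOn.inv₀ ?_ ?_) (by fun_prop)
      · exact ((clock_cont hz (by linarith)).sub continuousOn_const).pow 2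
      · intro t ht
        have := hlow t ⟨by linarith [ht.1], by linarith [ht.2]⟩
        exact (lt_trans (by norm_num) this).ne'
    · intro t ht
      rw [interior_Icc] at ht
      have hp : 0 < (z t - b)^2 :=
        lt_trans (by norm_num) (hlow t ⟨by linarith [ht.1], by linarith [ht.2]⟩)
      have h := ((hV t ⟨by linarith [ht.1], by linarith [ht.2]⟩).fun_inv hp.ne').sub
        ((hasDerivAt_id t).const_mul 48)
      refine HasDerivAt.hasDerivWithinAt ?_
      refine HasDerivAt.congr_deriv h ?_
      have hne := hp.ne'
      rw [neg_neg, mul_one]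
      congr 1
      generalize (z t - b)^2 = w at hne
      field_simp
    · intro t ht
      rw [interior_Icc] at ht
      have := mul_le_mul_of_nonneg_left (hg1 t ⟨ht.1.le, ht.2.le⟩) hEp.le
      linarith
  have h := hmono (a := s + 1/12) (b := s + 5/12) ⟨le_rfl, by linarith⟩ ⟨by linarith, le_rfl⟩ (by linarith)
  have hp := hlow (s + 1/12) ⟨by linarith, by linarith⟩
  have hq := hlow (s + 5/12) ⟨by linarith, by linarith⟩
  have hp' : 0 < ((z (s + 1/12) - b)^2)⁻¹ := inv_pos.2 (lt_trans (by norm_num) hp)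
  have hq' : ((z (s + 5/12) - b)^2)⁻¹ < 16 := by
    have := inv_strictAnti₀ (by norm_num) hq
    norm_num at this ⊢
    exact this
  simp only at h
  linarith

theorem theta_nonneg (x : ℝ) : 0 ≤ thetaFn x := by
  unfold thetaFn; split_ifs <;> positivity

theorem theta_half {x : ℝ} (h : 1/2 ≤ x) : Real.exp (-2) ≤ thetaFn x := by
  have hx : 0 < x := by linarith
  rw [thetaFn, if_pos hx, Real.exp_le_exp, le_div_iff₀ hx]
  linarith

theorem sin_first (n : ℕ) {t : ℝ} (ht : t ∈ Set.Icc (n : ℝ) (n + 1/2)) :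
    0 ≤ Real.sin (2 * Real.pi * t) := by
  have : Real.sin (2 * Real.pi * t) = Real.sin (2 * Real.pi * (t - n)) := by
    rw [← Real.sin_sub_nat_mul_two_pi _ n]; congr 1; ring
  rw [this]
  have := Real.pi_pos
  apply Real.sin_nonneg_of_nonneg_of_le_pi
  · have := ht.1
    exact mul_nonneg (by positivity) (by linarith)
  · nlinarith [ht.2]

theorem sin_first_half (n : ℕ) {t : ℝ} (ht : t ∈ Set.Icc ((n : ℝ) + 1/12) (n + 5/12)) :
    1/2 ≤ Real.sin (2 * Real.pi * t) := by
  have : Real.sin (2 * Real.pi * t) = Real.cos (2 * Real.pi * (t - n) - Real.pi / 2) := by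
    rw [← Real.sin_sub_nat_mul_two_pi _ n, Real.cos_sub_pi_div_two]; congr 1; ring
  rw [this, ← Real.cos_pi_div_three, ← Real.cos_abs (2 * Real.pi * (t - n) - Real.pi / 2)]
  have := Real.pi_pos
  apply Real.cos_le_cos_of_nonneg_of_le_pi (abs_nonneg _) (by linarith)
  rw [abs_le]
  constructor <;> nlinarith [ht.1, ht.2]

theorem sin_shift (t : ℝ) :
    -Real.sin (2 * Real.pi * t) = Real.sin (2 * Real.pi * (t - 1/2)) := by
  rw [← Real.sin_sub_pi]; congr 1; ring

open Real Set in
/-- The continuous-clock construction: for a suitable constant `c > 0`, the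
ODE system built from the switch `θ` and the smooth rounding function `r`
realizes, at integer times, the discrete iteration `x ↦ f(x)` of any
continuous integer-preserving function `f` (stroboscopic simulation). -/
theorem continuous_clock_simulates_iteration
    (r : ℝ → ℝ) (hrsmooth : ContDiff ℝ (⊤ : ℕ∞) r)
    (hr : ∀ (n : ℤ) (x : ℝ), x ∈ Icc ((n : ℝ) - 1 / 4) ((n : ℝ) + 1 / 4) →
      r x = n) :
    ∃ c : ℝ, 0 < c ∧
      ∀ f : ℝ → ℝ, Continuous f → (∀ n : ℤ, ∃ m : ℤ, f n = m) →
        ∀ x₀ : ℤ, ∀ y₁ y₂ y₃ : ℝ → ℝ,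
          (∀ t ∈ Ici (0 : ℝ), HasDerivWithinAt y₁
            (c * (f (r (y₂ t)) - y₁ t) ^ 3 * thetaFn (sin (2 * π * y₃ t)))
            (Ici (0 : ℝ)) t) →
          (∀ t ∈ Ici (0 : ℝ), HasDerivWithinAt y₂
            (c * (r (y₁ t) - y₂ t) ^ 3 * thetaFn (-sin (2 * π * y₃ t)))
            (Ici (0 : ℝ)) t) →
          (∀ t ∈ Ici (0 : ℝ), HasDerivWithinAt y₃ 1 (Ici (0 : ℝ)) t) →
          y₁ 0 = (x₀ : ℝ) → y₂ 0 = (x₀ : ℝ) → y₃ 0 = 0 →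
          ∀ n : ℕ, |y₂ n - f^[n] (x₀ : ℝ)| ≤ 1 / 4 ∧
            r (y₂ n) = f^[n] (x₀ : ℝ) := by
  refine ⟨24 * Real.exp 2, by positivity, ?_⟩
  intro f _ hf x₀ y₁ y₂ y₃ h1 h2 h3 i1 i2 i3
  have hy3 : ∀ t, 0 ≤ t → y₃ t = t := by
    intro t ht
    have := clock_const (z := fun t => y₃ t - t) (d := fun _ => 1 - 1) (a := 0) (b := t)
      (fun s hs => (h3 s hs).sub (hasDerivWithinAt_id s _)) le_rfl (by simp) t ⟨ht, le_rfl⟩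
    simp only [i3] at this
    linarith
  have hint : ∀ n : ℕ, ∃ m : ℤ, f^[n] (x₀ : ℝ) = m := by
    intro n
    induction n with
    | zero => exact ⟨x₀, rfl⟩
    | succ n ih =>
      obtain ⟨m, hm⟩ := ih
      rw [Function.iterate_succ_apply', hm]
      exact hf m
  have hround : ∀ (m : ℤ) (x : ℝ), |x - m| ≤ 1/4 → r x = m := by
    intro m x hx
    rw [abs_le] at hx
    exact hr m x ⟨by linarith [hx.1], by linarith [hx.2]⟩
  suffices H : ∀ n : ℕ, |y₂ n - f^[n] (x₀ : ℝ)| ≤ 1 / 4 by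
    intro n
    refine ⟨H n, ?_⟩
    obtain ⟨m, hm⟩ := hint n
    have := H n
    rw [hm] at this ⊢
    exact hround m _ this
  intro n
  induction n with
  | zero => simp [i2]
  | succ n ih =>
    obtain ⟨a, ha⟩ := hint n
    obtain ⟨b, hb⟩ := hf a
    rw [Function.iterate_succ_apply', ha, hb]
    rw [ha] at ih
    have hn : (0 : ℝ) ≤ n := n.cast_nonneg
    have c2 := clock_const h2 (a := n) (b := n + 1/2) hn (by
      intro t ht
      have := sin_first n ht
      rw [hy3 t (hn.trans ht.1), thetaFn, if_neg (by linarith), mul_zero])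
    have k1 : |y₁ (n + 1/2) - b| ≤ 1/4 := by
      apply clock_contract hn h1 (g := fun t => thetaFn (sin (2 * π * t)))
      · intro t ht
        rw [hy3 t (hn.trans ht.1), c2 t ht, hround a _ ih, hb]
      · intro t _
        exact theta_nonneg _
      · intro t ht
        exact theta_half (sin_first_half n ht)
    have hn' : (0 : ℝ) ≤ n + 1/2 := by linarith
    have c1 := clock_const h1 (a := n + 1/2) (b := n + 1/2 + 1/2) hn' (by
      intro t ht
      have := sin_first n (t := t - 1/2) ⟨by linarith [ht.1], by linarith [ht.2]⟩
      rw [← sin_shift] at this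
      rw [hy3 t (hn'.trans ht.1), thetaFn, if_neg (by linarith), mul_zero])
    have k2 : |y₂ (n + 1/2 + 1/2) - b| ≤ 1/4 := by
      apply clock_contract hn' h2 (g := fun t => thetaFn (-sin (2 * π * t)))
      · intro t ht
        rw [hy3 t (hn'.trans ht.1), c1 t ht, hround b _ k1]
      · intro t _
        exact theta_nonneg _
      · intro t ht
        rw [sin_shift]
        exact theta_half (sin_first_half n ⟨by linarith [ht.1], by linarith [ht.2]⟩)
    have e : ((n + 1 : ℕ) : ℝ) = n + 1/2 + 1/2 := by push_cast; ring
    rw [e]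
    exact k2
end
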